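/- arXiv:1607.06677 — 6 statements merged into one kernel-verified Lean document; each statement's English description precedes it below -/
import Mathlib

section
/- There exists a constant C₁ > 0, independent of n, K and M, with the following property. For every integer n ≥ 1, every M > 1, every K > 1, and all functions f₁, f₂ : ℝ → ℂ that are n-times continuously differentiable, supported in a compact subset of (0,1), and satisfy ‖fⱼ‖_{H^n(0,1)} ≤ M (j = 1,2), define ε₁ = ( ∫₀^K ( |∫₀¹ e^{iκx}(f₁(x)−f₂(x)) dx|² + |∫₀¹ e^{−iκx}(f₁(x)−f₂(x)) dx|² ) dκ )^{1/2}. If 0 < ε₁ < 1, then ∫₀¹ |f₁(x)−f₂(x)|² dx ≤ C₁ ( ε₁² + M² / ( K^{2/3} |ln ε₁|^{1/4} / (6n−3)³ )^{2n−1} ). -/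
open MeasureTheory Real
open scoped FourierTransform

lemma prod_erase_range_norm_sub (q : ℕ) : ∀ j ≤ q,
    ∏ i ∈ (Finset.range (q + 1)).erase j, ‖(j : ℂ) - i‖ = j.factorial * (q - j).factorial := by
  induction q with
  | zero => intro j hj; obtain rfl : j = 0 := by omega
            simp
  | succ q ih =>
    intro j hj
    rcases Nat.lt_or_ge q j with h | h
    · obtain rfl : j = q + 1 := by omega
      have : (Finset.range (q + 1 + 1)).erase (q + 1) = Finset.range (q + 1) := by
        ext i; simp; omega
      rw [this, ← Finset.prod_range_reflect, Nat.sub_self, Nat.factorial_zero, Nat.cast_one, mul_one,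
        Nat.factorial_eq_prod_range_add_one, Nat.cast_prod]
      refine Finset.prod_congr rfl fun i hi => ?_
      have hi' : i ≤ q := by simpa [Nat.lt_succ_iff] using hi
      rw [← Nat.cast_sub (by omega), Complex.norm_natCast]
      congr 1; omega
    · have : (Finset.range (q + 1 + 1)).erase j
          = insert (q + 1) ((Finset.range (q + 1)).erase j) := by
        ext i; simp; omega
      rw [this, Finset.prod_insert (by simp), ih j h, norm_sub_rev, ← Nat.cast_sub (by omega),
        Complex.norm_natCast, Nat.succ_sub h, Nat.factorial_succ]
      push_cast
      ring

lemma factorial_le_two_pow_mul {q j : ℕ} (h : j ≤ q) :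
    (q.factorial : ℝ) ≤ 2 ^ q * (j.factorial * (q - j).factorial) := by
  rw [← Nat.choose_mul_factorial_mul_factorial h]
  push_cast
  rw [mul_assoc]
  gcongr
  exact_mod_cast Nat.choose_le_two_pow q j

lemma norm_eval_lagrange_basis_le {m : ℕ} (hm : 0 < m) {T : ℝ} (hT : 1 ≤ T) {u : ℝ}
    (hu : |u| ≤ 3 * T / 2) {j : ℕ} (hj : j < m) :
    ‖(Lagrange.basis (Finset.range m) (fun i : ℕ => (i : ℂ) / (2 * m)) j).eval (u : ℂ)‖
      ≤ (24 * T) ^ m := by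
  obtain ⟨q, rfl⟩ : ∃ q, m = q + 1 := ⟨m - 1, by omega⟩
  have hjq : j ≤ q := by omega
  have hcard : ((Finset.range (q + 1)).erase j).card = q := by
    rw [Finset.card_erase_of_mem (by simpa using hj)]; simp
  have hm0 : (0 : ℝ) < ((q + 1 : ℕ) : ℝ) := by positivity
  set m : ℕ := q + 1 with hmdef
  have h1 : ‖(Lagrange.basis (Finset.range m) (fun i : ℕ => (i : ℂ) / (2 * m)) j).eval (u : ℂ)‖
      = (2 * m) ^ q * (∏ i ∈ (Finset.range m).erase j, ‖(u : ℂ) - i / (2 * m)‖)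
        / (∏ i ∈ (Finset.range m).erase j, ‖(j : ℂ) - i‖) := by
    rw [Lagrange.basis, Polynomial.eval_prod, norm_prod]
    have hpow : (2 * m : ℝ) ^ q = ∏ _i ∈ (Finset.range m).erase j, (2 * m : ℝ) := by
      rw [Finset.prod_const, hcard]
    rw [hpow, ← Finset.prod_mul_distrib, ← Finset.prod_div_distrib]
    refine Finset.prod_congr rfl fun i hi => ?_
    have hne : (j : ℂ) - i ≠ 0 := by
      have := (Finset.mem_erase.1 hi).1
      rw [sub_ne_zero]; exact_mod_cast this.symm
    have hm0' : (m : ℂ) ≠ 0 := by exact_mod_cast hm0.ne'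
    have : ‖(m : ℂ)‖ = m := by simp
    rw [Lagrange.basisDivisor]
    simp only [Polynomial.eval_mul, Polynomial.eval_C, Polynomial.eval_sub, Polynomial.eval_X,
      norm_mul, norm_inv, ← sub_div, norm_div, this]
    rw [Complex.norm_two]
    field_simp
  have h2 : ∏ i ∈ (Finset.range m).erase j, ‖(u : ℂ) - i / (2 * m)‖ ≤ (2 * T) ^ q := by
    rw [← hcard, ← Finset.prod_const]
    refine Finset.prod_le_prod (fun _ _ => norm_nonneg _) fun i hi => ?_
    have hi' : i < m := by simpa using (Finset.mem_erase.1 hi).2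
    have hi'' : (i : ℝ) ≤ m := by exact_mod_cast hi'.le
    calc ‖(u : ℂ) - i / (2 * m)‖ ≤ ‖(u : ℂ)‖ + ‖(i : ℂ) / (2 * m)‖ := norm_sub_le _ _
      _ = |u| + i / (2 * m) := by simp
      _ ≤ 3 * T / 2 + 1 / 2 := by
        refine add_le_add hu ?_
        rw [div_le_div_iff₀ (by positivity) (by positivity)]
        linarith
      _ ≤ 2 * T := by linarith
  rw [h1, prod_erase_range_norm_sub q j hjq]
  have hF := factorial_le_two_pow_mul hjq
  have hq0 : (0 : ℝ) < q.factorial := by positivity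
  calc (2 * m) ^ q * (∏ i ∈ (Finset.range m).erase j, ‖(u : ℂ) - i / (2 * m)‖)
        / (j.factorial * (q - j).factorial)
      ≤ (2 * m) ^ q * (2 * T) ^ q / (q.factorial / 2 ^ q) := by
        gcongr
        rw [div_le_iff₀ (by positivity)]
        linarith
    _ = (8 * T) ^ q * ((m : ℝ) ^ m / m.factorial) := by
        have : (m.factorial : ℝ) = m * q.factorial := by
          rw [hmdef, Nat.factorial_succ]; push_cast; ring
        have h8 : (8 * T) ^ q = 2 ^ q * 2 ^ q * 2 ^ q * T ^ q := by
          rw [← mul_pow, ← mul_pow, ← mul_pow]; norm_num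
        rw [this, show (m : ℝ) ^ m = m ^ q * m by rw [hmdef, pow_succ], h8, mul_pow, mul_pow]
        field_simp
    _ ≤ (8 * T) ^ m * rexp m := by
        gcongr
        · linarith
        · omega
        · exact Real.pow_div_factorial_le_exp _ (by positivity) _
    _ ≤ (8 * T) ^ m * 3 ^ m := by
        gcongr
        rw [← Real.exp_one_pow]
        gcongr
        exact Real.exp_one_lt_d9.le.trans (by norm_num)
    _ = (24 * T) ^ m := by rw [← mul_pow]; ring

lemma pow_div_factorial_le_third_pow {m : ℕ} {T : ℝ} (hT : 1 ≤ T) (hm : 216 * T ≤ m) :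
    (24 * T) ^ m / m.factorial ≤ (1 / 3) ^ m := by
  have hm0 : (0 : ℝ) < m := by linarith
  calc (24 * T) ^ m / m.factorial ≤ (m / 9) ^ m / m.factorial := by
        gcongr; linarith
    _ = (1 / 9) ^ m * ((m : ℝ) ^ m / m.factorial) := by rw [div_pow]; simp; ring
    _ ≤ (1 / 9) ^ m * 3 ^ m := by
        gcongr
        refine (Real.pow_div_factorial_le_exp _ (by positivity) _).trans ?_
        rw [← Real.exp_one_pow]
        gcongr
        exact Real.exp_one_lt_d9.le.trans (by norm_num)
    _ = (1 / 3) ^ m := by rw [← mul_pow]; norm_num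

/-- On the unit interval, `exp (i u x)` is a combination of exponentials with frequencies
in `[0, 1 / 2]`, up to a geometrically small error. -/
lemma exists_exp_interpolation {m : ℕ} {T : ℝ} (hT : 1 ≤ T) (hm : 216 * T ≤ m) {u : ℝ}
    (hu : |u| ≤ 3 * T / 2) :
    ∃ c : ℕ → ℂ, (∀ j ∈ Finset.range m, ‖c j‖ ≤ (24 * T) ^ m) ∧
      ∀ x ∈ Set.Icc (0 : ℝ) 1, ‖Complex.exp (Complex.I * u * x) -
        ∑ j ∈ Finset.range m, c j * Complex.exp (Complex.I * (j / (2 * m) : ℝ) * x)‖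
          ≤ 4 * (1 / 3) ^ m := by
  have hm0 : 0 < m := by
    have : (0 : ℝ) < m := by linarith
    exact_mod_cast this
  have hm0' : (0 : ℝ) < m := by exact_mod_cast hm0
  set v : ℕ → ℂ := fun i => (i : ℂ) / (2 * m) with hv
  set c : ℕ → ℂ := fun j => (Lagrange.basis (Finset.range m) v j).eval (u : ℂ) with hc
  have hcb : ∀ j ∈ Finset.range m, ‖c j‖ ≤ (24 * T) ^ m := fun j hj =>
    norm_eval_lagrange_basis_le hm0 hT hu (by simpa using hj)
  refine ⟨c, hcb, fun x hx => ?_⟩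
  have hvinj : Set.InjOn v (Finset.range m) := by
    intro a _ b _ hab
    have : (m : ℂ) ≠ 0 := by exact_mod_cast hm0.ne'
    simpa [hv, div_left_inj', this] using hab
  set P : Polynomial ℂ := ∑ k ∈ Finset.range m,
    Polynomial.C ((Complex.I * x) ^ k / k.factorial) * Polynomial.X ^ k with hP
  have hPdeg : P.degree < (Finset.range m).card := by
    rw [Finset.card_range]
    refine (Polynomial.degree_sum_le _ _).trans_lt ?_
    rw [Finset.sup_lt_iff (by exact WithBot.bot_lt_coe m)]
    intro k hk
    refine (Polynomial.degree_C_mul_X_pow_le _ _).trans_lt ?_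
    exact_mod_cast Finset.mem_range.1 hk
  have hPe (z : ℂ) : P.eval z = ∑ k ∈ Finset.range m, (Complex.I * z * x) ^ k / k.factorial := by
    rw [hP, Polynomial.eval_finsetSum]
    refine Finset.sum_congr rfl fun k _ => ?_
    simp only [Polynomial.eval_mul, Polynomial.eval_C, Polynomial.eval_pow, Polynomial.eval_X]
    ring
  have hPi : P.eval (u : ℂ) = ∑ j ∈ Finset.range m, c j * P.eval (v j) := by
    conv_lhs => rw [Lagrange.eq_interpolate hvinj hPdeg]
    rw [Lagrange.interpolate_apply, Polynomial.eval_finsetSum]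
    refine Finset.sum_congr rfl fun k _ => ?_
    simp only [Polynomial.eval_mul, Polynomial.eval_C, hc]
    ring
  have herr (y r : ℝ) (hr : |y| ≤ r) (hr' : 2 * r ≤ m) :
      ‖Complex.exp (Complex.I * y * x) - P.eval (y : ℂ)‖ ≤ r ^ m / m.factorial * 2 := by
    have hn : ‖Complex.I * y * x‖ ≤ r := by
      simp only [norm_mul, Complex.norm_I, Complex.norm_real, one_mul, Real.norm_eq_abs,
        abs_of_nonneg hx.1]
      nlinarith [abs_nonneg y, hx.2]
    rw [hPe]
    refine (Complex.exp_bound' ?_).trans ?_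
    · rw [div_le_iff₀ (by positivity)]
      push_cast
      linarith
    · gcongr
  have hvr (j : ℕ) : v j = ((j / (2 * m) : ℝ) : ℂ) := by simp [hv]
  have e1 := herr u (3 * T / 2) hu (by linarith)
  have e2 : ∀ j ∈ Finset.range m,
      ‖c j * (P.eval (v j) - Complex.exp (Complex.I * (j / (2 * m) : ℝ) * x))‖
        ≤ (24 * T) ^ m * ((1 / 2) ^ m / m.factorial * 2) := by
    intro j hj
    rw [norm_mul, norm_sub_rev, hvr]
    have hjm : (j : ℝ) ≤ m := by exact_mod_cast (Finset.mem_range.1 hj).le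
    gcongr
    · exact hcb j hj
    · refine herr _ _ ?_ (by linarith)
      rw [abs_of_nonneg (by positivity), div_le_div_iff₀ (by positivity) (by positivity)]
      linarith
  have hm2 : (m : ℝ) ≤ 2 ^ m := by exact_mod_cast Nat.lt_two_pow_self.le
  calc ‖Complex.exp (Complex.I * u * x) -
        ∑ j ∈ Finset.range m, c j * Complex.exp (Complex.I * (j / (2 * m) : ℝ) * x)‖
      = ‖(Complex.exp (Complex.I * u * x) - P.eval (u : ℂ)) + ∑ j ∈ Finset.range m,
          c j * (P.eval (v j) - Complex.exp (Complex.I * (j / (2 * m) : ℝ) * x))‖ := by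
        rw [hPi]; simp only [mul_sub, Finset.sum_sub_distrib]; congr 1; ring
    _ ≤ (3 * T / 2) ^ m / m.factorial * 2
          + ∑ j ∈ Finset.range m, (24 * T) ^ m * ((1 / 2) ^ m / m.factorial * 2) :=
        (norm_add_le _ _).trans (add_le_add e1 ((norm_sum_le _ _).trans (Finset.sum_le_sum e2)))
    _ = (3 * T / 2) ^ m / m.factorial * 2
          + m * ((24 * T) ^ m * ((1 / 2) ^ m / m.factorial * 2)) := by simp
    _ ≤ (24 * T) ^ m / m.factorial * 2
          + 2 ^ m * ((24 * T) ^ m * ((1 / 2) ^ m / m.factorial * 2)) := by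
        gcongr; linarith
    _ = 4 * ((24 * T) ^ m / m.factorial) := by
        have : (2 : ℝ) ^ m * (1 / 2) ^ m = 1 := by rw [← mul_pow]; norm_num
        linear_combination ((24 * T) ^ m / m.factorial * 2) * this
    _ ≤ 4 * (1 / 3) ^ m := by
        gcongr; exact pow_div_factorial_le_third_pow hT hm

lemma tsum_enorm_sq_fourier_add {f : ℝ → ℂ} (hf : Continuous f)
    (hs : Function.support f ⊆ Set.Ioc 0 1) (t : ℝ) :
    ∑' k : ℤ, ‖𝓕 f (k + t)‖ₑ ^ 2 = ENNReal.ofReal (∫ x in (0 : ℝ)..1, ‖f x‖ ^ 2) := by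
  set g : ℝ → ℂ := fun x => Complex.exp ((-2 * π * t * x : ℝ) * Complex.I) * f x with hg
  have hgc : Continuous g := by fun_prop
  have hgn (x : ℝ) : ‖g x‖ = ‖f x‖ := by
    rw [hg]; simp only [norm_mul, Complex.norm_exp_ofReal_mul_I, one_mul]
  have hL2 : MemLp g 2 (volume.restrict (Set.Ioc (0 : ℝ) 1)) :=
    (hgc.memLp_of_hasCompactSupport
      (HasCompactSupport.intro (K := Set.Icc 0 1) isCompact_Icc (by
        intro x hx
        have : f x = 0 := by
          by_contra h
          exact hx (Set.Ioc_subset_Icc_self (hs h))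
        simp [hg, this]))).restrict _
  have key := hasSum_sq_fourierCoeffOn zero_lt_one hL2
  have hcoef (k : ℤ) : fourierCoeffOn zero_lt_one g k = 𝓕 f (k + t) := by
    rw [fourierCoeffOn_eq_integral, Real.fourier_real_eq_integral_exp_smul]
    rw [← intervalIntegral.integral_eq_integral_of_support_subset (a := 0) (b := 1)
      (fun x hx => hs fun h => hx (by simp [h]))]
    simp only [sub_zero, div_one, one_smul]
    refine intervalIntegral.integral_congr fun x _ => ?_
    simp only [hg, smul_eq_mul, fourier_coe_apply, ← mul_assoc, ← Complex.exp_add]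
    congr 2
    push_cast
    ring
  simp only [hcoef, hgn, sub_zero, inv_one, one_smul] at key
  rw [← key.tsum_eq, ENNReal.ofReal_tsum_of_nonneg (fun _ => by positivity) key.summable]
  refine tsum_congr fun k => ?_
  rw [ENNReal.ofReal_pow (norm_nonneg _), ofReal_norm]

/-- Plancherel's identity for continuous functions supported in the unit interval. -/
lemma lintegral_enorm_sq_fourier {f : ℝ → ℂ} (hf : Continuous f)
    (hs : Function.support f ⊆ Set.Ioc 0 1) :
    ∫⁻ w, ‖𝓕 f w‖ₑ ^ 2 = ENNReal.ofReal (∫ x in (0 : ℝ)..1, ‖f x‖ ^ 2) := by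
  have hcs : HasCompactSupport f :=
    HasCompactSupport.intro (K := Set.Icc 0 1) isCompact_Icc fun x hx => by
      by_contra h
      exact hx (Set.Ioc_subset_Icc_self (hs h))
  have hcont : Continuous (𝓕 f) :=
    VectorFourier.fourierIntegral_continuous Real.continuous_fourierChar
      (by exact continuous_inner) (hf.integrable_of_hasCompactSupport hcs)
  calc ∫⁻ w, ‖𝓕 f w‖ₑ ^ 2
      = ∑' k : ℤ, ∫⁻ w in Set.Ioc (k : ℝ) (k + 1), ‖𝓕 f w‖ₑ ^ 2 := by
        rw [← setLIntegral_univ, ← iUnion_Ioc_intCast ℝ]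
        exact lintegral_iUnion (fun _ => measurableSet_Ioc) (Set.pairwise_disjoint_Ioc_intCast ℝ) _
    _ = ∑' k : ℤ, ∫⁻ t in Set.Ioc (0 : ℝ) 1, ‖𝓕 f (k + t)‖ₑ ^ 2 := by
        refine tsum_congr fun k => ?_
        have := (measurePreserving_add_left volume (k : ℝ)).setLIntegral_comp_preimage_emb
          (measurableEmbedding_addLeft (k : ℝ)) (fun w => ‖𝓕 f w‖ₑ ^ 2)
          (Set.Ioc (k : ℝ) (k + 1))
        rw [← this]
        simp
    _ = ∫⁻ t in Set.Ioc (0 : ℝ) 1, ∑' k : ℤ, ‖𝓕 f (k + t)‖ₑ ^ 2 :=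
        (lintegral_tsum fun k => by
          have : Continuous fun t : ℝ => ‖𝓕 f (k + t)‖ₑ ^ 2 := by fun_prop
          exact this.aemeasurable).symm
    _ = ENNReal.ofReal (∫ x in (0 : ℝ)..1, ‖f x‖ ^ 2) := by
        simp [tsum_enorm_sq_fourier_add hf hs]

/-- The Fourier transform of the restriction of `f` to the unit interval, with kernel
`exp (i κ x)`. -/
noncomputable def unitTransform (f : ℝ → ℂ) (κ : ℝ) : ℂ :=
  ∫ x in (0 : ℝ)..1, Complex.exp (Complex.I * κ * x) * f x

lemma continuous_unitTransform {f : ℝ → ℂ} (hf : Continuous f) :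
    Continuous (unitTransform f) := by
  unfold unitTransform
  exact intervalIntegral.continuous_parametric_intervalIntegral_of_continuous' (by fun_prop) 0 1

lemma fourier_eq_unitTransform {f : ℝ → ℂ} (hs : Function.support f ⊆ Set.Ioc 0 1) (w : ℝ) :
    𝓕 f w = unitTransform f (-2 * π * w) := by
  rw [Real.fourier_real_eq_integral_exp_smul, unitTransform,
    ← intervalIntegral.integral_eq_integral_of_support_subset (a := 0) (b := 1)
      (fun x hx => hs fun h => hx (by simp [h]))]
  refine intervalIntegral.integral_congr fun x _ => ?_
  simp only [smul_eq_mul]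
  congr 2
  push_cast
  ring

lemma integral_sq_norm_le_low_add_high {n : ℕ} {f : ℝ → ℂ} (hf : ContDiff ℝ n f)
    (hs : tsupport f ⊆ Set.Ioo 0 1) {T : ℝ} (hT : 0 < T) :
    ∫ x in (0 : ℝ)..1, ‖f x‖ ^ 2 ≤ (∫ κ in -T..T, ‖unitTransform f κ‖ ^ 2)
      + (T ^ (2 * n))⁻¹ * ∫ x in (0 : ℝ)..1, ‖iteratedDeriv n f x‖ ^ 2 := by
  have hsub : Set.Ioo (0 : ℝ) 1 ⊆ Set.Ioc 0 1 := Set.Ioo_subset_Ioc_self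
  have hs' : Function.support f ⊆ Set.Ioc 0 1 := (subset_tsupport f).trans (hs.trans hsub)
  have hcs : HasCompactSupport f :=
    HasCompactSupport.intro (K := Set.Icc 0 1) isCompact_Icc fun x hx => by
      by_contra h
      exact hx (Set.Ioc_subset_Icc_self (hs' h))
  have hds (k : ℕ) : Function.support (iteratedDeriv k f) ⊆ tsupport f := by
    have := support_iteratedFDeriv_subset (𝕜 := ℝ) (f := f) k
    intro x hx
    refine this fun h => hx ?_
    simp [iteratedDeriv, h]
  have hdc (k : ℕ) (hk : k ≤ n) : Continuous (iteratedDeriv k f) :=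
    hf.continuous_iteratedDeriv k (by exact_mod_cast hk)
  have hdi (k : ℕ) (hk : k ≤ n) : Integrable (iteratedDeriv k f) :=
    (hdc k hk).integrable_of_hasCompactSupport (hcs.mono' (hds k))
  have hF : 𝓕 (iteratedDeriv n f) = fun x : ℝ => (2 * π * Complex.I * x) ^ n • 𝓕 f x :=
    Real.fourier_iteratedDeriv (N := n) (by exact_mod_cast hf)
      (fun k hk => hdi k (by exact_mod_cast hk)) le_rfl
  have P0 := lintegral_enorm_sq_fourier hf.continuous hs'
  have Pn := lintegral_enorm_sq_fourier (hdc n le_rfl) ((hds n).trans (hs.trans hsub))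
  have hI0 : 0 ≤ ∫ x in (0 : ℝ)..1, ‖iteratedDeriv n f x‖ ^ 2 :=
    intervalIntegral.integral_nonneg zero_le_one fun _ _ => by positivity
  have hgc := continuous_unitTransform hf.continuous
  set R : ℝ := T / (2 * π) with hR
  have hR0 : 0 < R := by positivity
  have high : ∫⁻ w in (Set.Ioc (-R) R)ᶜ, ‖𝓕 f w‖ₑ ^ 2
      ≤ ENNReal.ofReal ((T ^ (2 * n))⁻¹ * ∫ x in (0 : ℝ)..1, ‖iteratedDeriv n f x‖ ^ 2) := by
    rw [ENNReal.ofReal_mul (by positivity), ← Pn, ← lintegral_const_mul' _ _ (by simp)]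
    refine (setLIntegral_mono' measurableSet_Ioc.compl fun w hw => ?_).trans
      (setLIntegral_le_lintegral _ _)
    have hw' : R ≤ |w| := by
      by_contra h
      rw [not_le, abs_lt] at h
      exact hw ⟨h.1, h.2.le⟩
    rw [hF, ← ofReal_norm, ← ofReal_norm, ← ENNReal.ofReal_pow (norm_nonneg _),
      ← ENNReal.ofReal_pow (norm_nonneg _), ← ENNReal.ofReal_mul (by positivity)]
    refine ENNReal.ofReal_le_ofReal ?_
    have hTw : T ≤ 2 * π * |w| := by
      rw [hR, div_le_iff₀ (by positivity)] at hw'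
      linarith
    have hn : ‖(2 * π * Complex.I * w : ℂ)‖ = 2 * π * |w| := by
      simp [abs_of_pos Real.pi_pos]
    rw [norm_smul, norm_pow, hn, inv_mul_eq_div, le_div_iff₀ (by positivity), mul_pow, ← pow_mul,
      mul_comm, mul_comm n 2]
    gcongr
  have low : ∫⁻ w in Set.Ioc (-R) R, ‖𝓕 f w‖ₑ ^ 2
      ≤ ENNReal.ofReal (∫ κ in -T..T, ‖unitTransform f κ‖ ^ 2) := by
    have e1 : ∫⁻ w in Set.Ioc (-R) R, ‖𝓕 f w‖ₑ ^ 2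
        = ENNReal.ofReal (∫ w in -R..R, ‖unitTransform f (-2 * π * w)‖ ^ 2) := by
      rw [intervalIntegral.integral_of_le (by linarith),
        ofReal_integral_eq_lintegral_ofReal]
      · refine lintegral_congr fun w => ?_
        rw [fourier_eq_unitTransform hs', ENNReal.ofReal_pow (norm_nonneg _), ofReal_norm]
      · have : Continuous fun w : ℝ => ‖unitTransform f (-2 * π * w)‖ ^ 2 := by fun_prop
        exact (this.integrableOn_Icc (a := -R) (b := R)).mono_set Set.Ioc_subset_Icc_self
      · exact ae_of_all _ fun _ => by positivity
    rw [e1]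
    refine ENNReal.ofReal_le_ofReal ?_
    have hpi : (-2 * π) ≠ 0 := by simp [Real.pi_ne_zero]
    have h2 := intervalIntegral.integral_comp_mul_left
      (fun κ => ‖unitTransform f κ‖ ^ 2) hpi (a := -R) (b := R)
    have hRT : -2 * π * R = -T := by rw [hR]; field_simp
    have hRT' : -2 * π * -R = T := by rw [mul_neg, hRT, neg_neg]
    rw [h2, hRT, hRT', intervalIntegral.integral_symm, smul_eq_mul]
    have h0 : 0 ≤ ∫ κ in -T..T, ‖unitTransform f κ‖ ^ 2 :=
      intervalIntegral.integral_nonneg (by linarith) fun _ _ => by positivity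
    rw [mul_neg, ← neg_mul, ← inv_neg]
    refine mul_le_of_le_one_left h0 (inv_le_one_of_one_le₀ ?_)
    linarith [Real.pi_gt_three]
  have h0 : 0 ≤ ∫ κ in -T..T, ‖unitTransform f κ‖ ^ 2 :=
    intervalIntegral.integral_nonneg (by linarith) fun _ _ => by positivity
  rw [← ENNReal.ofReal_le_ofReal_iff (by positivity), ENNReal.ofReal_add h0 (by positivity), ← P0,
    ← lintegral_add_compl _ (measurableSet_Ioc (a := -R) (b := R))]
  exact add_le_add low high
lemma norm_unitTransform_le_of_interpolation {f : ℝ → ℂ} (hf : Continuous f) {m : ℕ} {T ε s : ℝ}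
    (hT : 1 ≤ T) (hm : 216 * T ≤ m) (hs : |s| ≤ T)
    (hε : ∫ κ in (0 : ℝ)..1, ‖unitTransform f κ‖ ≤ ε) :
    ‖unitTransform f s‖ ≤
      2 * m * (24 * T) ^ m * ε + 4 * (1 / 3) ^ m * ∫ x in (0 : ℝ)..1, ‖f x‖ := by
  have hFc := continuous_unitTransform hf
  have hm0 : (0 : ℝ) < m := by linarith
  set I := ∫ x in (0 : ℝ)..1, ‖f x‖ with hI
  have pointwise : ∀ t ∈ Set.Icc (0 : ℝ) (1 / 2), ‖unitTransform f s‖ ≤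
      (∑ j ∈ Finset.range m, (24 * T) ^ m * ‖unitTransform f (t + j / (2 * m))‖)
        + 4 * (1 / 3) ^ m * I := by
    intro t ht
    have hu : |s - t| ≤ 3 * T / 2 := by
      rw [abs_le] at hs ⊢
      constructor <;> linarith [ht.1, ht.2, hs.1, hs.2]
    obtain ⟨c, hc, hce⟩ := exists_exp_interpolation hT hm hu
    have hdiff : unitTransform f s - ∑ j ∈ Finset.range m,
        c j * unitTransform f (t + j / (2 * m)) = ∫ x in (0 : ℝ)..1,
          Complex.exp (Complex.I * t * x) * (Complex.exp (Complex.I * (s - t : ℝ) * x) -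
            ∑ j ∈ Finset.range m, c j * Complex.exp (Complex.I * (j / (2 * m) : ℝ) * x)) * f x := by
      simp only [unitTransform]
      simp_rw [← intervalIntegral.integral_const_mul]
      rw [← intervalIntegral.integral_finsetSum fun j _ =>
          (Continuous.intervalIntegrable (by fun_prop) _ _),
        ← intervalIntegral.integral_sub (Continuous.intervalIntegrable (by fun_prop) _ _)
          (Continuous.intervalIntegrable (by fun_prop) _ _)]
      refine intervalIntegral.integral_congr fun x _ => ?_
      simp only [mul_sub, sub_mul, Finset.mul_sum, Finset.sum_mul]
      congr 1
      · rw [← Complex.exp_add]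
        congr 2
        push_cast
        ring
      · refine Finset.sum_congr rfl fun j _ => ?_
        have : Complex.exp (Complex.I * (t + j / (2 * m) : ℝ) * x) =
            Complex.exp (Complex.I * t * x) * Complex.exp (Complex.I * (j / (2 * m) : ℝ) * x) := by
          rw [← Complex.exp_add]
          congr 1
          push_cast
          ring
        rw [this]
        ring
    have hbound : ‖unitTransform f s - ∑ j ∈ Finset.range m,
        c j * unitTransform f (t + j / (2 * m))‖ ≤ 4 * (1 / 3) ^ m * I := by
      rw [hdiff, hI, ← intervalIntegral.integral_const_mul]
      refine intervalIntegral.norm_integral_le_of_norm_le zero_le_one (ae_of_all _ fun x hx => ?_)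
        (Continuous.intervalIntegrable (by fun_prop) _ _)
      rw [norm_mul, norm_mul, show Complex.I * t * x = (t * x : ℝ) * Complex.I by push_cast; ring,
        Complex.norm_exp_ofReal_mul_I, one_mul]
      gcongr
      exact hce x (Set.Ioc_subset_Icc_self hx)
    have hsum : ‖∑ j ∈ Finset.range m, c j * unitTransform f (t + j / (2 * m))‖ ≤
        ∑ j ∈ Finset.range m, (24 * T) ^ m * ‖unitTransform f (t + j / (2 * m))‖ := by
      refine (norm_sum_le _ _).trans (Finset.sum_le_sum fun j hj => ?_)
      rw [norm_mul]
      gcongr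
      exact hc j hj
    have := norm_le_norm_add_norm_sub' (unitTransform f s)
      (∑ j ∈ Finset.range m, c j * unitTransform f (t + j / (2 * m)))
    linarith
  have shifted : ∀ j ∈ Finset.range m,
      ∫ t in (0 : ℝ)..(1 / 2), (24 * T) ^ m * ‖unitTransform f (t + j / (2 * m))‖
        ≤ (24 * T) ^ m * ε := by
    intro j hj
    have hj' : (j : ℝ) ≤ m := by exact_mod_cast (Finset.mem_range.1 hj).le
    have hx0 : (0 : ℝ) ≤ j / (2 * m) := by positivity
    have hx1 : (j : ℝ) / (2 * m) ≤ 1 / 2 := by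
      rw [div_le_div_iff₀ (by positivity) (by positivity)]; linarith
    rw [intervalIntegral.integral_const_mul]
    gcongr
    rw [intervalIntegral.integral_comp_add_right (fun κ => ‖unitTransform f κ‖)]
    refine le_trans ?_ hε
    refine intervalIntegral.integral_mono_interval (by linarith) (by linarith) (by linarith)
      (ae_of_all _ fun _ => norm_nonneg _) (hFc.norm.intervalIntegrable _ _)
  have hint := intervalIntegral.integral_mono_on (μ := volume) (a := 0) (b := 1 / 2)
    (f := fun _ => ‖unitTransform f s‖) (by norm_num) (by simp)
    (Continuous.intervalIntegrable (by fun_prop) _ _) pointwise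
  rw [intervalIntegral.integral_add (Continuous.intervalIntegrable (by fun_prop) _ _) (by simp),
    intervalIntegral.integral_finsetSum fun j _ =>
      (Continuous.intervalIntegrable (by fun_prop) _ _)] at hint
  have := Finset.sum_le_sum shifted
  simp only [intervalIntegral.integral_const, smul_eq_mul, sub_zero, Finset.sum_const,
    Finset.card_range, nsmul_eq_mul] at hint this
  linarith

lemma integral_norm_le_of_integral_sq_le {g : ℝ → ℂ} (hg : Continuous g) {b : ℝ} (hb : 0 < b)
    (h : ∫ x in (0 : ℝ)..1, ‖g x‖ ^ 2 ≤ b ^ 2) : ∫ x in (0 : ℝ)..1, ‖g x‖ ≤ b := by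
  have hle : ∫ x in (0 : ℝ)..1, ‖g x‖ ≤ ∫ x in (0 : ℝ)..1, (‖g x‖ ^ 2 / (2 * b) + b / 2) := by
    refine intervalIntegral.integral_mono_on zero_le_one
      (Continuous.intervalIntegrable (by fun_prop) _ _)
      (Continuous.intervalIntegrable (by fun_prop) _ _) fun x _ => ?_
    have : ‖g x‖ ^ 2 / (2 * b) + b / 2 - ‖g x‖ = (‖g x‖ - b) ^ 2 / (2 * b) := by
      field_simp; ring
    have h2 : 0 ≤ (‖g x‖ - b) ^ 2 / (2 * b) := by positivity
    linarith
  rw [intervalIntegral.integral_add (Continuous.intervalIntegrable (by fun_prop) _ _) (by simp),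
    intervalIntegral.integral_div] at hle
  simp only [intervalIntegral.integral_const, smul_eq_mul, sub_zero, one_mul] at hle
  have : (∫ x in (0 : ℝ)..1, ‖g x‖ ^ 2) / (2 * b) ≤ b / 2 := by
    rw [div_le_div_iff₀ (by positivity) (by positivity)]
    nlinarith
  linarith

lemma two_mul_pow_mul_le_inv_pow {n m : ℕ} (hn : 1 ≤ n) {a ε : ℝ} (ha : 1 ≤ a) (hε0 : 0 ≤ ε)
    (hm : (m : ℝ) ≤ 217 * n * a ^ 3)
    (hε : ε ≤ rexp (-(a ^ 4 * (6 * n - 3) ^ 12))) :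
    2 * m * (24 * a ^ 3) ^ m * ε ≤ 2 * ((a ^ 3) ^ n)⁻¹ := by
  have hn' : (1 : ℝ) ≤ n := by exact_mod_cast hn
  have hm2 : (m : ℝ) ≤ 2 ^ m := by exact_mod_cast Nat.lt_two_pow_self.le
  have ha3 : a ^ 3 ≤ rexp (3 * a) := by
    rw [show (3 : ℝ) * a = (3 : ℕ) * a by norm_num, Real.exp_nat_mul]
    gcongr
    linarith [Real.add_one_le_exp a]
  have h48 : 48 * a ^ 3 ≤ rexp (7 * a) := by
    have h4 : (48 : ℝ) ≤ rexp (4 * a) := by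
      calc (48 : ℝ) ≤ 2.7 ^ 4 := by norm_num
        _ ≤ rexp 1 ^ 4 := by
          gcongr; exact le_trans (by norm_num) Real.exp_one_gt_d9.le
        _ = rexp 4 := by rw [← Real.exp_nat_mul]; norm_num
        _ ≤ rexp (4 * a) := by gcongr; linarith
    calc 48 * a ^ 3 ≤ rexp (4 * a) * rexp (3 * a) := by gcongr
      _ = rexp (7 * a) := by rw [← Real.exp_add]; ring_nf
  have hA : 2 * m * (24 * a ^ 3) ^ m ≤ 2 * rexp (1519 * n * a ^ 4) := by
    calc 2 * m * (24 * a ^ 3) ^ m ≤ 2 * 2 ^ m * (24 * a ^ 3) ^ m := by gcongr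
      _ = 2 * (48 * a ^ 3) ^ m := by rw [mul_assoc, ← mul_pow]; ring_nf
      _ ≤ 2 * rexp (7 * a) ^ m := by gcongr
      _ = 2 * rexp (m * (7 * a)) := by rw [Real.exp_nat_mul]
      _ ≤ 2 * rexp (1519 * n * a ^ 4) := by
        refine mul_le_mul_of_nonneg_left (Real.exp_le_exp.2 ?_) zero_le_two
        calc m * (7 * a) ≤ 217 * n * a ^ 3 * (7 * a) := by gcongr
          _ = 1519 * n * a ^ 4 := by ring
  have hB : (a ^ 3) ^ n ≤ rexp (n * a ^ 4) := by
    rw [Real.exp_nat_mul]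
    gcongr
    have : a ^ 3 ≤ a ^ 4 := pow_le_pow_right₀ ha (by norm_num)
    linarith [Real.add_one_le_exp (a ^ 4)]
  have hN : (1520 : ℝ) * n ≤ (6 * n - 3) ^ 12 := by
    calc (1520 : ℝ) * n ≤ 3 ^ 11 * (3 * n) := by norm_num; linarith
      _ ≤ (6 * n - 3) ^ 11 * (6 * n - 3) := by
        have h6 : (3 : ℝ) ≤ 6 * n - 3 := by linarith
        gcongr
        linarith
      _ = (6 * n - 3) ^ 12 := by ring
  rw [← div_eq_mul_inv, le_div_iff₀ (by positivity)]
  calc 2 * m * (24 * a ^ 3) ^ m * ε * (a ^ 3) ^ n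
      ≤ 2 * rexp (1519 * n * a ^ 4) * rexp (-(a ^ 4 * (6 * n - 3) ^ 12)) * rexp (n * a ^ 4) := by
        gcongr
    _ = 2 * rexp (1519 * n * a ^ 4 + -(a ^ 4 * (6 * n - 3) ^ 12) + n * a ^ 4) := by
        rw [Real.exp_add, Real.exp_add]; ring
    _ ≤ 2 * rexp 0 := by
        gcongr
        have : a ^ 4 * (1520 * n) ≤ a ^ 4 * (6 * n - 3) ^ 12 := by gcongr
        linarith
    _ = 2 := by simp

lemma norm_unitTransform_le_inv_pow {n : ℕ} (hn : 1 ≤ n) {f : ℝ → ℂ} (hf : Continuous f)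
    {M a ε s : ℝ} (hM : 1 < M) (ha : 1 ≤ a) (hfM : ∫ x in (0 : ℝ)..1, ‖f x‖ ^ 2 ≤ (2 * M) ^ 2)
    (hε0 : 0 < ε) (hε : ε ≤ rexp (-(a ^ 4 * (6 * n - 3) ^ 12)))
    (hF : ∫ κ in (0 : ℝ)..1, ‖unitTransform f κ‖ ^ 2 ≤ ε ^ 2) (hs : |s| ≤ a ^ 3) :
    ‖unitTransform f s‖ ≤ 10 * M * ((a ^ 3) ^ n)⁻¹ := by
  have hn' : (1 : ℝ) ≤ n := by exact_mod_cast hn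
  have ha3 : 1 ≤ a ^ 3 := one_le_pow₀ ha
  have hna : 1 ≤ n * a ^ 3 := one_le_mul_of_one_le_of_one_le hn' ha3
  set m : ℕ := ⌈216 * n * a ^ 3⌉₊ with hmdef
  have hm1 : 216 * n * a ^ 3 ≤ m := Nat.le_ceil _
  have hm2 : (m : ℝ) ≤ 217 * n * a ^ 3 := by
    have := (Nat.ceil_lt_add_one (show 0 ≤ 216 * n * a ^ 3 by positivity)).le
    linarith
  have hm3 : 216 * a ^ 3 ≤ m := by nlinarith
  have hFε := integral_norm_le_of_integral_sq_le (continuous_unitTransform hf) hε0 hF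
  have hfI := integral_norm_le_of_integral_sq_le hf (by linarith) hfM
  have key := norm_unitTransform_le_of_interpolation hf ha3 hm3 hs hFε
  have h1 := two_mul_pow_mul_le_inv_pow hn ha hε0.le hm2 hε
  have h2 : (1 / 3 : ℝ) ^ m ≤ ((a ^ 3) ^ n)⁻¹ := by
    rw [div_pow, one_pow, one_div]
    gcongr
    calc (a ^ 3) ^ n ≤ rexp (a ^ 3) ^ n := by
          gcongr
          linarith [Real.add_one_le_exp (a ^ 3)]
      _ = rexp (n * a ^ 3) := (Real.exp_nat_mul _ _).symm
      _ ≤ rexp m := by gcongr; linarith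
      _ = rexp 1 ^ m := (Real.exp_one_pow m).symm
      _ ≤ 3 ^ m := by
        gcongr
        exact Real.exp_one_lt_d9.le.trans (by norm_num)
  calc ‖unitTransform f s‖ ≤ 2 * ((a ^ 3) ^ n)⁻¹ + 4 * ((a ^ 3) ^ n)⁻¹ * (2 * M) := by
        refine key.trans (add_le_add h1 ?_)
        gcongr
        exact intervalIntegral.integral_nonneg zero_le_one fun _ _ => norm_nonneg _
    _ ≤ 10 * M * ((a ^ 3) ^ n)⁻¹ := by
        have : 0 < ((a ^ 3) ^ n)⁻¹ := by positivity
        nlinarith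

lemma integral_sq_norm_le_of_data {n : ℕ} (hn : 1 ≤ n) {f : ℝ → ℂ} (hf : ContDiff ℝ n f)
    (hs : tsupport f ⊆ Set.Ioo 0 1) {M K a ε : ℝ} (hM : 1 < M) (hK : 1 < K) (ha : 0 < a)
    (hfM : ∫ x in (0 : ℝ)..1, ‖f x‖ ^ 2 ≤ (2 * M) ^ 2)
    (hnM : ∫ x in (0 : ℝ)..1, ‖iteratedDeriv n f x‖ ^ 2 ≤ (2 * M) ^ 2)
    (hε0 : 0 < ε) (hεK : ∫ κ in -K..K, ‖unitTransform f κ‖ ^ 2 = ε ^ 2)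
    (hεa : K < a ^ 3 → ε ≤ rexp (-(a ^ 4 * (6 * n - 3) ^ 12))) :
    ∫ x in (0 : ℝ)..1, ‖f x‖ ^ 2 ≤ 204 * (ε ^ 2 + M ^ 2 / (a ^ 3) ^ (2 * n - 1)) := by
  have hFc := continuous_unitTransform hf.continuous
  have ha3 : 0 < a ^ 3 := by positivity
  have hsub (b c : ℝ) (hb : -K ≤ b) (hbc : b ≤ c) (hc : c ≤ K) :
      ∫ κ in b..c, ‖unitTransform f κ‖ ^ 2 ≤ ε ^ 2 := by
    rw [← hεK]
    exact intervalIntegral.integral_mono_interval hb hbc hc (ae_of_all _ fun _ => by positivity)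
      ((hFc.norm.pow 2).intervalIntegrable _ _)
  rcases lt_or_ge (a ^ 3) 1 with h1 | h1
  · have : M ^ 2 ≤ M ^ 2 / (a ^ 3) ^ (2 * n - 1) :=
      le_div_self (by positivity) (by positivity) (pow_le_one₀ ha3.le h1.le)
    nlinarith [sq_nonneg ε]
  have ha1 : 1 ≤ a := by
    by_contra h
    exact absurd (pow_lt_one₀ ha.le (not_le.1 h) three_ne_zero) (not_lt.2 h1)
  have hsplit := integral_sq_norm_le_low_add_high hf hs ha3
  have hpow : a ^ 3 * ((a ^ 3) ^ (2 * n))⁻¹ = ((a ^ 3) ^ (2 * n - 1))⁻¹ := by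
    obtain ⟨k, hk⟩ : ∃ k, 2 * n = k + 1 := ⟨2 * n - 1, by omega⟩
    rw [hk, Nat.add_sub_cancel, pow_succ' (a ^ 3) k, mul_inv, mul_inv_cancel_left₀ ha3.ne']
  have hhigh : ((a ^ 3) ^ (2 * n))⁻¹ * ∫ x in (0 : ℝ)..1, ‖iteratedDeriv n f x‖ ^ 2
      ≤ 4 * (M ^ 2 / (a ^ 3) ^ (2 * n - 1)) := by
    calc _ ≤ ((a ^ 3) ^ (2 * n - 1))⁻¹ * (2 * M) ^ 2 := by
          gcongr
          · exact intervalIntegral.integral_nonneg zero_le_one fun _ _ => by positivity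
          · omega
      _ = _ := by ring
  have hD : 0 ≤ M ^ 2 / (a ^ 3) ^ (2 * n - 1) := by positivity
  rcases le_or_gt (a ^ 3) K with h | h
  · have := hsub (-a ^ 3) (a ^ 3) (by linarith) (by linarith) h
    nlinarith [sq_nonneg ε]
  · have hlow : ∫ κ in -a ^ 3..a ^ 3, ‖unitTransform f κ‖ ^ 2
        ≤ 200 * (M ^ 2 / (a ^ 3) ^ (2 * n - 1)) := by
      calc ∫ κ in -a ^ 3..a ^ 3, ‖unitTransform f κ‖ ^ 2
          ≤ ∫ κ in -a ^ 3..a ^ 3, (10 * M * ((a ^ 3) ^ n)⁻¹) ^ 2 := by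
            refine intervalIntegral.integral_mono_on (by linarith)
              ((hFc.norm.pow 2).intervalIntegrable _ _) (by simp) fun κ hκ => ?_
            gcongr
            exact norm_unitTransform_le_inv_pow hn hf.continuous hM ha1 hfM hε0 (hεa h)
              (hsub 0 1 (by linarith) zero_le_one hK.le) (abs_le.2 hκ)
        _ = 200 * M ^ 2 * (a ^ 3 * ((a ^ 3) ^ (2 * n))⁻¹) := by
            simp only [intervalIntegral.integral_const, smul_eq_mul, mul_comm 2 n, pow_mul]
            ring
        _ = 200 * (M ^ 2 / (a ^ 3) ^ (2 * n - 1)) := by rw [hpow]; ring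
    nlinarith [sq_nonneg ε]

lemma integral_norm_sub_sq_le {g₁ g₂ : ℝ → ℂ} (h₁ : Continuous g₁) (h₂ : Continuous g₂) {M : ℝ}
    (hM₁ : ∫ x in (0 : ℝ)..1, ‖g₁ x‖ ^ 2 ≤ M ^ 2) (hM₂ : ∫ x in (0 : ℝ)..1, ‖g₂ x‖ ^ 2 ≤ M ^ 2) :
    ∫ x in (0 : ℝ)..1, ‖g₁ x - g₂ x‖ ^ 2 ≤ (2 * M) ^ 2 := by
  have hle : ∫ x in (0 : ℝ)..1, ‖g₁ x - g₂ x‖ ^ 2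
      ≤ ∫ x in (0 : ℝ)..1, (2 * ‖g₁ x‖ ^ 2 + 2 * ‖g₂ x‖ ^ 2) := by
    refine intervalIntegral.integral_mono_on zero_le_one
      (Continuous.intervalIntegrable (by fun_prop) _ _)
      (Continuous.intervalIntegrable (by fun_prop) _ _) fun x _ => ?_
    calc ‖g₁ x - g₂ x‖ ^ 2 ≤ (‖g₁ x‖ + ‖g₂ x‖) ^ 2 := by gcongr; exact norm_sub_le _ _
      _ ≤ 2 * ‖g₁ x‖ ^ 2 + 2 * ‖g₂ x‖ ^ 2 := by nlinarith [sq_nonneg (‖g₁ x‖ - ‖g₂ x‖)]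
  rw [intervalIntegral.integral_add (Continuous.intervalIntegrable (by fun_prop) _ _)
    (Continuous.intervalIntegrable (by fun_prop) _ _), intervalIntegral.integral_const_mul,
    intervalIntegral.integral_const_mul] at hle
  linarith

lemma integral_sq_iteratedDeriv_le_of_sobolev {n k : ℕ} (hk : k ≤ n) {f : ℝ → ℂ} {M : ℝ}
    (hM : 0 ≤ M)
    (h : √(∑ k ∈ Finset.range (n + 1), ∫ x in (0 : ℝ)..1, ‖iteratedDeriv k f x‖ ^ 2) ≤ M) :
    ∫ x in (0 : ℝ)..1, ‖iteratedDeriv k f x‖ ^ 2 ≤ M ^ 2 := by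
  refine le_trans ?_ ((Real.sqrt_le_left hM).1 h)
  exact Finset.single_le_sum
    (f := fun k => ∫ x in (0 : ℝ)..1, ‖iteratedDeriv k f x‖ ^ 2)
    (fun _ _ => intervalIntegral.integral_nonneg zero_le_one fun _ _ => by positivity)
    (by simpa [Nat.lt_succ_iff] using hk)

lemma integral_add_integral_neg_eq {g : ℝ → ℝ} (hg : Continuous g) (K : ℝ) :
    ∫ κ in (0 : ℝ)..K, (g κ + g (-κ)) = ∫ κ in -K..K, g κ := by
  rw [intervalIntegral.integral_add (hg.intervalIntegrable _ _)
    (Continuous.intervalIntegrable (by fun_prop) _ _), intervalIntegral.integral_comp_neg,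
    add_comm, neg_zero, intervalIntegral.integral_add_adjacent_intervals
    (hg.intervalIntegrable _ _) (hg.intervalIntegrable _ _)]

lemma pow_mul_pow_le_of_lt_cube {K L N a : ℝ} (hK : 0 < K) (hL : 0 < L) (hN : 0 < N) (ha : 0 < a)
    (haK : a ^ 3 = K ^ ((2 : ℝ) / 3) * L ^ ((1 : ℝ) / 4) / N ^ 3) (h : K < a ^ 3) :
    a ^ 4 * N ^ 12 ≤ L := by
  have h1 : K ^ ((2 : ℝ) / 3) ≤ a ^ 2 := by
    calc K ^ ((2 : ℝ) / 3) ≤ (a ^ 3) ^ ((2 : ℝ) / 3) := by gcongr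
      _ = a ^ 2 := by
        rw [← Real.rpow_natCast a 3, ← Real.rpow_mul ha.le, ← Real.rpow_natCast a 2]
        norm_num
  have h2 : a * N ^ 3 ≤ L ^ ((1 : ℝ) / 4) := by
    rw [eq_div_iff (by positivity)] at haK
    have : a ^ 2 * (a * N ^ 3) ≤ a ^ 2 * L ^ ((1 : ℝ) / 4) := by
      calc a ^ 2 * (a * N ^ 3) = K ^ ((2 : ℝ) / 3) * L ^ ((1 : ℝ) / 4) := by rw [← haK]; ring
        _ ≤ a ^ 2 * L ^ ((1 : ℝ) / 4) := by gcongr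
    exact le_of_mul_le_mul_left this (by positivity)
  calc a ^ 4 * N ^ 12 = (a * N ^ 3) ^ 4 := by ring
    _ ≤ (L ^ ((1 : ℝ) / 4)) ^ 4 := by gcongr
    _ = L := by
      rw [← Real.rpow_natCast, ← Real.rpow_mul hL.le]
      norm_num



/-- Theorem 2.1 of the paper (estimate for the mean `f`), deterministic
reformulation: increasing stability for the inverse source problem. -/
theorem stability_mean :
    ∃ C₁ > (0:ℝ), ∀ (n : ℕ), 1 ≤ n → ∀ (M K : ℝ), 1 < M → 1 < K →
    ∀ (f₁ f₂ : ℝ → ℂ), ContDiff ℝ n f₁ → ContDiff ℝ n f₂ →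
    tsupport f₁ ⊆ Set.Ioo 0 1 → tsupport f₂ ⊆ Set.Ioo 0 1 →
    Real.sqrt (∑ k ∈ Finset.range (n+1),
      ∫ x in (0:ℝ)..1, ‖iteratedDeriv k f₁ x‖^2) ≤ M →
    Real.sqrt (∑ k ∈ Finset.range (n+1),
      ∫ x in (0:ℝ)..1, ‖iteratedDeriv k f₂ x‖^2) ≤ M →
    ∀ ε₁ : ℝ,
      ε₁ = Real.sqrt (∫ κ in (0:ℝ)..K,
        (‖∫ x in (0:ℝ)..1, Complex.exp (Complex.I * κ * x) * (f₁ x - f₂ x)‖^2 +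
         ‖∫ x in (0:ℝ)..1, Complex.exp (-(Complex.I * κ * x)) * (f₁ x - f₂ x)‖^2)) →
      0 < ε₁ → ε₁ < 1 →
      (∫ x in (0:ℝ)..1, ‖f₁ x - f₂ x‖^2) ≤
        C₁ * (ε₁^2 +
          M^2 / (K^((2:ℝ)/3) * |Real.log ε₁|^((1:ℝ)/4) / (6*(n:ℝ)-3)^3)^(2*(n:ℝ)-1)) := by
  refine ⟨204, by norm_num, ?_⟩
  intro n hn M K hM hK f₁ f₂ hf₁ hf₂ hs₁ hs₂ hM₁ hM₂ ε hε hε0 hε1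
  have hn' : (1 : ℝ) ≤ n := by exact_mod_cast hn
  have hM0 : 0 ≤ M := by linarith
  have hf : ContDiff ℝ n (f₁ - f₂) := hf₁.sub hf₂
  have hs : tsupport (f₁ - f₂) ⊆ Set.Ioo 0 1 :=
    (tsupport_sub f₁ f₂).trans (Set.union_subset hs₁ hs₂)
  have hL2 (k : ℕ) (hk : k ≤ n) :
      ∫ x in (0 : ℝ)..1, ‖iteratedDeriv k (f₁ - f₂) x‖ ^ 2 ≤ (2 * M) ^ 2 := by
    have hk' : (k : WithTop ℕ∞) ≤ n := by exact_mod_cast hk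
    have := integral_norm_sub_sq_le (hf₁.continuous_iteratedDeriv k hk')
      (hf₂.continuous_iteratedDeriv k hk') (integral_sq_iteratedDeriv_le_of_sobolev hk hM0 hM₁)
      (integral_sq_iteratedDeriv_le_of_sobolev hk hM0 hM₂)
    convert this using 5 with x
    exact iteratedDeriv_sub (hf₁.contDiffAt.of_le hk') (hf₂.contDiffAt.of_le hk')
  have hεK : ∫ κ in -K..K, ‖unitTransform (f₁ - f₂) κ‖ ^ 2 = ε ^ 2 := by
    have hg : Continuous fun κ => ‖unitTransform (f₁ - f₂) κ‖ ^ 2 :=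
      (continuous_unitTransform hf.continuous).norm.pow 2
    rw [hε, Real.sq_sqrt
      (intervalIntegral.integral_nonneg (by linarith) fun _ _ => by positivity),
      ← integral_add_integral_neg_eq hg]
    simp [unitTransform]
  have hlog : Real.log ε < 0 := Real.log_neg hε0 hε1
  have hL : 0 < |Real.log ε| := abs_pos.2 hlog.ne
  have hN : 0 < 6 * (n : ℝ) - 3 := by linarith
  set X := K ^ ((2 : ℝ) / 3) * |Real.log ε| ^ ((1 : ℝ) / 4) / (6 * (n : ℝ) - 3) ^ 3 with hX
  have hX0 : 0 < X := by positivity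
  set a := X ^ ((1 : ℝ) / 3) with hadef
  have ha : 0 < a := by positivity
  have ha3 : a ^ 3 = X := by
    rw [hadef, ← Real.rpow_natCast, ← Real.rpow_mul hX0.le]
    norm_num
  have hexp : X ^ (2 * (n : ℝ) - 1) = (a ^ 3) ^ (2 * n - 1) := by
    rw [ha3, ← Real.rpow_natCast, Nat.cast_sub (by omega)]
    push_cast
    rfl
  rw [hexp]
  refine integral_sq_norm_le_of_data hn hf hs hM hK ha (by simpa using hL2 0 (Nat.zero_le n))
    (hL2 n le_rfl) hε0 hεK fun h => ?_
  have := pow_mul_pow_le_of_lt_cube (by linarith) hL hN ha (ha3.trans hX) h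
  rw [abs_of_neg hlog] at this
  calc ε = rexp (Real.log ε) := (Real.exp_log hε0).symm
    _ ≤ _ := by gcongr; linarith
end

section
/- There exists a constant C₂ > 0, independent of n, K and M, with the following property. For every integer n ≥ 1, every M > 1, every K > 1, and all functions g₁, g₂ : ℝ → ℂ that are n-times continuously differentiable, supported in a compact subset of (0,1), and satisfy ‖gⱼ‖_{H^n(0,1)} ≤ M (j = 1,2), define ε₂ = ( ∫₀^K ( |∫₀¹ e^{2iκx}(g₁(x)−g₂(x)) dx|² + |∫₀¹ e^{−2iκx}(g₁(x)−g₂(x)) dx|² ) dκ )^{1/2}. If 0 < ε₂ < 1, then ∫₀¹ |g₁(x)−g₂(x)|² dx ≤ C₂ ( ε₂² + M² / ( K^{2/3} |ln ε₂|^{1/4} / (6n−3)³ )^{2n−1} ). -/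
open MeasureTheory Real

/-- The Fourier transform on the unit interval, at frequency `2κ`. -/
noncomputable def unitFourier (f : ℝ → ℂ) (κ : ℝ) : ℂ :=
  ∫ x in (0:ℝ)..1, Complex.exp (2 * Complex.I * κ * x) * f x

theorem continuous_unitFourier {f : ℝ → ℂ} (hf : Continuous f) : Continuous (unitFourier f) := by
  unfold unitFourier
  apply intervalIntegral.continuous_parametric_intervalIntegral_of_continuous'
  fun_prop

theorem hasSum_sq_norm_unitFourier {f : ℝ → ℂ} (hf : Continuous f) (θ : ℝ) :
    HasSum (fun n : ℤ => ‖unitFourier f (π * (n + θ))‖ ^ 2) (∫ x in (0:ℝ)..1, ‖f x‖ ^ 2) := by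
  have hg : Continuous fun x : ℝ => Complex.exp (2 * Complex.I * (π * θ : ℝ) * x) * f x := by
    fun_prop
  have hL2 : MemLp (fun x : ℝ => Complex.exp (2 * Complex.I * (π * θ : ℝ) * x) * f x) 2
      (volume.restrict (Set.Ioc 0 1)) :=
    (memLp_two_iff_integrable_sq_norm hg.aestronglyMeasurable).mpr
      (hg.norm.pow 2).integrableOn_Ioc
  have h := (Equiv.neg ℤ).hasSum_iff.mpr (hasSum_sq_fourierCoeffOn zero_lt_one hL2)
  convert h using 1
  · ext n
    simp only [Function.comp_apply, Equiv.neg_apply, fourierCoeffOn_eq_integral, fourier_coe_apply]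
    simp only [unitFourier, sub_zero, div_one, one_smul, smul_eq_mul, ← mul_assoc, ← Complex.exp_add]
    congr 2
    refine intervalIntegral.integral_congr fun x _ => ?_
    congr 2
    push_cast
    ring
  · simp only [sub_zero, inv_one, one_smul, norm_mul]
    refine intervalIntegral.integral_congr fun x _ => ?_
    simp [Complex.norm_exp]

theorem lintegral_sq_enorm_unitFourier {f : ℝ → ℂ} (hf : Continuous f) :
    ∫⁻ u : ℝ, ENNReal.ofReal (‖unitFourier f (π * u)‖ ^ 2) =
      ENNReal.ofReal (∫ x in (0:ℝ)..1, ‖f x‖ ^ 2) := by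
  have hc := continuous_unitFourier hf
  rw [← setLIntegral_univ, ← iUnion_Ioc_intCast ℝ, lintegral_iUnion (fun _ => measurableSet_Ioc)
    (Set.pairwise_disjoint_Ioc_intCast ℝ)]
  have hshift (n : ℤ) : ∫⁻ u in Set.Ioc (n : ℝ) (n + 1), ENNReal.ofReal (‖unitFourier f (π * u)‖ ^ 2)
      = ∫⁻ θ in Set.Ioc (0 : ℝ) 1, ENNReal.ofReal (‖unitFourier f (π * (n + θ))‖ ^ 2) := by
    have := (measurePreserving_add_left volume (n : ℝ)).setLIntegral_comp_preimage
      (s := Set.Ioc (n : ℝ) (n + 1)) measurableSet_Ioc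
      (f := fun u => ENNReal.ofReal (‖unitFourier f (π * u)‖ ^ 2)) (by fun_prop)
    rw [← this]
    simp
  simp_rw [hshift]
  rw [← lintegral_tsum (fun n => by fun_prop)]
  have hpt (θ : ℝ) : ∑' n : ℤ, ENNReal.ofReal (‖unitFourier f (π * (n + θ))‖ ^ 2) =
      ENNReal.ofReal (∫ x in (0:ℝ)..1, ‖f x‖ ^ 2) := by
    rw [← (hasSum_sq_norm_unitFourier hf θ).tsum_eq, ENNReal.ofReal_tsum_of_nonneg
      (fun _ => by positivity) (hasSum_sq_norm_unitFourier hf θ).summable]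
  simp_rw [hpt]
  simp

theorem integrable_sq_norm_unitFourier {f : ℝ → ℂ} (hf : Continuous f) :
    Integrable fun κ => ‖unitFourier f κ‖ ^ 2 := by
  have hc := continuous_unitFourier hf
  rw [← integrable_comp_mul_left_iff _ pi_ne_zero]
  refine ⟨by fun_prop, ?_⟩
  rw [hasFiniteIntegral_iff_ofReal (Filter.Eventually.of_forall fun _ => by positivity),
    lintegral_sq_enorm_unitFourier hf]
  exact ENNReal.ofReal_lt_top

theorem integral_sq_norm_unitFourier {f : ℝ → ℂ} (hf : Continuous f) :
    ∫ κ, ‖unitFourier f κ‖ ^ 2 = π * ∫ x in (0:ℝ)..1, ‖f x‖ ^ 2 := by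
  have hc := continuous_unitFourier hf
  have h1 : ∫ u, ‖unitFourier f (π * u)‖ ^ 2 = ∫ x in (0:ℝ)..1, ‖f x‖ ^ 2 := by
    rw [integral_eq_lintegral_of_nonneg_ae (Filter.Eventually.of_forall fun _ => by positivity)
      (by fun_prop), lintegral_sq_enorm_unitFourier hf, ENNReal.toReal_ofReal]
    exact intervalIntegral.integral_nonneg zero_le_one fun _ _ => by positivity
  rw [← h1, Measure.integral_comp_mul_left (fun κ => ‖unitFourier f κ‖ ^ 2) π,
    abs_of_pos (inv_pos.mpr pi_pos), smul_eq_mul, mul_inv_cancel_left₀ pi_ne_zero]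

theorem unitFourier_deriv {f : ℝ → ℂ} (hf : ContDiff ℝ 1 f) (h0 : f 0 = 0) (h1 : f 1 = 0) (κ : ℝ) :
    unitFourier (deriv f) κ = -(2 * Complex.I * κ) * unitFourier f κ := by
  have he (x : ℝ) : HasDerivAt (fun x : ℝ => Complex.exp (2 * Complex.I * κ * x))
      (2 * Complex.I * κ * Complex.exp (2 * Complex.I * κ * x)) x := by
    have h : HasDerivAt (fun x : ℝ => 2 * Complex.I * κ * (x : ℂ)) (2 * Complex.I * κ) x := by
      simpa using (Complex.ofRealCLM.hasDerivAt (x := x)).const_mul (2 * Complex.I * κ)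
    simpa [mul_comm] using h.cexp
  have hd : Continuous (deriv f) := hf.continuous_deriv le_rfl
  unfold unitFourier
  rw [intervalIntegral.integral_mul_deriv_eq_deriv_mul (fun x _ => he x)
    (fun x _ => (hf.differentiable one_ne_zero x).hasDerivAt)
    (Continuous.intervalIntegrable (by fun_prop) _ _) (hd.intervalIntegrable _ _), h0, h1,
    ← intervalIntegral.integral_const_mul]
  simp [mul_assoc]

theorem tsupport_iteratedDeriv_subset_tsupport {f : ℝ → ℂ} (k : ℕ) :
    tsupport (iteratedDeriv k f) ⊆ tsupport f := by
  induction k with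
  | zero => simp
  | succ k ih =>
    rw [iteratedDeriv_succ]
    exact (tsupport_deriv_subset ..).trans ih

theorem unitFourier_iteratedDeriv {f : ℝ → ℂ} {n : ℕ} (hf : ContDiff ℝ n f)
    (hs : tsupport f ⊆ Set.Ioo 0 1) (κ : ℝ) :
    unitFourier (iteratedDeriv n f) κ = (-(2 * Complex.I * κ)) ^ n * unitFourier f κ := by
  induction n with
  | zero => simp
  | succ n ih =>
    have hz {x : ℝ} (hx : x ∉ Set.Ioo (0 : ℝ) 1) : iteratedDeriv n f x = 0 :=
      image_eq_zero_of_notMem_tsupport fun h => hx (hs (tsupport_iteratedDeriv_subset_tsupport n h))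
    have hd : ContDiff ℝ 1 (iteratedDeriv n f) := by
      rw [iteratedDeriv_eq_iterate]
      exact ContDiff.iterate_deriv' 1 n (by simpa [add_comm] using hf)
    rw [iteratedDeriv_succ, unitFourier_deriv hd (hz (by simp)) (hz (by simp)),
      ih (hf.of_le (by norm_cast; omega)), pow_succ']
    ring

/-- The energy of a smooth function is controlled by its low frequencies, up to the energy of
its `n`-th derivative divided by the `2n`-th power of the cut-off. -/
theorem energy_le_lowFrequency_add {f : ℝ → ℂ} {n : ℕ} (hf : ContDiff ℝ n f)
    (hs : tsupport f ⊆ Set.Ioo 0 1) {R : ℝ} (hR : 0 < R) :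
    π * ∫ x in (0:ℝ)..1, ‖f x‖ ^ 2 ≤
      (∫ κ in (0:ℝ)..R, (‖unitFourier f κ‖ ^ 2 + ‖unitFourier f (-κ)‖ ^ 2)) +
        π * ((∫ x in (0:ℝ)..1, ‖iteratedDeriv n f x‖ ^ 2) / (2 * R) ^ (2 * n)) := by
  have hc := continuous_unitFourier hf.continuous
  have hi := integrable_sq_norm_unitFourier hf.continuous
  have hdc : Continuous (iteratedDeriv n f) := hf.continuous_iteratedDeriv n le_rfl
  have hlow : ∫ κ in (0:ℝ)..R, (‖unitFourier f κ‖ ^ 2 + ‖unitFourier f (-κ)‖ ^ 2) =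
      ∫ κ, (Set.Ioc (-R) R).indicator (fun κ => ‖unitFourier f κ‖ ^ 2) κ := by
    rw [integral_indicator measurableSet_Ioc, ← intervalIntegral.integral_of_le (by linarith),
      intervalIntegral.integral_add (Continuous.intervalIntegrable (by fun_prop) _ _)
        (Continuous.intervalIntegrable (by fun_prop) _ _),
      intervalIntegral.integral_comp_neg (fun κ => ‖unitFourier f κ‖ ^ 2), neg_zero, add_comm,
      intervalIntegral.integral_add_adjacent_intervals (Continuous.intervalIntegrable (by fun_prop) _ _)
        (Continuous.intervalIntegrable (by fun_prop) _ _)]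
  rw [← integral_sq_norm_unitFourier hf.continuous, hlow, ← mul_div_assoc,
    ← integral_sq_norm_unitFourier hdc, ← integral_div, ← integral_add
      (hi.indicator measurableSet_Ioc) ((integrable_sq_norm_unitFourier hdc).div_const _)]
  refine integral_mono hi ((hi.indicator measurableSet_Ioc).add
    ((integrable_sq_norm_unitFourier hdc).div_const _)) fun κ => ?_
  simp only [Set.indicator_apply]
  split_ifs with hκ
  · exact le_add_of_nonneg_right (by positivity)
  · have habs : R ≤ |κ| := by
      rw [Set.mem_Ioc, not_and_or, not_lt, not_le] at hκ
      rcases hκ with h | h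
      · exact (by linarith : R ≤ -κ).trans (neg_le_abs κ)
      · exact h.le.trans (le_abs_self κ)
    rw [zero_add, le_div_iff₀ (by positivity), unitFourier_iteratedDeriv hf hs, norm_mul, norm_pow,
      mul_pow _ ‖_‖, ← pow_mul, mul_comm, mul_comm n 2]
    simp only [norm_neg, norm_mul, Complex.norm_I, Complex.norm_real, Complex.norm_ofNat, mul_one,
      norm_eq_abs]
    gcongr

theorem prod_erase_abs_sub_eq_factorial (j k : ℕ) :
    ∏ i ∈ (Finset.range (j + k + 1)).erase j, |(j : ℝ) - i| = j.factorial * k.factorial := by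
  induction k with
  | zero =>
    rw [add_zero, Finset.range_add_one, Finset.erase_insert Finset.notMem_range_self,
      ← Finset.prod_range_reflect, Nat.factorial_zero, Nat.cast_one, mul_one,
      ← Finset.prod_range_add_one_eq_factorial, Nat.cast_prod]
    refine Finset.prod_congr rfl fun i hi => ?_
    rw [Finset.mem_range] at hi
    rw [Nat.sub_sub, Nat.cast_sub (by omega), abs_of_nonneg (by push_cast; linarith)]
    push_cast
    ring
  | succ k ih =>
    rw [← add_assoc, Finset.range_add_one, Finset.erase_insert_of_ne (by omega),
      Finset.prod_insert (by simp), ih, Nat.factorial_succ, abs_of_nonpos (by push_cast; linarith)]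
    push_cast
    ring

/-- Growth of a complex polynomial outside a set of well separated nodes. -/
theorem norm_eval_le_of_separated_nodes {P : Polynomial ℂ} {d : ℕ} (hP : P.degree < (d + 1 : ℕ))
    {v : ℕ → ℝ} {δ r m : ℝ} (hδ : 0 < δ) (x : ℝ)
    (hsep : ∀ i ∈ Finset.range (d + 1), ∀ j ∈ Finset.range (d + 1),
      δ * |(i : ℝ) - j| ≤ |v i - v j|)
    (hdist : ∀ i ∈ Finset.range (d + 1), |x - v i| ≤ r)
    (hm : ∀ i ∈ Finset.range (d + 1), ‖P.eval (v i : ℂ)‖ ≤ m) :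
    ‖P.eval (x : ℂ)‖ ≤ m * ((2 * r / δ) ^ d / d.factorial) := by
  have hr : 0 ≤ r := (abs_nonneg _).trans (hdist 0 (by simp))
  have hm0 : 0 ≤ m := (norm_nonneg _).trans (hm 0 (by simp))
  have hinj : Set.InjOn (fun i => (v i : ℂ)) (Finset.range (d + 1)) := by
    intro i hi j hj hij
    have h := hsep i hi j hj
    rw [Complex.ofReal_inj.mp hij, sub_self, abs_zero] at h
    have h0 : |(i : ℝ) - j| = 0 :=
      le_antisymm (nonpos_of_mul_nonpos_right h hδ) (abs_nonneg _)
    exact_mod_cast sub_eq_zero.mp (abs_eq_zero.mp h0)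
  rw [Lagrange.eq_interpolate (f := P) (s := Finset.range (d + 1)) hinj (by simpa using hP),
    Lagrange.interpolate_apply, Polynomial.eval_finsetSum]
  have hterm : ∀ j ∈ Finset.range (d + 1),
      ‖(Polynomial.C (P.eval (v j : ℂ)) *
        Lagrange.basis (Finset.range (d + 1)) (fun i => (v i : ℂ)) j).eval (x : ℂ)‖ ≤
      m * (r / δ) ^ d / d.factorial * d.choose j := by
    intro j hj
    obtain ⟨k, rfl⟩ : ∃ k, d = j + k := ⟨d - j, by rw [Finset.mem_range] at hj; omega⟩
    have hcard : ((Finset.range (j + k + 1)).erase j).card = j + k := by simp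
    rw [Polynomial.eval_mul, Polynomial.eval_C, norm_mul, Lagrange.basis, Polynomial.eval_prod,
      norm_prod]
    have hprod : ∏ i ∈ (Finset.range (j + k + 1)).erase j,
        ‖(Lagrange.basisDivisor (v j : ℂ) (v i)).eval (x : ℂ)‖ ≤
        ∏ i ∈ (Finset.range (j + k + 1)).erase j, (r / δ * |(j : ℝ) - i|⁻¹) := by
      refine Finset.prod_le_prod (fun _ _ => norm_nonneg _) fun i hi => ?_
      obtain ⟨hne, hi⟩ := Finset.mem_erase.mp hi
      have hpos : 0 < |(j : ℝ) - i| := abs_pos.mpr (sub_ne_zero.mpr (by exact_mod_cast hne.symm))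
      simp only [Lagrange.basisDivisor, Polynomial.eval_mul, Polynomial.eval_C,
        Polynomial.eval_sub, Polynomial.eval_X, ← Complex.ofReal_sub, ← Complex.ofReal_inv,
        norm_mul, Complex.norm_real, norm_eq_abs, abs_inv]
      calc |v j - v i|⁻¹ * |x - v i| ≤ (δ * |(j : ℝ) - i|)⁻¹ * r := by
            gcongr
            · exact hsep j hj i hi
            · exact hdist i hi
        _ = r / δ * |(j : ℝ) - i|⁻¹ := by rw [mul_inv]; ring
    rw [Finset.prod_mul_distrib, Finset.prod_const, hcard, Finset.prod_inv_distrib,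
      prod_erase_abs_sub_eq_factorial] at hprod
    refine (mul_le_mul (hm j hj) hprod (Finset.prod_nonneg fun _ _ => norm_nonneg _) hm0).trans_eq ?_
    have hch : ((j + k).choose j : ℝ) * j.factorial * k.factorial = (j + k).factorial := by
      rw [Nat.choose_symm_add]
      exact_mod_cast Nat.add_choose_mul_factorial_mul_factorial j k
    rw [← hch]
    have : ((j + k).choose j : ℝ) ≠ 0 := by
      exact_mod_cast (Nat.choose_pos (Nat.le_add_right j k)).ne'
    field_simp
  refine (norm_sum_le_of_le _ hterm).trans_eq ?_
  rw [← Finset.mul_sum, ← Nat.cast_sum, Nat.sum_range_choose]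
  push_cast
  rw [mul_div_assoc 2 r, mul_pow]
  ring

theorem exists_le_div_of_integral_le {g : ℝ → ℝ} (hg : Continuous g) {a b E : ℝ} (hab : a < b)
    (hE : ∫ x in a..b, g x ≤ E) : ∃ x ∈ Set.Icc a b, g x ≤ E / (b - a) := by
  obtain ⟨x, hx, hmin⟩ :=
    isCompact_Icc.exists_isMinOn (Set.nonempty_Icc.mpr hab.le) hg.continuousOn
  refine ⟨x, hx, ?_⟩
  rw [le_div_iff₀ (sub_pos.mpr hab)]
  refine le_trans ?_ hE
  have := intervalIntegral.integral_mono_on (μ := volume) hab.le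
    ((continuous_const (y := g x)).intervalIntegrable a b) (hg.intervalIntegrable a b) (fun y hy => hmin hy)
  simpa [mul_comm] using this

/-- A nonnegative function with small integral is small at well separated points. -/
theorem exists_separated_nodes {g : ℝ → ℝ} (hg : Continuous g) (hg0 : ∀ x, 0 ≤ g x) {K E : ℝ}
    (hK : 0 < K) {N : ℕ} (hN : 0 < N) (hE : ∫ x in (0:ℝ)..K, g x ≤ E) :
    ∃ v : ℕ → ℝ, (∀ i ∈ Finset.range N, v i ∈ Set.Icc 0 K ∧ g (v i) ≤ E / (K / (2 * N))) ∧
      ∀ i j : ℕ, K / (2 * N) * |(i : ℝ) - j| ≤ |v i - v j| := by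
  have hN' : (0 : ℝ) < N := by exact_mod_cast hN
  set δ := K / (2 * N) with hδ
  have hδ0 : 0 < δ := by positivity
  have hNδ : 2 * N * δ = K := by rw [hδ]; field_simp
  have hex (i : ℕ) : ∃ x ∈ Set.Icc (2 * i * δ) (2 * i * δ + δ),
      i ∈ Finset.range N → x ∈ Set.Icc 0 K ∧ g x ≤ E / δ := by
    by_cases hi : i ∈ Finset.range N
    · have hiN : (i : ℝ) + 1 ≤ N := by exact_mod_cast Finset.mem_range.mp hi
      have hle : 2 * i * δ + δ ≤ K := by nlinarith
      have hsub : Set.Icc (2 * i * δ) (2 * i * δ + δ) ⊆ Set.Icc 0 K :=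
        Set.Icc_subset_Icc (by positivity) hle
      have hint : ∫ x in (2 * i * δ)..(2 * i * δ + δ), g x ≤ E :=
        (intervalIntegral.integral_mono_interval (by positivity) (by linarith) hle
          (Filter.Eventually.of_forall hg0) (hg.intervalIntegrable _ _)).trans hE
      obtain ⟨x, hx, hgx⟩ := exists_le_div_of_integral_le hg (by linarith) hint
      exact ⟨x, hx, fun _ => ⟨hsub hx, by simpa using hgx⟩⟩
    · exact ⟨2 * i * δ, ⟨le_rfl, by linarith⟩, fun h => absurd h hi⟩
  choose v hv hv' using hex
  refine ⟨v, hv', ?_⟩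
  have key {i j : ℕ} (hij : i ≤ j) : δ * |(i : ℝ) - j| ≤ |v i - v j| := by
    rcases hij.eq_or_lt with rfl | hlt
    · simp
    · have hlt' : (i : ℝ) + 1 ≤ j := by exact_mod_cast hlt
      rw [abs_sub_comm, abs_sub_comm (v i), abs_of_nonneg (by linarith)]
      refine le_trans ?_ (le_abs_self _)
      have h1 := (hv i).2
      have h2 := (hv j).1
      nlinarith
  intro i j
  rcases le_total i j with h | h
  · exact key h
  · rw [abs_sub_comm, abs_sub_comm (v i)]
    exact key h

theorem exp_sub_sum_le_pow_div_factorial_mul_exp {x : ℝ} (hx : 0 ≤ x) (n : ℕ) :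
    exp x - ∑ m ∈ Finset.range n, x ^ m / m.factorial ≤ x ^ n / n.factorial * exp x := by
  have hs : HasSum (fun m => x ^ m / (m.factorial : ℝ)) (exp x) := by
    rw [exp_eq_exp_ℝ]
    exact NormedSpace.expSeries_div_hasSum_exp x
  refine hasSum_le (fun k => ?_) ((hasSum_nat_add_iff' n).mpr hs)
    (hs.mul_left (x ^ n / n.factorial))
  rw [div_mul_div_comm, ← pow_add, add_comm n k]
  gcongr
  rw [mul_comm]
  exact_mod_cast Nat.le_of_dvd (Nat.factorial_pos _) (Nat.factorial_mul_factorial_dvd_factorial_add k n)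

theorem norm_exp_sub_sum_le_pow_div_factorial_mul_exp (z : ℂ) (n : ℕ) :
    ‖Complex.exp z - ∑ m ∈ Finset.range n, z ^ m / m.factorial‖ ≤
      ‖z‖ ^ n / n.factorial * exp ‖z‖ :=
  (Complex.norm_exp_sub_sum_le_exp_norm_sub_sum z n).trans
    (exp_sub_sum_le_pow_div_factorial_mul_exp (norm_nonneg z) n)

theorem exists_polynomial_norm_unitFourier_sub_le {f : ℝ → ℂ} (hf : Continuous f) (N : ℕ) :
    ∃ P : Polynomial ℂ, P.degree < N ∧ ∀ κ : ℝ, ‖unitFourier f κ - P.eval (κ : ℂ)‖ ≤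
      (2 * |κ|) ^ N / N.factorial * exp (2 * |κ|) * ∫ x in (0:ℝ)..1, ‖f x‖ := by
  refine ⟨∑ k ∈ Finset.range N, Polynomial.C ((2 * Complex.I) ^ k / k.factorial *
    ∫ x in (0:ℝ)..1, (x : ℂ) ^ k * f x) * Polynomial.X ^ k, ?_, fun κ => ?_⟩
  · refine (Polynomial.degree_sum_le _ _).trans_lt ((Finset.sup_lt_iff (WithBot.bot_lt_coe N)).mpr
      fun k hk => (Polynomial.degree_C_mul_X_pow_le k _).trans_lt ?_)
    exact WithBot.coe_lt_coe.mpr (Finset.mem_range.mp hk)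
  · have heval : (∑ k ∈ Finset.range N, Polynomial.C ((2 * Complex.I) ^ k / k.factorial *
        ∫ x in (0:ℝ)..1, (x : ℂ) ^ k * f x) * Polynomial.X ^ k).eval (κ : ℂ) =
        ∫ x in (0:ℝ)..1,
          (∑ k ∈ Finset.range N, (2 * Complex.I * κ * x) ^ k / k.factorial) * f x := by
      simp_rw [Finset.sum_mul]
      rw [intervalIntegral.integral_finsetSum
        (fun k _ => Continuous.intervalIntegrable (by fun_prop) _ _), Polynomial.eval_finsetSum]
      refine Finset.sum_congr rfl fun k _ => ?_
      rw [Polynomial.eval_mul, Polynomial.eval_C, Polynomial.eval_pow, Polynomial.eval_X,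
        mul_right_comm, ← intervalIntegral.integral_const_mul]
      refine intervalIntegral.integral_congr fun x _ => ?_
      simp only [mul_pow]
      ring
    rw [heval, unitFourier, ← intervalIntegral.integral_sub
      (Continuous.intervalIntegrable (by fun_prop) _ _)
      (Continuous.intervalIntegrable (by fun_prop) _ _), ← intervalIntegral.integral_const_mul]
    refine intervalIntegral.norm_integral_le_of_norm_le zero_le_one
      (Filter.Eventually.of_forall fun x hx => ?_)
      (Continuous.intervalIntegrable (by fun_prop) _ _)
    have hnorm : ‖2 * Complex.I * κ * x‖ ≤ 2 * |κ| := by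
      simp only [norm_mul, Complex.norm_I, Complex.norm_real, Complex.norm_ofNat, mul_one,
        norm_eq_abs, abs_of_pos hx.1]
      exact mul_le_of_le_one_right (by positivity) hx.2
    rw [← sub_mul, norm_mul]
    gcongr
    refine (norm_exp_sub_sum_le_pow_div_factorial_mul_exp _ N).trans ?_
    gcongr

/-- Quantitative continuation of the transform from the frequencies `[0, K]` to `[-s, s]`. -/
theorem norm_unitFourier_le_of_lowFrequency {f : ℝ → ℂ} (hf : Continuous f) {K s ε B : ℝ}
    (hK : 1 ≤ K) (hs : K ≤ s) (hε : 0 ≤ ε) (hB : ∫ x in (0:ℝ)..1, ‖f x‖ ≤ B)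
    (hF : ∫ κ in (0:ℝ)..K, ‖unitFourier f κ‖ ^ 2 ≤ ε ^ 2) {N : ℕ} (hN : 0 < N) {κ : ℝ}
    (hκ : |κ| ≤ s) :
    ‖unitFourier f κ‖ ≤ 2 * B * exp (2 * s) * ((16 * exp 1 * s) ^ N / N.factorial) +
      (8 * exp 1 * (s / K)) ^ N * (2 * N) * ε := by
  have hc := continuous_unitFourier hf
  have hB0 : 0 ≤ B :=
    (intervalIntegral.integral_nonneg zero_le_one fun _ _ => norm_nonneg _).trans hB
  have hN1 : (1 : ℝ) ≤ N := by exact_mod_cast hN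
  have hK0 : 0 < K := by linarith
  have hs0 : 0 < s := by linarith
  obtain ⟨P, hPdeg, hP⟩ := exists_polynomial_norm_unitFourier_sub_le hf N
  obtain ⟨v, hv, hsep⟩ := exists_separated_nodes (g := fun κ => ‖unitFourier f κ‖ ^ 2)
    (by fun_prop) (fun _ => by positivity) hK0 hN hF
  have herr {y R : ℝ} (hy : |y| ≤ R) (hRs : R ≤ s) :
      ‖unitFourier f y - P.eval (y : ℂ)‖ ≤ (2 * R) ^ N / N.factorial * exp (2 * s) * B := by
    have := (abs_nonneg y).trans hy
    refine (hP y).trans ?_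
    have h0 : 0 ≤ ∫ x in (0:ℝ)..1, ‖f x‖ :=
      intervalIntegral.integral_nonneg zero_le_one fun _ _ => norm_nonneg _
    gcongr
    exact hy.trans hRs
  have hnode : ∀ i ∈ Finset.range N, ‖P.eval (v i : ℂ)‖ ≤
      2 * N * ε + (2 * K) ^ N / N.factorial * exp (2 * s) * B := by
    intro i hi
    obtain ⟨⟨hv0, hvK⟩, hvi⟩ := hv i hi
    have h1 : ‖unitFourier f (v i)‖ ≤ 2 * N * ε := by
      refine le_of_sq_le_sq ?_ (by positivity)
      refine hvi.trans ?_
      rw [div_div_eq_mul_div, div_le_iff₀ hK0]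
      have : ε ^ 2 * (2 * N) * 1 ≤ ε ^ 2 * (2 * N) * (2 * N * K) := by
        gcongr
        nlinarith
      nlinarith
    have h2 := herr (by rwa [abs_of_nonneg hv0]) hs
    have h3 := norm_sub_norm_le (P.eval (v i : ℂ)) (unitFourier f (v i))
    rw [norm_sub_rev] at h3
    linarith
  obtain ⟨d, rfl⟩ : ∃ d, N = d + 1 := ⟨N - 1, by omega⟩
  have hdist : ∀ i ∈ Finset.range (d + 1), |κ - v i| ≤ 2 * s := by
    intro i hi
    obtain ⟨hv0, hvK⟩ := (hv i hi).1
    rw [abs_le] at hκ ⊢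
    constructor <;> linarith
  have hPκ := norm_eval_le_of_separated_nodes hPdeg (by positivity) κ
    (fun i _ j _ => hsep i j) hdist hnode
  have hΛ : (2 * (2 * s) / (K / (2 * (d + 1 : ℕ)))) ^ d / d.factorial ≤
      (8 * exp 1 * (s / K)) ^ (d + 1) := by
    have he : (1 : ℝ) ≤ exp 1 := one_le_exp zero_le_one
    have hsK : 1 ≤ s / K := (one_le_div hK0).mpr hs
    have h1 : 2 * (2 * s) / (K / (2 * (d + 1 : ℕ))) = 8 * (s / K) * (d + 1 : ℕ) := by
      field_simp
      ring
    have h2 := pow_div_factorial_le_exp (x := ((d + 1 : ℕ) : ℝ)) (by positivity) d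
    rw [h1, mul_pow, mul_div_assoc]
    calc (8 * (s / K)) ^ d * (((d + 1 : ℕ) : ℝ) ^ d / d.factorial)
        ≤ (8 * (s / K)) ^ (d + 1) * exp ((d + 1 : ℕ) : ℝ) := by
          gcongr
          · linarith
          · omega
      _ = (8 * exp 1 * (s / K)) ^ (d + 1) := by
          rw [← mul_one ((d + 1 : ℕ) : ℝ), exp_nat_mul, ← mul_pow]
          ring
  have hκerr := herr hκ le_rfl
  have htri := norm_le_norm_add_norm_sub' (unitFourier f κ) (P.eval (κ : ℂ))
  have hPκ' := hPκ.trans (mul_le_mul_of_nonneg_left hΛ (by positivity))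
  have hKs : (8 * exp 1 * (s / K)) ^ (d + 1) * (2 * K) ^ (d + 1) = (16 * exp 1 * s) ^ (d + 1) := by
    rw [← mul_pow]
    congr 1
    field_simp
    ring
  have h2s : (2 * s) ^ (d + 1) ≤ (16 * exp 1 * s) ^ (d + 1) := by
    have he : (1 : ℝ) ≤ exp 1 := one_le_exp zero_le_one
    gcongr
    linarith
  calc ‖unitFourier f κ‖ ≤ (2 * (d + 1 : ℕ) * ε +
          (2 * K) ^ (d + 1) / (d + 1).factorial * exp (2 * s) * B) *
          (8 * exp 1 * (s / K)) ^ (d + 1) +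
          (2 * s) ^ (d + 1) / (d + 1).factorial * exp (2 * s) * B := by linarith
    _ = (8 * exp 1 * (s / K)) ^ (d + 1) * (2 * (d + 1 : ℕ)) * ε +
          ((8 * exp 1 * (s / K)) ^ (d + 1) * (2 * K) ^ (d + 1)) / (d + 1).factorial *
            exp (2 * s) * B +
          (2 * s) ^ (d + 1) / (d + 1).factorial * exp (2 * s) * B := by ring
    _ ≤ (8 * exp 1 * (s / K)) ^ (d + 1) * (2 * (d + 1 : ℕ)) * ε +
          (16 * exp 1 * s) ^ (d + 1) / (d + 1).factorial * exp (2 * s) * B +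
          (16 * exp 1 * s) ^ (d + 1) / (d + 1).factorial * exp (2 * s) * B := by
        rw [hKs]
        gcongr
    _ = _ := by ring

theorem pow_div_factorial_le_exp_neg {s : ℝ} (hs : 0 ≤ s) {N : ℕ} (hN : 16 * exp 5 * s ≤ N) :
    (16 * exp 1 * s) ^ N / N.factorial ≤ exp (-(3 * s)) := by
  have h := pow_div_factorial_le_exp (x := 16 * exp 5 * s) (by positivity) N
  have he : (exp 4) ^ N = exp (4 * N) := by rw [← exp_nat_mul, mul_comm]
  have h5 : 16 * exp 5 * s = exp 4 * (16 * exp 1 * s) := by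
    rw [show (5 : ℝ) = 4 + 1 by norm_num, exp_add]
    ring
  have hsN : s ≤ N := by
    have : (1 : ℝ) ≤ exp 5 := one_le_exp (by norm_num)
    nlinarith
  have h' : exp (4 * N) * ((16 * exp 1 * s) ^ N / N.factorial) ≤ exp N := by
    rw [← he, ← mul_div_assoc, ← mul_pow, ← h5]
    exact h.trans (exp_le_exp.mpr hN)
  rw [← le_div_iff₀' (exp_pos _), ← exp_sub] at h'
  exact h'.trans (exp_le_exp.mpr (by linarith))

theorem exists_pow_mul_exp_neg_le :
    ∃ C > (0 : ℝ), ∀ (t s q : ℝ) (N : ℕ), 1 ≤ t → 1 ≤ s → s ≤ t ^ 6 → 0 ≤ q → q ≤ t ^ 2 →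
      (N : ℝ) ≤ 16 * exp 5 * s + 1 →
      (8 * exp 1 * q) ^ N * (2 * N) * exp (-t ^ 8) ≤ C * exp (-s) := by
  set D : ℝ := 8 * (16 * exp 5 + 1) + 1 with hD
  have hD0 : 0 ≤ D := by positivity
  refine ⟨exp (D ^ 8), exp_pos _, fun t s q N ht hs hst hq hqt hN => ?_⟩
  have ht0 : 0 ≤ t := by linarith
  have hbase : 8 * exp 1 * q ≤ exp (6 * t) := by
    have h8 : (8 : ℝ) ≤ exp (3 * t) := by
      have h2 : (2 : ℝ) ≤ exp t := by linarith [add_one_le_exp t]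
      calc (8 : ℝ) = 2 ^ 3 := by norm_num
        _ ≤ exp t ^ 3 := by gcongr
        _ = exp (3 * t) := by rw [← exp_nat_mul]; norm_num
    have hq' : q ≤ exp (2 * t) := by
      have h1 : t ≤ exp t := by linarith [add_one_le_exp t]
      calc q ≤ t ^ 2 := hqt
        _ ≤ exp t ^ 2 := by gcongr
        _ = exp (2 * t) := by rw [← exp_nat_mul]; norm_num
    calc 8 * exp 1 * q ≤ exp (3 * t) * exp t * exp (2 * t) := by gcongr
      _ = exp (6 * t) := by rw [← exp_add, ← exp_add]; ring_nf
  have hpow : (8 * exp 1 * q) ^ N * (2 * N) ≤ exp (8 * t * N) := by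
    have h2N : (2 * N : ℝ) ≤ exp (2 * t * N) := by
      have h1 := add_one_le_exp (2 * t * N)
      have h2 : (N : ℝ) ≤ t * N := le_mul_of_one_le_left (by positivity) ht
      nlinarith
    calc (8 * exp 1 * q) ^ N * (2 * N) ≤ exp (6 * t) ^ N * exp (2 * t * N) := by gcongr
      _ = exp (8 * t * N) := by rw [← exp_nat_mul, ← exp_add]; ring_nf
  have hNt : (N : ℝ) ≤ (16 * exp 5 + 1) * t ^ 6 := by
    calc (N : ℝ) ≤ (16 * exp 5 + 1) * s := by linarith
      _ ≤ _ := by gcongr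
  have hs7 : s ≤ t ^ 7 := hst.trans (pow_le_pow_right₀ ht (by norm_num))
  have hexp : 8 * t * N - t ^ 8 ≤ D ^ 8 - s := by
    have h1 : 8 * t * N + s ≤ D * t ^ 7 := by
      calc 8 * t * N + s ≤ 8 * t * ((16 * exp 5 + 1) * t ^ 6) + t ^ 7 := by gcongr
        _ = D * t ^ 7 := by rw [hD]; ring
    have h2 : D * t ^ 7 ≤ t ^ 8 + D ^ 8 := by
      rcases le_total D t with h | h
      · calc D * t ^ 7 ≤ t * t ^ 7 := by gcongr
          _ ≤ t ^ 8 + D ^ 8 := by linarith [pow_nonneg hD0 8, (by ring : t * t ^ 7 = t ^ 8)]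
      · calc D * t ^ 7 ≤ D * D ^ 7 := by gcongr
          _ ≤ t ^ 8 + D ^ 8 := by linarith [pow_nonneg ht0 8, (by ring : D * D ^ 7 = D ^ 8)]
    linarith
  calc (8 * exp 1 * q) ^ N * (2 * N) * exp (-t ^ 8) ≤ exp (8 * t * N) * exp (-t ^ 8) := by gcongr
    _ = exp (8 * t * N - t ^ 8) := by rw [← exp_add, sub_eq_add_neg]
    _ ≤ exp (D ^ 8 - s) := exp_le_exp.mpr hexp
    _ = exp (D ^ 8) * exp (-s) := by rw [← exp_add, sub_eq_add_neg]

/-- The transform is exponentially small on `[-s, s]` when the low frequency data are small enough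
compared with `s`. -/
theorem exists_norm_unitFourier_le_exp_neg :
    ∃ C > (0 : ℝ), ∀ (f : ℝ → ℂ), Continuous f → ∀ (K s t B : ℝ), 1 ≤ K → K ≤ s → 1 ≤ t →
      s ≤ t ^ 6 → s ≤ K * t ^ 2 → 1 ≤ B → ∫ x in (0:ℝ)..1, ‖f x‖ ≤ B →
      ∫ κ in (0:ℝ)..K, ‖unitFourier f κ‖ ^ 2 ≤ exp (-t ^ 8) ^ 2 →
      ∀ κ : ℝ, |κ| ≤ s → ‖unitFourier f κ‖ ≤ C * B * exp (-s) := by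
  obtain ⟨C, hC, h⟩ := exists_pow_mul_exp_neg_le
  refine ⟨2 + C, by positivity, fun f hf K s t B hK hs ht hst hsK hB1 hB hF κ hκ => ?_⟩
  have hK0 : 0 < K := by linarith
  have hs0 : 0 < s := by linarith
  set N := ⌈16 * exp 5 * s⌉₊
  have hN : 0 < N := Nat.ceil_pos.mpr (by positivity)
  have h1 := norm_unitFourier_le_of_lowFrequency hf hK hs (exp_pos _).le hB hF hN hκ
  have h2 := pow_div_factorial_le_exp_neg hs0.le (Nat.le_ceil (16 * exp 5 * s))
  have h3 := h t s (s / K) N ht (hK.trans hs) hst (by positivity)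
    (by rwa [div_le_iff₀' hK0]) (Nat.ceil_lt_add_one (by positivity)).le
  calc ‖unitFourier f κ‖ ≤ 2 * B * exp (2 * s) * exp (-(3 * s)) + C * exp (-s) := by
        refine h1.trans (add_le_add ?_ h3)
        gcongr
    _ = 2 * B * exp (-s) + C * 1 * exp (-s) := by
        rw [mul_assoc (2 * B), ← exp_add]
        ring_nf
    _ ≤ 2 * B * exp (-s) + C * B * exp (-s) := by gcongr
    _ = (2 + C) * B * exp (-s) := by ring

theorem integral_norm_le_of_integral_sq_norm_le {f : ℝ → ℂ} (hf : Continuous f) {B : ℝ}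
    (hB : 0 < B) (h : ∫ x in (0:ℝ)..1, ‖f x‖ ^ 2 ≤ B ^ 2) : ∫ x in (0:ℝ)..1, ‖f x‖ ≤ B := by
  have h1 : ∫ x in (0:ℝ)..1, ‖f x‖ ≤ ∫ x in (0:ℝ)..1, (‖f x‖ ^ 2 / (2 * B) + B / 2) := by
    refine intervalIntegral.integral_mono_on zero_le_one
      (Continuous.intervalIntegrable (by fun_prop) _ _)
      (Continuous.intervalIntegrable (by fun_prop) _ _) fun x _ => ?_
    have h2 : ‖f x‖ ^ 2 / (2 * B) + B / 2 - ‖f x‖ = (‖f x‖ - B) ^ 2 / (2 * B) := by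
      field_simp
      ring
    have h3 : 0 ≤ (‖f x‖ - B) ^ 2 / (2 * B) := by positivity
    linarith
  rw [intervalIntegral.integral_add (Continuous.intervalIntegrable (by fun_prop) _ _)
    (Continuous.intervalIntegrable (by fun_prop) _ _), intervalIntegral.integral_div,
    intervalIntegral.integral_const] at h1
  have h4 : (∫ x in (0:ℝ)..1, ‖f x‖ ^ 2) / (2 * B) ≤ B / 2 := by
    rw [div_le_iff₀ (by positivity)]
    linarith
  simp only [sub_zero, one_smul] at h1
  linarith

theorem div_cube_pow_le_exp {s : ℝ} (hs : 0 ≤ s) {m : ℕ} (hm : 1 ≤ m) :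
    (s / (3 * m) ^ 3) ^ m ≤ exp s := by
  have hm' : (1 : ℝ) ≤ m := by exact_mod_cast hm
  have h1 : (m.factorial : ℝ) ≤ ((3 * m : ℝ) ^ 3) ^ m := by
    calc (m.factorial : ℝ) ≤ (m : ℝ) ^ m := by exact_mod_cast Nat.factorial_le_pow m
      _ ≤ ((3 * m : ℝ) ^ 3) ^ m := by
        gcongr
        nlinarith [le_self_pow₀ (by linarith : 1 ≤ 3 * (m : ℝ)) (by norm_num : 3 ≠ 0)]
  rw [div_pow]
  refine le_trans ?_ (pow_div_factorial_le_exp s hs m)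
  gcongr

/-- Stability with the bandwidth `K = k ^ 3` and the data discrepancy `exp (-t ^ 8)`. -/
theorem exists_energy_le :
    ∃ C > (0 : ℝ), ∀ (n m : ℕ), 2 * n = m + 1 → 1 ≤ m → ∀ (M k t : ℝ), 1 ≤ M → 1 ≤ k → 0 < t →
      ∀ f : ℝ → ℂ, ContDiff ℝ n f → tsupport f ⊆ Set.Ioo 0 1 →
      ∫ x in (0:ℝ)..1, ‖f x‖ ^ 2 ≤ (2 * M) ^ 2 →
      ∫ x in (0:ℝ)..1, ‖iteratedDeriv n f x‖ ^ 2 ≤ (2 * M) ^ 2 →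
      ∫ κ in (0:ℝ)..k ^ 3, (‖unitFourier f κ‖ ^ 2 + ‖unitFourier f (-κ)‖ ^ 2) =
        exp (-t ^ 8) ^ 2 →
      ∫ x in (0:ℝ)..1, ‖f x‖ ^ 2 ≤
        C * (exp (-t ^ 8) ^ 2 + M ^ 2 / (k ^ 2 * t ^ 2 / (3 * m) ^ 3) ^ m) := by
  obtain ⟨C, hC, h⟩ := exists_norm_unitFourier_le_exp_neg
  refine ⟨4 + 8 * C ^ 2, by positivity, fun n m hnm hm M k t hM hk ht f hf hs h0 hn hF => ?_⟩
  have hm' : (1 : ℝ) ≤ m := by exact_mod_cast hm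
  have hM0 : 0 < M := by linarith
  have hk0 : 0 < k := by linarith
  have hc := continuous_unitFourier hf.continuous
  set A := (k ^ 2 * t ^ 2 / (3 * m) ^ 3) ^ m with hA
  have hA0 : 0 < A := by positivity
  have henergy {R : ℝ} (hR1 : 1 ≤ R) (hR : k ^ 2 * t ^ 2 ≤ R) : ∫ x in (0:ℝ)..1, ‖f x‖ ^ 2 ≤
      (∫ κ in (0:ℝ)..R, (‖unitFourier f κ‖ ^ 2 + ‖unitFourier f (-κ)‖ ^ 2)) + 4 * (M ^ 2 / A) := by
    have hlow : 0 ≤ ∫ κ in (0:ℝ)..R, (‖unitFourier f κ‖ ^ 2 + ‖unitFourier f (-κ)‖ ^ 2) :=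
      intervalIntegral.integral_nonneg (by linarith) fun _ _ => by positivity
    have hAR : A ≤ (2 * R) ^ (2 * n) := by
      calc A ≤ (2 * R) ^ m := by
            refine pow_le_pow_left₀ (by positivity) ?_ m
            refine (div_le_self (by positivity) (one_le_pow₀ (by linarith))).trans ?_
            linarith
        _ ≤ (2 * R) ^ (2 * n) := pow_le_pow_right₀ (by linarith) (by omega)
    have htail : (∫ x in (0:ℝ)..1, ‖iteratedDeriv n f x‖ ^ 2) / (2 * R) ^ (2 * n) ≤
        4 * (M ^ 2 / A) := by
      calc (∫ x in (0:ℝ)..1, ‖iteratedDeriv n f x‖ ^ 2) / (2 * R) ^ (2 * n) ≤ (2 * M) ^ 2 / A := by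
            gcongr
        _ = 4 * (M ^ 2 / A) := by ring
    have he := energy_le_lowFrequency_add hf hs (R := R) (by linarith)
    have hπ : 1 ≤ π := by linarith [pi_gt_three]
    nlinarith [pi_pos]
  rcases le_total (t ^ 2) k with htk | htk
  · have hR := henergy (R := k ^ 3) (one_le_pow₀ hk) (by rw [pow_succ k 2]; gcongr)
    rw [hF] at hR
    have h1 : 0 ≤ exp (-t ^ 8) ^ 2 := by positivity
    have h2 : 0 ≤ M ^ 2 / A := by positivity
    nlinarith [sq_nonneg C]
  · set s := k ^ 2 * t ^ 2 with hsdef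
    have ht1 : 1 ≤ t := (one_le_sq_iff₀ ht.le).mp (hk.trans htk)
    have hKs : k ^ 3 ≤ s := by rw [pow_succ k 2, hsdef]; gcongr
    have hs1 : 1 ≤ s := (one_le_pow₀ hk).trans hKs
    have hst : s ≤ t ^ 6 := by
      calc s ≤ (t ^ 2) ^ 2 * t ^ 2 := by rw [hsdef]; gcongr
        _ = t ^ 6 := by ring
    have hsK : s ≤ k ^ 3 * t ^ 2 := by
      rw [hsdef]
      gcongr
      norm_num
    have hF' : ∫ κ in (0:ℝ)..k ^ 3, ‖unitFourier f κ‖ ^ 2 ≤ exp (-t ^ 8) ^ 2 := by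
      rw [← hF]
      exact intervalIntegral.integral_mono_on (by positivity)
        (Continuous.intervalIntegrable (by fun_prop) _ _)
        (Continuous.intervalIntegrable (by fun_prop) _ _)
        fun κ _ => le_add_of_nonneg_right (by positivity)
    have hsup := h f hf.continuous (k ^ 3) s t (2 * M) (one_le_pow₀ hk) hKs ht1 hst hsK
      (by linarith) (integral_norm_le_of_integral_sq_norm_le hf.continuous (by positivity) h0) hF'
    have hlow : ∫ κ in (0:ℝ)..s, (‖unitFourier f κ‖ ^ 2 + ‖unitFourier f (-κ)‖ ^ 2) ≤
        8 * C ^ 2 * (M ^ 2 / A) := by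
      calc ∫ κ in (0:ℝ)..s, (‖unitFourier f κ‖ ^ 2 + ‖unitFourier f (-κ)‖ ^ 2)
          ≤ ∫ κ in (0:ℝ)..s, 2 * (C * (2 * M) * exp (-s)) ^ 2 := by
            refine intervalIntegral.integral_mono_on (by linarith)
              (Continuous.intervalIntegrable (by fun_prop) _ _)
              (Continuous.intervalIntegrable (by fun_prop) _ _) fun κ hκ => ?_
            have hκ' : |κ| ≤ s := by rw [abs_of_nonneg hκ.1]; exact hκ.2
            have h1 := pow_le_pow_left₀ (norm_nonneg _) (hsup κ hκ') 2
            have h2 := pow_le_pow_left₀ (norm_nonneg _) (hsup (-κ) (by rwa [abs_neg])) 2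
            linarith
        _ = 8 * C ^ 2 * (M ^ 2 * (s * exp (-s) * exp (-s))) := by
            rw [intervalIntegral.integral_const, smul_eq_mul, sub_zero]
            ring
        _ ≤ 8 * C ^ 2 * (M ^ 2 / A) := by
            rw [div_eq_mul_inv]
            gcongr
            have h1 : s * exp (-s) ≤ 1 := by
              rw [exp_neg, ← div_eq_mul_inv, div_le_one (exp_pos s)]
              linarith [add_one_le_exp s]
            have h2 : exp (-s) ≤ A⁻¹ := by
              rw [exp_neg]
              exact inv_anti₀ hA0 (div_cube_pow_le_exp (by linarith) hm)
            calc s * exp (-s) * exp (-s) ≤ 1 * A⁻¹ := by gcongr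
              _ = A⁻¹ := one_mul _
    have hR := henergy hs1 le_rfl
    have h1 : 0 ≤ (4 + 8 * C ^ 2) * exp (-t ^ 8) ^ 2 := by positivity
    linarith

theorem integral_sq_norm_iteratedDeriv_le {g : ℝ → ℂ} {n k : ℕ} (hk : k ≤ n) {M : ℝ}
    (h : √(∑ k ∈ Finset.range (n + 1), ∫ x in (0:ℝ)..1, ‖iteratedDeriv k g x‖ ^ 2) ≤ M) :
    ∫ x in (0:ℝ)..1, ‖iteratedDeriv k g x‖ ^ 2 ≤ M ^ 2 :=
  (Finset.single_le_sum (f := fun k => ∫ x in (0:ℝ)..1, ‖iteratedDeriv k g x‖ ^ 2)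
    (fun _ _ => intervalIntegral.integral_nonneg zero_le_one fun _ _ => by positivity)
    (Finset.mem_range_succ_iff.mpr hk)).trans (Real.sqrt_le_iff.mp h).2

theorem integral_sq_norm_iteratedDeriv_sub_le {g₁ g₂ : ℝ → ℂ} {k : ℕ} (h₁ : ContDiff ℝ k g₁)
    (h₂ : ContDiff ℝ k g₂) {M : ℝ} (hM₁ : ∫ x in (0:ℝ)..1, ‖iteratedDeriv k g₁ x‖ ^ 2 ≤ M ^ 2)
    (hM₂ : ∫ x in (0:ℝ)..1, ‖iteratedDeriv k g₂ x‖ ^ 2 ≤ M ^ 2) :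
    ∫ x in (0:ℝ)..1, ‖iteratedDeriv k (g₁ - g₂) x‖ ^ 2 ≤ (2 * M) ^ 2 := by
  have c₁ := h₁.continuous_iteratedDeriv k le_rfl
  have c₂ := h₂.continuous_iteratedDeriv k le_rfl
  have hsub (x : ℝ) := iteratedDeriv_sub (h₁.contDiffAt (x := x)) (h₂.contDiffAt (x := x))
  simp_rw [hsub]
  calc ∫ x in (0:ℝ)..1, ‖iteratedDeriv k g₁ x - iteratedDeriv k g₂ x‖ ^ 2
      ≤ ∫ x in (0:ℝ)..1, (2 * ‖iteratedDeriv k g₁ x‖ ^ 2 + 2 * ‖iteratedDeriv k g₂ x‖ ^ 2) := by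
        refine intervalIntegral.integral_mono_on zero_le_one
          (Continuous.intervalIntegrable (by fun_prop) _ _)
          (Continuous.intervalIntegrable (by fun_prop) _ _) fun x _ => ?_
        have h := pow_le_pow_left₀ (norm_nonneg _)
          (norm_sub_le (iteratedDeriv k g₁ x) (iteratedDeriv k g₂ x)) 2
        nlinarith [sq_nonneg (‖iteratedDeriv k g₁ x‖ - ‖iteratedDeriv k g₂ x‖)]
    _ ≤ (2 * M) ^ 2 := by
        rw [intervalIntegral.integral_add (Continuous.intervalIntegrable (by fun_prop) _ _)
          (Continuous.intervalIntegrable (by fun_prop) _ _),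
          intervalIntegral.integral_const_mul, intervalIntegral.integral_const_mul]
        linarith

/-- Theorem 2.1 of the paper (estimate for the variance `g = σ²`), deterministic
reformulation: increasing stability for the inverse source problem. -/
theorem stability_variance :
    ∃ C₂ > (0:ℝ), ∀ (n : ℕ), 1 ≤ n → ∀ (M K : ℝ), 1 < M → 1 < K →
    ∀ (g₁ g₂ : ℝ → ℂ), ContDiff ℝ n g₁ → ContDiff ℝ n g₂ →
    tsupport g₁ ⊆ Set.Ioo 0 1 → tsupport g₂ ⊆ Set.Ioo 0 1 →
    Real.sqrt (∑ k ∈ Finset.range (n+1),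
      ∫ x in (0:ℝ)..1, ‖iteratedDeriv k g₁ x‖^2) ≤ M →
    Real.sqrt (∑ k ∈ Finset.range (n+1),
      ∫ x in (0:ℝ)..1, ‖iteratedDeriv k g₂ x‖^2) ≤ M →
    ∀ ε₂ : ℝ,
      ε₂ = Real.sqrt (∫ κ in (0:ℝ)..K,
        (‖∫ x in (0:ℝ)..1, Complex.exp (2 * Complex.I * κ * x) * (g₁ x - g₂ x)‖^2 +
         ‖∫ x in (0:ℝ)..1, Complex.exp (-(2 * Complex.I * κ * x)) * (g₁ x - g₂ x)‖^2)) →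
      0 < ε₂ → ε₂ < 1 →
      (∫ x in (0:ℝ)..1, ‖g₁ x - g₂ x‖^2) ≤
        C₂ * (ε₂^2 +
          M^2 / (K^((2:ℝ)/3) * |Real.log ε₂|^((1:ℝ)/4) / (6*(n:ℝ)-3)^3)^(2*(n:ℝ)-1)) := by
  obtain ⟨C, hC, h⟩ := exists_energy_le
  refine ⟨C, hC, fun n hn M K hM hK g₁ g₂ hg₁ hg₂ hs₁ hs₂ hM₁ hM₂ ε hε hε0 hε1 => ?_⟩
  have hlog : 0 < |log ε| := abs_pos.mpr (log_neg hε0 hε1).ne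
  have hK0 : 0 < K := by linarith
  set k := K ^ ((1:ℝ)/3) with hk
  set t := |log ε| ^ ((1:ℝ)/8) with ht
  have hk3 : k ^ 3 = K := by
    rw [hk, ← rpow_natCast, ← rpow_mul hK0.le]
    norm_num
  have hk2 : K ^ ((2:ℝ)/3) = k ^ 2 := by
    rw [hk, ← rpow_natCast, ← rpow_mul hK0.le]
    norm_num
  have ht8 : exp (-t ^ 8) = ε := by
    rw [ht, ← rpow_natCast, ← rpow_mul hlog.le]
    norm_num
    rw [abs_of_neg (log_neg hε0 hε1), neg_neg, exp_log hε0]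
  have ht2 : |log ε| ^ ((1:ℝ)/4) = t ^ 2 := by
    rw [ht, ← rpow_natCast, ← rpow_mul hlog.le]
    norm_num
  obtain ⟨m, hm⟩ : ∃ m, 2 * n = m + 1 := ⟨2 * n - 1, by omega⟩
  have hm' : 2 * (n : ℝ) = m + 1 := by exact_mod_cast hm
  have hsupp : tsupport (g₁ - g₂) ⊆ Set.Ioo 0 1 :=
    ((closure_mono (Function.support_sub g₁ g₂)).trans closure_union.subset).trans
      (Set.union_subset hs₁ hs₂)
  have h0 := integral_sq_norm_iteratedDeriv_sub_le (k := 0) (hg₁.of_le (by simp))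
    (hg₂.of_le (by simp)) (integral_sq_norm_iteratedDeriv_le (Nat.zero_le n) hM₁)
    (integral_sq_norm_iteratedDeriv_le (Nat.zero_le n) hM₂)
  have hfinal := h n m hm (by omega) M k t hM.le (one_le_rpow hK.le (by norm_num))
    (rpow_pos_of_pos hlog _) (g₁ - g₂) (hg₁.sub hg₂) hsupp (by simpa using h0)
    (integral_sq_norm_iteratedDeriv_sub_le hg₁ hg₂ (integral_sq_norm_iteratedDeriv_le le_rfl hM₁)
      (integral_sq_norm_iteratedDeriv_le le_rfl hM₂)) ?_
  · rw [hk2, ht2, show 6 * (n : ℝ) - 3 = 3 * m by linarith, show 2 * (n : ℝ) - 1 = m by linarith,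
      rpow_natCast]
    rwa [ht8] at hfinal
  · rw [hk3, ht8, hε, sq_sqrt (intervalIntegral.integral_nonneg hK0.le fun _ _ => by positivity)]
    simp [unitFourier]
end

section
/- There exists a constant C₃ > 0, independent of n, N and M, with the following property. For every integer n ≥ 1, every M > 1, every integer N ≥ 1, and all functions f₁, f₂ : ℝ → ℝ that are n-times continuously differentiable, supported in a compact subset of (0,1), and satisfy ‖fⱼ‖_{H^n(0,1)} ≤ M (j = 1,2), define ε₃ = ( Σ_{j=1}^{N} |∫₀¹ sin(jπx)(f₁(x)−f₂(x)) dx|² )^{1/2} and ε₄ = sup_{κ ∈ (0,1)} |∫₀¹ sin(κx)(f₁(x)−f₂(x)) dx|. If 0 < ε₄ < 1, then ∫₀¹ |f₁(x)−f₂(x)|² dx ≤ C₃ ( ε₃² + M² / ( N^{5/8} |ln ε₄|^{1/9} / (6n−3)³ )^{2n−1} ). -/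
open MeasureTheory Real

/-- The `k`-th derivative of the odd reflection `x ↦ f x - f (-x)` of `f`. -/
noncomputable def oddReflectionDeriv (f : ℝ → ℝ) (k : ℕ) (x : ℝ) : ℝ :=
  iteratedDeriv k f x - (-1) ^ k * iteratedDeriv k f (-x)

section OddReflection

variable {f : ℝ → ℝ} {n k : ℕ}

lemma iteratedDeriv_eq_zero_of_tsupport_subset (hs : tsupport f ⊆ Set.Ioo 0 1) {x : ℝ}
    (hx : x ∉ Set.Ioo (0 : ℝ) 1) : iteratedDeriv k f x = 0 := by
  have hk : tsupport (iteratedDeriv k f) ⊆ tsupport f := by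
    induction k with
    | zero => rw [iteratedDeriv_zero]
    | succ k ih => exact iteratedDeriv_succ (f := f) ▸ tsupport_deriv_subset.trans ih
  by_contra h
  exact hx (hs (hk (subset_tsupport _ h)))

lemma hasDerivAt_oddReflectionDeriv (hf : ContDiff ℝ n f) (hk : k < n) (x : ℝ) :
    HasDerivAt (oddReflectionDeriv f k) (oddReflectionDeriv f (k + 1) x) x := by
  have hd : ∀ y, HasDerivAt (iteratedDeriv k f) (iteratedDeriv (k + 1) f y) y := fun y => by
    rw [iteratedDeriv_succ]
    exact ((hf.differentiable_iteratedDeriv k (by exact_mod_cast hk)) y).hasDerivAt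
  have h := (hd x).sub (((hd (-x)).scomp x (hasDerivAt_neg x)).const_mul ((-1) ^ k))
  refine h.congr_deriv ?_
  simp only [oddReflectionDeriv, smul_eq_mul]
  ring

lemma continuous_oddReflectionDeriv (hf : ContDiff ℝ n f) (hk : k ≤ n) :
    Continuous (oddReflectionDeriv f k) := by
  have hc : Continuous (iteratedDeriv k f) := hf.continuous_iteratedDeriv k (by exact_mod_cast hk)
  unfold oddReflectionDeriv
  fun_prop

lemma oddReflectionDeriv_of_nonneg (hs : tsupport f ⊆ Set.Ioo 0 1) {x : ℝ} (hx : 0 ≤ x) :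
    oddReflectionDeriv f k x = iteratedDeriv k f x := by
  have : iteratedDeriv k f (-x) = 0 :=
    iteratedDeriv_eq_zero_of_tsupport_subset hs (fun h => by linarith [h.1])
  simp [oddReflectionDeriv, this]

lemma oddReflectionDeriv_neg (f : ℝ → ℝ) (k : ℕ) (x : ℝ) :
    oddReflectionDeriv f k (-x) = -(-1) ^ k * oddReflectionDeriv f k x := by
  have : ((-1 : ℝ) ^ k) * (-1) ^ k = 1 := by rw [← mul_pow]; simp
  simp only [oddReflectionDeriv, neg_neg]
  linear_combination (-(iteratedDeriv k f (-x))) * this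

lemma oddReflectionDeriv_one (hs : tsupport f ⊆ Set.Ioo 0 1) :
    oddReflectionDeriv f k 1 = 0 := by
  rw [oddReflectionDeriv_of_nonneg hs zero_le_one]
  exact iteratedDeriv_eq_zero_of_tsupport_subset hs (by simp)

lemma oddReflectionDeriv_neg_one (hs : tsupport f ⊆ Set.Ioo 0 1) :
    oddReflectionDeriv f k (-1) = 0 := by
  rw [oddReflectionDeriv_neg, oddReflectionDeriv_one hs, mul_zero]

end OddReflection

lemma intervalIntegral_neg_one_one {E : Type*} [NormedAddCommGroup E] [NormedSpace ℝ E]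
    {φ : ℝ → E} (hφ : Continuous φ) :
    ∫ x in (-1 : ℝ)..1, φ x = ∫ x in (0 : ℝ)..1, (φ x + φ (-x)) := by
  rw [← intervalIntegral.integral_add_adjacent_intervals (b := 0)
    (hφ.intervalIntegrable _ _) (hφ.intervalIntegrable _ _),
    intervalIntegral.integral_add (hφ.intervalIntegrable _ _)
      (Continuous.intervalIntegrable (by fun_prop) _ _),
    intervalIntegral.integral_comp_neg (fun x => φ x)]
  simp [add_comm]

/-- The Fourier coefficients of the derivatives of the odd reflection on `(-1, 1)`. -/
noncomputable def oddCoeff (f : ℝ → ℝ) (k : ℕ) (j : ℤ) : ℂ :=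
  fourierCoeffOn (show (-1 : ℝ) < 1 by norm_num) (fun x => (oddReflectionDeriv f k x : ℂ)) j

section OddCoeff

variable {f : ℝ → ℝ} {n k : ℕ}

lemma hasSum_sq_oddCoeff (hf : ContDiff ℝ n f) (hs : tsupport f ⊆ Set.Ioo 0 1) (hk : k ≤ n) :
    HasSum (fun j => ‖oddCoeff f k j‖ ^ 2) (∫ x in (0 : ℝ)..1, |iteratedDeriv k f x| ^ 2) := by
  have hc := continuous_oddReflectionDeriv hf hk
  have hc' : Continuous (fun x => (oddReflectionDeriv f k x : ℂ)) := by fun_prop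
  have hL : MemLp (fun x => (oddReflectionDeriv f k x : ℂ)) 2
      (volume.restrict (Set.Ioc (-1 : ℝ) 1)) :=
    (memLp_two_iff_integrable_sq_norm hc'.aestronglyMeasurable).2
      (Continuous.integrableOn_Ioc (by fun_prop))
  have h := hasSum_sq_fourierCoeffOn (show (-1 : ℝ) < 1 by norm_num) hL
  convert h using 1
  · rfl
  rw [intervalIntegral_neg_one_one (by fun_prop), smul_eq_mul,
    ← intervalIntegral.integral_const_mul]
  refine intervalIntegral.integral_congr fun x hx => ?_
  rw [Set.uIcc_of_le zero_le_one] at hx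
  have h2 : ((-1 : ℝ) ^ k) ^ 2 = 1 := by rw [← pow_mul, mul_comm, pow_mul]; simp
  simp only [Complex.norm_real, norm_eq_abs, sq_abs]
  rw [oddReflectionDeriv_neg, oddReflectionDeriv_of_nonneg hs hx.1]
  linear_combination (-1 / 2) * (iteratedDeriv k f x) ^ 2 * h2

lemma norm_oddCoeff_succ (hf : ContDiff ℝ n f) (hs : tsupport f ⊆ Set.Ioo 0 1) (hk : k < n)
    {j : ℤ} (hj : j ≠ 0) : ‖oddCoeff f (k + 1) j‖ = π * |(j : ℝ)| * ‖oddCoeff f k j‖ := by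
  have hab : (-1 : ℝ) < 1 := by norm_num
  have h := fourierCoeffOn_of_hasDerivAt hab hj
    (fun x _ => (hasDerivAt_oddReflectionDeriv hf hk x).ofReal_comp)
    (f' := fun x => (oddReflectionDeriv f (k + 1) x : ℂ))
    (Continuous.intervalIntegrable (by
      have := continuous_oddReflectionDeriv hf (k := k + 1) hk
      fun_prop) _ _)
  rw [oddReflectionDeriv_one hs, oddReflectionDeriv_neg_one hs] at h
  change oddCoeff f k j = _ * (_ - _ * oddCoeff f (k + 1) j) at h
  have hpi := pi_pos
  have hj' : (j : ℂ) ≠ 0 := by exact_mod_cast hj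
  have h' : oddCoeff f (k + 1) j = (π * Complex.I * j) * oddCoeff f k j := by
    rw [h]
    have hp : (π : ℂ) ≠ 0 := by exact_mod_cast pi_ne_zero
    have hI := Complex.I_ne_zero
    push_cast
    field_simp
    ring
  rw [h']
  simp [abs_of_pos hpi]

lemma norm_oddCoeff (hf : ContDiff ℝ n f) (hs : tsupport f ⊆ Set.Ioo 0 1)
    {j : ℤ} (hj : j ≠ 0) (hk : k ≤ n) :
    ‖oddCoeff f k j‖ = (π * |(j : ℝ)|) ^ k * ‖oddCoeff f 0 j‖ := by
  induction k with
  | zero => simp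
  | succ k ih =>
    rw [norm_oddCoeff_succ hf hs hk hj, ih (by omega)]
    ring

lemma norm_oddCoeff_zero (hf : Continuous f) (hs : tsupport f ⊆ Set.Ioo 0 1) (j : ℤ) :
    ‖oddCoeff f 0 j‖ = |∫ x in (0 : ℝ)..1, sin (j * π * x) * f x| := by
  have hc : Continuous (oddReflectionDeriv f 0) :=
    continuous_oddReflectionDeriv (n := 0) (contDiff_zero.2 hf) le_rfl
  have hF : ∀ x : ℝ, fourier (-j) (x : AddCircle ((1 : ℝ) - -1))
      = Complex.exp (-(j * π * x : ℝ) * Complex.I) := by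
    intro x
    rw [fourier_coe_apply]
    congr 1
    push_cast
    ring
  rw [oddCoeff, fourierCoeffOn_eq_integral]
  simp_rw [hF]
  rw [intervalIntegral_neg_one_one (by fun_prop)]
  have : ∀ x ∈ Set.uIcc (0 : ℝ) 1,
      Complex.exp (-(j * π * x : ℝ) * Complex.I) • (oddReflectionDeriv f 0 x : ℂ) +
      Complex.exp (-(j * π * (-x) : ℝ) * Complex.I) • (oddReflectionDeriv f 0 (-x) : ℂ)
      = (-2 * Complex.I) * ((sin (j * π * x) * f x : ℝ) : ℂ) := by
    intro x hx
    rw [Set.uIcc_of_le zero_le_one] at hx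
    rw [oddReflectionDeriv_neg, oddReflectionDeriv_of_nonneg hs hx.1]
    simp only [iteratedDeriv_zero, smul_eq_mul, Complex.exp_mul_I]
    push_cast
    simp only [Complex.cos_neg, Complex.sin_neg, mul_neg, neg_neg]
    ring
  rw [intervalIntegral.integral_congr this, intervalIntegral.integral_const_mul,
    intervalIntegral.integral_ofReal]
  simp only [norm_smul, norm_mul, Complex.norm_real, norm_eq_abs, norm_neg, Complex.norm_I]
  norm_num
  ring

/-- A compactly supported `f` is controlled in `L²(0,1)` by finitely many sine coefficients and
by the `L²` norm of its `n`-th derivative. -/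
lemma integral_sq_le_sum_sine_coeff (hf : ContDiff ℝ n f) (hs : tsupport f ⊆ Set.Ioo 0 1)
    (K : ℕ) {Q : ℝ} (hQ : 0 < Q) (hQK : Q ≤ K + 1) :
    ∫ x in (0 : ℝ)..1, |f x| ^ 2 ≤
      2 * ∑ j ∈ Finset.Icc 1 K, |∫ x in (0 : ℝ)..1, sin ((j : ℝ) * π * x) * f x| ^ 2 +
      2 * (∫ x in (0 : ℝ)..1, |iteratedDeriv n f x| ^ 2) / Q ^ (2 * n) := by
  have ha := hasSum_sq_oddCoeff hf hs (k := 0) (Nat.zero_le _)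
  have hb := hasSum_sq_oddCoeff hf hs (k := n) le_rfl
  have hb0 := le_hasSum hb 0 (fun j _ => by positivity)
  have ha' := ha.nat_add_neg
  have hb' := hb.nat_add_neg
  have hz := norm_oddCoeff_zero hf.continuous hs
  simp only [hz] at ha'
  simp only [iteratedDeriv_zero] at ha'
  have hfin := hasSum_sum_of_ne_finset_zero
    (f := fun j : ℕ => if j ∈ Finset.Icc 1 K then
      2 * |∫ x in (0 : ℝ)..1, sin ((j : ℝ) * π * x) * f x| ^ 2 else 0) (s := Finset.Icc 1 K)
    (L := SummationFilter.unconditional ℕ)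
    (fun j hj => if_neg hj)
  have hle := hasSum_le (fun j => ?_) ha' (hfin.add (hb'.div_const (Q ^ (2 * n))))
  · rw [Finset.sum_congr rfl (fun j hj => if_pos hj), ← Finset.mul_sum] at hle
    have h1 : ∀ a b : ℝ, b ≤ a → (a + b) / Q ^ (2 * n) ≤ 2 * a / Q ^ (2 * n) := fun a b h => by
      gcongr; linarith
    have h2 := h1 _ _ hb0
    simp only [Int.cast_zero, zero_mul, sin_zero, intervalIntegral.integral_zero, abs_zero] at hle
    linarith
  · have hnn : 0 ≤ (‖oddCoeff f n (j : ℤ)‖ ^ 2 + ‖oddCoeff f n (-(j : ℤ))‖ ^ 2) / Q ^ (2 * n) := by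
      positivity
    have hneg : |∫ x in (0 : ℝ)..1, sin (((-(j : ℤ) : ℤ) : ℝ) * π * x) * f x|
        = |∫ x in (0 : ℝ)..1, sin ((j : ℝ) * π * x) * f x| := by
      rw [← abs_neg, ← intervalIntegral.integral_neg]
      congr 2
      ext x
      push_cast
      rw [neg_mul, neg_mul, sin_neg]
      ring
    rcases Nat.eq_zero_or_pos j with rfl | hj
    · simpa using hnn
    · rw [hneg]
      by_cases hjK : j ∈ Finset.Icc 1 K
      · rw [if_pos hjK, Int.cast_natCast]
        linarith
      · rw [if_neg hjK, zero_add, le_div_iff₀ (by positivity),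
          norm_oddCoeff hf hs (by omega) le_rfl, norm_oddCoeff hf hs (by omega) le_rfl, hz, hz,
          hneg]
        have hKj : K + 1 ≤ j := by
          by_contra h
          exact hjK (Finset.mem_Icc.2 ⟨hj, by omega⟩)
        have hKj' : ((K : ℝ) + 1) ≤ j := by exact_mod_cast hKj
        have hpow : Q ^ (2 * n) ≤ (π * (j : ℝ)) ^ (2 * n) := by
          gcongr
          nlinarith [pi_gt_three]
        push_cast
        rw [abs_neg, Nat.abs_cast, mul_pow _ |_| 2, ← pow_mul, mul_comm n 2]
        nlinarith [mul_le_mul_of_nonneg_right hpow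
          (sq_nonneg |∫ x in (0 : ℝ)..1, sin ((j : ℝ) * π * x) * f x|)]

end OddCoeff

section SineTransform

variable {f : ℝ → ℝ} {ε B : ℝ}

/-- The `k`-th forward difference with step `h`, started at `h`, of the sine transform. -/
lemma integral_im_mul_sub_one_pow (hf : Continuous f) (h : ℝ) (k : ℕ) :
    ∫ x in (0 : ℝ)..1, (Complex.exp (Complex.I * (h * x : ℝ)) *
      (Complex.exp (Complex.I * (h * x : ℝ)) - 1) ^ k).im * f x =
    ∑ m ∈ Finset.range (k + 1), (-1) ^ (m + k) * (k.choose m : ℝ) *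
      ∫ x in (0 : ℝ)..1, sin ((m + 1) * h * x) * f x := by
  simp_rw [← intervalIntegral.integral_const_mul]
  rw [← intervalIntegral.integral_finsetSum
    (fun m _ => Continuous.intervalIntegrable (by fun_prop) _ _)]
  refine intervalIntegral.integral_congr fun x _ => ?_
  rw [sub_pow, Finset.mul_sum, Complex.im_sum, Finset.sum_mul]
  refine Finset.sum_congr rfl fun m _ => ?_
  have h1 : Complex.exp (Complex.I * (h * x : ℝ)) *
      ((-1) ^ (m + k) * Complex.exp (Complex.I * (h * x : ℝ)) ^ m * 1 ^ (k - m) * (k.choose m : ℂ))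
      = (((-1) ^ (m + k) * (k.choose m : ℝ) : ℝ) : ℂ) *
        Complex.exp (((m + 1) * h * x : ℝ) * Complex.I) := by
    have : Complex.exp (((m + 1) * h * x : ℝ) * Complex.I) =
        Complex.exp (Complex.I * (h * x : ℝ)) ^ m * Complex.exp (Complex.I * (h * x : ℝ)) := by
      rw [← pow_succ, ← Complex.exp_nat_mul]
      congr 1
      push_cast
      ring
    rw [this]
    push_cast
    ring
  rw [h1, Complex.im_ofReal_mul, Complex.exp_ofReal_mul_I_im]
  ring

/-- Newton's forward difference expansion of the sine transform. -/
lemma sine_transform_eq_sum (hf : Continuous f) (h : ℝ) (T : ℕ) :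
    ∫ x in (0 : ℝ)..1, sin ((T + 1) * h * x) * f x =
    ∑ k ∈ Finset.range (T + 1), (T.choose k : ℝ) *
      ∫ x in (0 : ℝ)..1, (Complex.exp (Complex.I * (h * x : ℝ)) *
        (Complex.exp (Complex.I * (h * x : ℝ)) - 1) ^ k).im * f x := by
  simp_rw [← intervalIntegral.integral_const_mul]
  rw [← intervalIntegral.integral_finsetSum
    (fun m _ => Continuous.intervalIntegrable (by fun_prop) _ _)]
  refine intervalIntegral.integral_congr fun x _ => ?_
  set z := Complex.exp (Complex.I * (h * x : ℝ)) with hz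
  have h1 : Complex.exp (((T + 1) * h * x : ℝ) * Complex.I) = z * ((z - 1) + 1) ^ T := by
    rw [sub_add_cancel, ← pow_succ', hz, ← Complex.exp_nat_mul]
    congr 1
    push_cast
    ring
  rw [← Complex.exp_ofReal_mul_I_im, h1, add_pow, Finset.mul_sum, Complex.im_sum, Finset.sum_mul]
  refine Finset.sum_congr rfl fun m _ => ?_
  have h2 : z * ((z - 1) ^ m * 1 ^ (T - m) * (T.choose m : ℂ)) =
      ((T.choose m : ℝ) : ℂ) * (z * (z - 1) ^ m) := by
    push_cast
    ring
  rw [h2, Complex.im_ofReal_mul]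
  ring

lemma abs_sine_transform_le (hf : Continuous f) (hB : ∫ x in (0 : ℝ)..1, |f x| ≤ B)
    (hε : ∀ κ ∈ Set.Ioo (0 : ℝ) 1, |∫ x in (0 : ℝ)..1, sin (κ * x) * f x| ≤ ε)
    {n : ℕ} {h : ℝ} (hh : 0 < h) (hnh : n * h < 1) (T : ℕ) :
    |∫ x in (0 : ℝ)..1, sin ((T + 1) * h * x) * f x| ≤
      ∑ k ∈ Finset.range (T + 1), (T.choose k : ℝ) *
        (if k < n then 2 ^ k * ε else h ^ k * B) := by
  rw [sine_transform_eq_sum hf]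
  refine (Finset.abs_sum_le_sum_abs _ _).trans (Finset.sum_le_sum fun k _ => ?_)
  rw [abs_mul, Nat.abs_cast]
  refine mul_le_mul_of_nonneg_left ?_ (Nat.cast_nonneg _)
  split_ifs with hk
  · rw [integral_im_mul_sub_one_pow hf]
    have h2 : (2 : ℝ) ^ k * ε = ∑ m ∈ Finset.range (k + 1), (k.choose m : ℝ) * ε := by
      rw [← Finset.sum_mul]
      congr 1
      exact_mod_cast (Nat.sum_range_choose k).symm
    rw [h2]
    refine (Finset.abs_sum_le_sum_abs _ _).trans (Finset.sum_le_sum fun m hm => ?_)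
    rw [abs_mul, abs_mul, abs_pow, abs_neg, abs_one, one_pow, one_mul, Nat.abs_cast]
    refine mul_le_mul_of_nonneg_left (hε _ ⟨by positivity, ?_⟩) (Nat.cast_nonneg _)
    have hm' : ((m : ℝ) + 1) ≤ n := by
      have := Finset.mem_range.1 hm
      exact_mod_cast (by omega : m + 1 ≤ n)
    nlinarith
  · calc _ ≤ ∫ x in (0 : ℝ)..1, |(Complex.exp (Complex.I * (h * x : ℝ)) *
        (Complex.exp (Complex.I * (h * x : ℝ)) - 1) ^ k).im * f x| :=
          intervalIntegral.abs_integral_le_integral_abs zero_le_one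
      _ ≤ ∫ x in (0 : ℝ)..1, h ^ k * |f x| := by
          refine intervalIntegral.integral_mono_on zero_le_one
            (Continuous.intervalIntegrable (by fun_prop) _ _)
            (Continuous.intervalIntegrable (by fun_prop) _ _) fun x hx => ?_
          rw [abs_mul]
          refine mul_le_mul_of_nonneg_right ((Complex.abs_im_le_norm _).trans ?_) (abs_nonneg _)
          rw [norm_mul, mul_comm Complex.I, Complex.norm_exp_ofReal_mul_I, one_mul, norm_pow,
            mul_comm _ Complex.I]
          refine pow_le_pow_left₀ (norm_nonneg _)
            (norm_exp_I_mul_ofReal_sub_one_le.trans ?_) k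
          rw [norm_eq_abs, abs_of_nonneg (mul_nonneg hh.le hx.1)]
          nlinarith [hx.2]
      _ ≤ h ^ k * B := by
          rw [intervalIntegral.integral_const_mul]
          exact mul_le_mul_of_nonneg_left hB (by positivity)

lemma sum_choose_mul_pow_le_exp (T : ℕ) {y : ℝ} (hy : 0 ≤ y) :
    ∑ k ∈ Finset.range (T + 1), (T.choose k : ℝ) * y ^ k ≤ exp (T * y) := by
  have h : ∑ k ∈ Finset.range (T + 1), (T.choose k : ℝ) * y ^ k = (y + 1) ^ T := by
    rw [add_pow]
    refine Finset.sum_congr rfl fun k _ => ?_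
    rw [one_pow]
    ring
  rw [h, exp_nat_mul]
  exact pow_le_pow_left₀ (by positivity) (add_one_le_exp y) T

lemma sum_choose_mul_ite_le (hε : 0 ≤ ε) (hB : 0 ≤ B) (n T : ℕ) {h s : ℝ} (hh : 0 ≤ h)
    (hs : 0 ≤ s) :
    ∑ k ∈ Finset.range (T + 1), (T.choose k : ℝ) * (if k < n then 2 ^ k * ε else h ^ k * B) ≤
      ε * exp (n * s + T * (2 * exp (-s))) + B * exp (T * (exp 1 * h) - n) := by
  have h1 := sum_choose_mul_pow_le_exp T (y := 2 * exp (-s)) (by positivity)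
  have h2 := sum_choose_mul_pow_le_exp T (y := exp 1 * h) (by positivity)
  have h3 : ∑ k ∈ Finset.range (T + 1),
      (T.choose k : ℝ) * (if k < n then 2 ^ k * ε else h ^ k * B) ≤
      ∑ k ∈ Finset.range (T + 1), (ε * exp (n * s) * ((T.choose k : ℝ) * (2 * exp (-s)) ^ k) +
        B * exp (-n) * ((T.choose k : ℝ) * (exp 1 * h) ^ k)) := by
    refine Finset.sum_le_sum fun k _ => ?_
    have e1 : 0 ≤ ε * exp (n * s) * ((T.choose k : ℝ) * (2 * exp (-s)) ^ k) := by positivity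
    have e2 : 0 ≤ B * exp (-n) * ((T.choose k : ℝ) * (exp 1 * h) ^ k) := by positivity
    split_ifs with hk
    · refine le_add_of_le_of_nonneg ?_ e2
      have : (1 : ℝ) ≤ exp (n * s) * exp (-s) ^ k := by
        rw [← exp_nat_mul, ← exp_add]
        refine one_le_exp ?_
        have : (k : ℝ) ≤ n := by exact_mod_cast hk.le
        nlinarith
      calc (T.choose k : ℝ) * (2 ^ k * ε) = (T.choose k : ℝ) * (2 ^ k * ε) * 1 := by ring
        _ ≤ (T.choose k : ℝ) * (2 ^ k * ε) * (exp (n * s) * exp (-s) ^ k) :=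
          mul_le_mul_of_nonneg_left this (by positivity)
        _ = _ := by rw [mul_pow]; ring
    · refine le_add_of_nonneg_of_le e1 ?_
      have : (1 : ℝ) ≤ exp (-n) * exp 1 ^ k := by
        rw [← exp_nat_mul, ← exp_add]
        refine one_le_exp ?_
        have : (n : ℝ) ≤ k := by exact_mod_cast not_lt.1 hk
        linarith
      calc (T.choose k : ℝ) * (h ^ k * B) = (T.choose k : ℝ) * (h ^ k * B) * 1 := by ring
        _ ≤ (T.choose k : ℝ) * (h ^ k * B) * (exp (-n) * exp 1 ^ k) :=
          mul_le_mul_of_nonneg_left this (by positivity)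
        _ = _ := by rw [mul_pow]; ring
  refine h3.trans ?_
  rw [Finset.sum_add_distrib, ← Finset.mul_sum, ← Finset.mul_sum, exp_add, sub_eq_neg_add, exp_add,
    ← mul_assoc ε, ← mul_assoc B]
  gcongr

/-- Quantitative unique continuation: smallness of the sine transform on `(0,1)` propagates to the
larger frequencies `j π`. -/
lemma abs_sine_transform_le_exp_neg (hf : Continuous f) (hB : ∫ x in (0 : ℝ)..1, |f x| ≤ B)
    (hε : ∀ κ ∈ Set.Ioo (0 : ℝ) 1, |∫ x in (0 : ℝ)..1, sin (κ * x) * f x| ≤ ε)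
    {K j : ℕ} (hK : 27 ≤ K) (hεK : ε ≤ exp (-(K : ℝ) ^ 3)) (hj : 1 ≤ j) (hjK : j ≤ K) :
    |∫ x in (0 : ℝ)..1, sin ((j : ℝ) * π * x) * f x| ≤ (1 + B) * exp (-K) := by
  have hε0 : 0 ≤ ε := (abs_nonneg _).trans (hε (1 / 2) ⟨by norm_num, by norm_num⟩)
  have hB0 : 0 ≤ B := le_trans
    (intervalIntegral.integral_nonneg zero_le_one fun x _ => abs_nonneg _) hB
  have hK' : (27 : ℝ) ≤ K := by exact_mod_cast hK
  have hj' : (1 : ℝ) ≤ j := by exact_mod_cast hj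
  have hjK' : (j : ℝ) ≤ K := by exact_mod_cast hjK
  have hpi := pi_gt_three
  have hpi' := pi_lt_d2
  have hX : (j : ℝ) * π ≤ 3.15 * K := by nlinarith
  set T : ℕ := 64 * K ^ 2 with hT
  have hTK : (T : ℝ) = 64 * (K : ℝ) ^ 2 := by simp [hT]
  set h : ℝ := j * π / (T + 1) with hh
  have hT1 : (0 : ℝ) < T + 1 := by positivity
  have hhT : ((T : ℝ) + 1) * h = j * π := by rw [hh]; field_simp
  have hh0 : 0 < h := by positivity
  have hTh : (T : ℝ) * h ≤ 3.15 * K := by linarith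
  have hnh : ((16 * K : ℕ) : ℝ) * h < 1 := by
    rw [hh, ← mul_div_assoc, div_lt_one hT1, hTK]
    push_cast
    nlinarith
  have hmain := (abs_sine_transform_le hf hB hε hh0 hnh T).trans
    (sum_choose_mul_ite_le hε0 hB0 (16 * K) T hh0.le (s := (K : ℝ) ^ 2 / 32) (by positivity))
  rw [hhT] at hmain
  refine hmain.trans ?_
  have hexp : (K : ℝ) ^ 2 / 32 * exp (-((K : ℝ) ^ 2 / 32)) ≤ 1 := by
    rw [exp_neg, ← div_eq_mul_inv, div_le_one (exp_pos _)]
    linarith [add_one_le_exp ((K : ℝ) ^ 2 / 32)]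
  rw [add_mul, one_mul]
  refine add_le_add ?_ (mul_le_mul_of_nonneg_left (exp_le_exp.2 ?_) hB0)
  · refine (mul_le_mul_of_nonneg_right hεK (exp_pos _).le).trans ?_
    rw [← exp_add]
    refine exp_le_exp.2 ?_
    rw [hTK]
    push_cast
    have hK2 : (729 : ℝ) ≤ (K : ℝ) ^ 2 := by nlinarith
    have : 729 * (K : ℝ) ≤ (K : ℝ) ^ 3 := by nlinarith
    nlinarith
  · push_cast
    have he := exp_one_lt_d9
    have : exp 1 * (T * h) ≤ 2.72 * (3.15 * K) :=
      mul_le_mul (by linarith) hTh (by positivity) (by norm_num)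
    nlinarith

end SineTransform

lemma integral_sq_iteratedDeriv_le {f : ℝ → ℝ} {n k : ℕ} {M : ℝ} (hk : k ≤ n)
    (h : √(∑ k ∈ Finset.range (n + 1), ∫ x in (0 : ℝ)..1, |iteratedDeriv k f x| ^ 2) ≤ M) :
    ∫ x in (0 : ℝ)..1, |iteratedDeriv k f x| ^ 2 ≤ M ^ 2 := by
  refine le_trans ?_ (sqrt_le_iff.1 h).2
  exact Finset.single_le_sum
    (f := fun k => ∫ x in (0 : ℝ)..1, |iteratedDeriv k f x| ^ 2)
    (fun i _ => intervalIntegral.integral_nonneg zero_le_one fun x _ => by positivity)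
    (Finset.mem_range.2 (by omega))

lemma integral_sq_iteratedDeriv_sub_le {f₁ f₂ : ℝ → ℝ} {n k : ℕ} {M : ℝ} (hk : k ≤ n)
    (hf₁ : ContDiff ℝ n f₁) (hf₂ : ContDiff ℝ n f₂)
    (h₁ : √(∑ k ∈ Finset.range (n + 1), ∫ x in (0 : ℝ)..1, |iteratedDeriv k f₁ x| ^ 2) ≤ M)
    (h₂ : √(∑ k ∈ Finset.range (n + 1), ∫ x in (0 : ℝ)..1, |iteratedDeriv k f₂ x| ^ 2) ≤ M) :
    ∫ x in (0 : ℝ)..1, |iteratedDeriv k (f₁ - f₂) x| ^ 2 ≤ 4 * M ^ 2 := by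
  have c₁ : Continuous (iteratedDeriv k f₁) := hf₁.continuous_iteratedDeriv k (by exact_mod_cast hk)
  have c₂ : Continuous (iteratedDeriv k f₂) := hf₂.continuous_iteratedDeriv k (by exact_mod_cast hk)
  have hsub : ∀ x, iteratedDeriv k (f₁ - f₂) x = iteratedDeriv k f₁ x - iteratedDeriv k f₂ x :=
    fun x => iteratedDeriv_sub ((hf₁.of_le (by exact_mod_cast hk)).contDiffAt)
      ((hf₂.of_le (by exact_mod_cast hk)).contDiffAt)
  simp_rw [hsub]
  calc _ ≤ ∫ x in (0 : ℝ)..1,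
        (2 * |iteratedDeriv k f₁ x| ^ 2 + 2 * |iteratedDeriv k f₂ x| ^ 2) := by
        refine intervalIntegral.integral_mono_on zero_le_one
          (Continuous.intervalIntegrable (by fun_prop) _ _)
          (Continuous.intervalIntegrable (by fun_prop) _ _) fun x _ => ?_
        simp only [sq_abs]
        nlinarith [sq_nonneg (iteratedDeriv k f₁ x + iteratedDeriv k f₂ x)]
    _ ≤ 4 * M ^ 2 := by
        rw [intervalIntegral.integral_add (Continuous.intervalIntegrable (by fun_prop) _ _)
          (Continuous.intervalIntegrable (by fun_prop) _ _), intervalIntegral.integral_const_mul,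
          intervalIntegral.integral_const_mul]
        linarith [integral_sq_iteratedDeriv_le hk h₁, integral_sq_iteratedDeriv_le hk h₂]

lemma integral_abs_le_of_integral_sq_le {f : ℝ → ℝ} (hf : Continuous f) {R : ℝ} (hR : 0 < R)
    (h : ∫ x in (0 : ℝ)..1, |f x| ^ 2 ≤ R ^ 2) : ∫ x in (0 : ℝ)..1, |f x| ≤ R := by
  calc ∫ x in (0 : ℝ)..1, |f x| ≤ ∫ x in (0 : ℝ)..1, ((2 * R)⁻¹ * |f x| ^ 2 + R / 2) := by
        refine intervalIntegral.integral_mono_on zero_le_one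
          (Continuous.intervalIntegrable (by fun_prop) _ _)
          (Continuous.intervalIntegrable (by fun_prop) _ _) fun x _ => ?_
        have : (2 * R)⁻¹ * |f x| ^ 2 + R / 2 - |f x| = (2 * R)⁻¹ * (|f x| - R) ^ 2 := by
          field_simp
          ring
        have : 0 ≤ (2 * R)⁻¹ * (|f x| - R) ^ 2 := by positivity
        linarith
    _ = (2 * R)⁻¹ * (∫ x in (0 : ℝ)..1, |f x| ^ 2) + R / 2 := by
        rw [intervalIntegral.integral_add (Continuous.intervalIntegrable (by fun_prop) _ _)
          (Continuous.intervalIntegrable (by fun_prop) _ _), intervalIntegral.integral_const_mul]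
        simp
    _ ≤ (2 * R)⁻¹ * R ^ 2 + R / 2 := by gcongr
    _ = R := by field_simp; ring

lemma abs_sine_transform_le_iSup {f : ℝ → ℝ} (hf : Continuous f) {κ : ℝ}
    (hκ : κ ∈ Set.Ioo (0 : ℝ) 1) :
    |∫ x in (0 : ℝ)..1, sin (κ * x) * f x| ≤
      ⨆ κ : Set.Ioo (0 : ℝ) 1, |∫ x in (0 : ℝ)..1, sin ((κ : ℝ) * x) * f x| := by
  refine le_ciSup (f := fun κ : Set.Ioo (0 : ℝ) 1 =>
    |∫ x in (0 : ℝ)..1, sin ((κ : ℝ) * x) * f x|) ⟨∫ x in (0 : ℝ)..1, |f x|, ?_⟩ ⟨κ, hκ⟩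
  rintro _ ⟨κ, rfl⟩
  refine (intervalIntegral.abs_integral_le_integral_abs zero_le_one).trans ?_
  refine intervalIntegral.integral_mono_on zero_le_one
    (Continuous.intervalIntegrable (by fun_prop) _ _)
    (Continuous.intervalIntegrable (by fun_prop) _ _) fun x _ => ?_
  rw [abs_mul]
  exact mul_le_of_le_one_left (abs_nonneg _) (abs_sin_le_one _)

lemma cube_le_of_le_rpow_mul_rpow {N L Q : ℝ} (hN : 0 ≤ N) (hL : 0 ≤ L) (hQ : 1 ≤ Q) (hNQ : N ≤ Q)
    (h : Q ≤ N ^ ((5 : ℝ) / 8) * L ^ ((1 : ℝ) / 9)) : Q ^ 3 ≤ L := by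
  have hQ0 : 0 < Q := by linarith
  set l := L ^ ((1 : ℝ) / 9) with hl
  have hl0 : 0 ≤ l := rpow_nonneg hL _
  have hlL : l ^ 9 = L := by
    rw [hl, ← rpow_natCast, ← rpow_mul hL]
    norm_num
  set q := Q ^ ((3 : ℝ) / 8) with hq
  have hq8 : q ^ 8 = Q ^ 3 := by
    rw [hq, ← rpow_natCast, ← rpow_mul hQ0.le, ← rpow_natCast]
    norm_num
  have hq1 : 1 ≤ q := one_le_rpow hQ (by norm_num)
  have hql : q ≤ l := by
    have h1 : Q ^ ((5 : ℝ) / 8) * q ≤ Q ^ ((5 : ℝ) / 8) * l := by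
      rw [hq, ← rpow_add hQ0]
      norm_num
      exact h.trans (mul_le_mul_of_nonneg_right (rpow_le_rpow hN hNQ (by norm_num)) hl0)
    exact le_of_mul_le_mul_left h1 (rpow_pos_of_pos hQ0 _)
  calc Q ^ 3 = q ^ 8 := hq8.symm
    _ ≤ l ^ 8 := pow_le_pow_left₀ (by linarith) hql 8
    _ ≤ l ^ 9 := pow_le_pow_right₀ (hq1.trans hql) (by norm_num)
    _ = L := hlL

lemma exp_neg_le_pow_div_pow (m : ℕ) {Q : ℝ} (hQ : 0 < Q) : exp (-Q) ≤ (m : ℝ) ^ m / Q ^ m := by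
  have h := pow_div_factorial_le_exp Q hQ.le m
  have hm : (m.factorial : ℝ) ≤ (m : ℝ) ^ m := by exact_mod_cast m.factorial_le_pow
  rw [div_le_iff₀ (by positivity)] at h
  rw [exp_neg, le_div_iff₀ (by positivity), inv_mul_le_iff₀ (exp_pos _)]
  exact h.trans (mul_le_mul_of_nonneg_left hm (exp_pos _).le)

/-- Theorem 2.2 of the paper, deterministic reformulation: increasing stability
for determining the (real) mean of the random source from one-sided data. -/
theorem stability_mean_one_sided :
    ∃ C₃ > (0:ℝ), ∀ (n : ℕ), 1 ≤ n → ∀ (M : ℝ), 1 < M → ∀ (N : ℕ), 1 ≤ N →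
    ∀ (f₁ f₂ : ℝ → ℝ), ContDiff ℝ n f₁ → ContDiff ℝ n f₂ →
    tsupport f₁ ⊆ Set.Ioo 0 1 → tsupport f₂ ⊆ Set.Ioo 0 1 →
    Real.sqrt (∑ k ∈ Finset.range (n+1),
      ∫ x in (0:ℝ)..1, |iteratedDeriv k f₁ x|^2) ≤ M →
    Real.sqrt (∑ k ∈ Finset.range (n+1),
      ∫ x in (0:ℝ)..1, |iteratedDeriv k f₂ x|^2) ≤ M →
    ∀ ε₃ ε₄ : ℝ,
      ε₃ = Real.sqrt (∑ j ∈ Finset.Icc 1 N,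
        |∫ x in (0:ℝ)..1, Real.sin ((j:ℝ) * π * x) * (f₁ x - f₂ x)|^2) →
      ε₄ = ⨆ κ : Set.Ioo (0:ℝ) 1,
        |∫ x in (0:ℝ)..1, Real.sin ((κ:ℝ) * x) * (f₁ x - f₂ x)| →
      0 < ε₄ → ε₄ < 1 →
      (∫ x in (0:ℝ)..1, |f₁ x - f₂ x|^2) ≤
        C₃ * (ε₃^2 +
          M^2 / ((N:ℝ)^((5:ℝ)/8) * |Real.log ε₄|^((1:ℝ)/9) / (6*(n:ℝ)-3)^3)^(2*(n:ℝ)-1)) := by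
  refine ⟨62, by norm_num, ?_⟩
  intro n hn M hM N hN f₁ f₂ hf₁ hf₂ hs₁ hs₂ hM₁ hM₂ ε₃ ε₄ hε₃ hε₄ hε₄0 hε₄1
  have hf : ContDiff ℝ n (f₁ - f₂) := hf₁.sub hf₂
  have hs : tsupport (f₁ - f₂) ⊆ Set.Ioo 0 1 :=
    (tsupport_sub f₁ f₂).trans (Set.union_subset hs₁ hs₂)
  have hA := integral_sq_iteratedDeriv_sub_le (Nat.zero_le n) hf₁ hf₂ hM₁ hM₂
  have hD := integral_sq_iteratedDeriv_sub_le le_rfl hf₁ hf₂ hM₁ hM₂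
  rw [iteratedDeriv_zero] at hA
  simp_rw [← Pi.sub_apply f₁ f₂] at hε₃ hε₄ ⊢
  set f := f₁ - f₂
  obtain ⟨m, rfl⟩ : ∃ m, n = m + 1 := ⟨n - 1, by omega⟩
  have hfour : 2 * (((m + 1 : ℕ) : ℝ)) - 1 = ((2 * m + 1 : ℕ) : ℝ) := by push_cast; ring
  have hsix : 6 * (((m + 1 : ℕ) : ℝ)) - 3 = 3 * ((2 * m + 1 : ℕ) : ℝ) := by push_cast; ring
  rw [hfour, rpow_natCast, hsix]
  set p : ℕ := 2 * m + 1 with hp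
  have hp1 : (1 : ℝ) ≤ p := by exact_mod_cast (by omega : 1 ≤ p)
  set L := |log ε₄| with hL
  have hlog : log ε₄ < 0 := log_neg hε₄0 hε₄1
  have hLlog : L = -log ε₄ := abs_of_neg hlog
  have hL0 : 0 < L := by linarith
  set Q := (N : ℝ) ^ ((5 : ℝ) / 8) * L ^ ((1 : ℝ) / 9) with hQ
  have hN0 : (0 : ℝ) < N := by exact_mod_cast hN
  have hQ0 : 0 < Q := by positivity
  have hp3 : (1 : ℝ) ≤ (p : ℝ) ^ 3 := one_le_pow₀ hp1
  have hpp : (p : ℝ) ≤ (3 * (p : ℝ)) ^ 3 := by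
    have : (p : ℝ) ≤ (p : ℝ) ^ 3 := le_self_pow₀ hp1 (by norm_num)
    nlinarith
  set Y := M ^ 2 / (Q / (3 * (p : ℝ)) ^ 3) ^ p with hY
  have hY0 : 0 ≤ Y := by positivity
  have hM0 : 0 < M := by linarith
  rcases le_or_gt Q ((3 * (p : ℝ)) ^ 3) with hsmall | hlarge
  · have : M ^ 2 ≤ Y := by
      refine le_div_self (by positivity) (by positivity) (pow_le_one₀ (by positivity) ?_)
      exact (div_le_one (by positivity)).2 hsmall
    nlinarith [sq_nonneg ε₃]
  have hQ27 : 27 < Q := by nlinarith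
  have htail : M ^ 2 / Q ^ (2 * (m + 1)) ≤ Y := by
    refine div_le_div_of_nonneg_left (by positivity) (by positivity) ?_
    calc (Q / (3 * (p : ℝ)) ^ 3) ^ p ≤ Q ^ p :=
          pow_le_pow_left₀ (by positivity) (div_le_self hQ0.le (by linarith)) p
      _ ≤ Q ^ (2 * (m + 1)) := pow_le_pow_right₀ (by linarith) (by omega)
  have htail' : 2 * (∫ x in (0 : ℝ)..1, |iteratedDeriv (m + 1) f x| ^ 2) / Q ^ (2 * (m + 1)) ≤
      8 * Y := by
    calc _ ≤ 2 * (4 * M ^ 2) / Q ^ (2 * (m + 1)) := by gcongr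
      _ = 8 * (M ^ 2 / Q ^ (2 * (m + 1))) := by ring
      _ ≤ _ := by linarith
  rcases le_or_gt Q N with hQN | hNQ
  · have h := integral_sq_le_sum_sine_coeff hf hs N hQ0 (by linarith)
    have hε₃' : ε₃ ^ 2 = ∑ j ∈ Finset.Icc 1 N,
        |∫ x in (0 : ℝ)..1, sin ((j : ℝ) * π * x) * f x| ^ 2 := by
      rw [hε₃, sq_sqrt (Finset.sum_nonneg fun _ _ => by positivity)]
    rw [← hε₃'] at h
    nlinarith [sq_nonneg ε₃]
  · set K := ⌊Q⌋₊ with hK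
    have hKQ : (K : ℝ) ≤ Q := Nat.floor_le hQ0.le
    have hQK : Q < K + 1 := Nat.lt_floor_add_one Q
    have hK27 : 27 ≤ K := Nat.le_floor (by exact_mod_cast hQ27.le)
    have hQL : Q ^ 3 ≤ L :=
      cube_le_of_le_rpow_mul_rpow hN0.le hL0.le (by linarith) hNQ.le le_rfl
    have hεK : ε₄ ≤ exp (-(K : ℝ) ^ 3) := by
      rw [← exp_log hε₄0]
      refine exp_le_exp.2 ?_
      have : (K : ℝ) ^ 3 ≤ Q ^ 3 := pow_le_pow_left₀ (Nat.cast_nonneg _) hKQ 3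
      linarith
    have hB : ∫ x in (0 : ℝ)..1, |f x| ≤ 2 * M :=
      integral_abs_le_of_integral_sq_le hf.continuous (by linarith) (by linarith)
    have hcoeff : ∀ j ∈ Finset.Icc 1 K,
        |∫ x in (0 : ℝ)..1, sin ((j : ℝ) * π * x) * f x| ^ 2 ≤ (3 * M * exp (-K)) ^ 2 := by
      intro j hj
      rw [Finset.mem_Icc] at hj
      refine pow_le_pow_left₀ (abs_nonneg _) ?_ 2
      refine (abs_sine_transform_le_exp_neg hf.continuous hB
        (fun κ hκ => hε₄ ▸ abs_sine_transform_le_iSup hf.continuous hκ) hK27 hεK hj.1 hj.2).trans ?_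
      gcongr
      linarith
    have hsum := Finset.sum_le_card_nsmul _ _ _ hcoeff
    rw [Nat.card_Icc, Nat.add_sub_cancel, nsmul_eq_mul] at hsum
    have hKexp : (K : ℝ) * exp (-K) ≤ 1 := by
      rw [exp_neg, ← div_eq_mul_inv, div_le_one (exp_pos _)]
      linarith [add_one_le_exp (K : ℝ)]
    have hexp : exp (-(K : ℝ)) ≤ 3 * exp (-Q) := by
      calc exp (-(K : ℝ)) ≤ exp (1 + -Q) := exp_le_exp.2 (by linarith)
        _ = exp 1 * exp (-Q) := exp_add _ _
        _ ≤ 3 * exp (-Q) := by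
          gcongr
          linarith [exp_one_lt_d9]
    have hQY : M ^ 2 * exp (-Q) ≤ Y := by
      calc M ^ 2 * exp (-Q) ≤ M ^ 2 * (((3 * (p : ℝ)) ^ 3) ^ p / Q ^ p) := by
            refine mul_le_mul_of_nonneg_left ((exp_neg_le_pow_div_pow p hQ0).trans ?_)
              (by positivity)
            gcongr
        _ = Y := by
            rw [hY, div_pow]
            field_simp
    have hmid : (K : ℝ) * (3 * M * exp (-K)) ^ 2 ≤ 27 * Y := by
      calc (K : ℝ) * (3 * M * exp (-K)) ^ 2 = 9 * M ^ 2 * exp (-K) * (K * exp (-K)) := by ring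
        _ ≤ 9 * M ^ 2 * (3 * exp (-Q)) * 1 := by gcongr
        _ = 27 * (M ^ 2 * exp (-Q)) := by ring
        _ ≤ 27 * Y := by linarith
    have h := integral_sq_le_sum_sine_coeff hf hs K hQ0 hQK.le
    nlinarith [sq_nonneg ε₃]
end

section
/- Let n ≥ 1 be an integer and let h : ℝ → ℂ be n-times continuously differentiable with support contained in a compact subset of (0,1), with ‖h‖²_{H^n(0,1)} = Σ_{k=0}^{n} ∫₀¹ |h^{(k)}(x)|² dx. Then for every s > 0, ∫_s^∞ ( |∫₀¹ e^{iκx} h(x) dx|² + |∫₀¹ e^{−iκx} h(x) dx|² ) dκ ≤ 2 s^{−(2n−1)} ‖h‖²_{H^n(0,1)}. -/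
open MeasureTheory Real

/-- Integrating by parts against `exp (c x)` transfers one derivative to the exponential
when the boundary values vanish. -/
theorem norm_integral_cexp_mul_deriv {g : ℝ → ℂ} (c : ℂ) (hg : Differentiable ℝ g)
    (hg' : Continuous (deriv g)) (h0 : g 0 = 0) (h1 : g 1 = 0) :
    ‖∫ x in (0:ℝ)..1, Complex.exp (c * x) * deriv g x‖ =
      ‖c‖ * ‖∫ x in (0:ℝ)..1, Complex.exp (c * x) * g x‖ := by
  have he : ∀ x : ℝ, HasDerivAt (fun x : ℝ => Complex.exp (c * x)) (c * Complex.exp (c * x)) x := by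
    intro x
    have := (((Complex.ofRealCLM.hasDerivAt (x := x)).const_mul c).cexp)
    simpa [mul_comm] using this
  rw [intervalIntegral.integral_mul_deriv_eq_deriv_mul (fun x _ => he x)
    (fun x _ => (hg x).hasDerivAt)
    ((by fun_prop : Continuous fun x : ℝ => c * Complex.exp (c * x)).intervalIntegrable _ _)
    (hg'.intervalIntegrable _ _)]
  simp [h0, h1, mul_assoc, intervalIntegral.integral_const_mul]

theorem norm_integral_cexp_mul_iteratedDeriv {n : ℕ} {h : ℝ → ℂ} (c : ℂ)
    (hd : ContDiff ℝ n h) (hsupp : tsupport h ⊆ Set.Ioo 0 1) {k : ℕ} (hk : k ≤ n) :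
    ‖∫ x in (0:ℝ)..1, Complex.exp (c * x) * iteratedDeriv k h x‖ =
      ‖c‖ ^ k * ‖∫ x in (0:ℝ)..1, Complex.exp (c * x) * h x‖ := by
  induction k with
  | zero => simp
  | succ k ih =>
    have hzero : ∀ x ∉ Set.Ioo (0:ℝ) 1, iteratedDeriv k h x = 0 := by
      intro x hx
      have hx' : x ∉ tsupport (iteratedFDeriv ℝ k h) :=
        fun hmem => hx (hsupp (tsupport_iteratedFDeriv_subset k hmem))
      rw [iteratedDeriv_eq_iteratedFDeriv, image_eq_zero_of_notMem_tsupport hx']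
      rfl
    have hstep := norm_integral_cexp_mul_deriv (g := iteratedDeriv k h) c
      (hd.differentiable_iteratedDeriv k (by exact_mod_cast hk))
      (by
        rw [← iteratedDeriv_succ]
        exact hd.continuous_iteratedDeriv (k + 1) (by exact_mod_cast hk))
      (hzero 0 (by simp)) (hzero 1 (by simp))
    rw [iteratedDeriv_succ, hstep, ih (by omega), pow_succ]
    ring

theorem sq_integral_le_integral_sq {f : ℝ → ℝ} (hf : Continuous f) :
    (∫ x in (0:ℝ)..1, f x) ^ 2 ≤ ∫ x in (0:ℝ)..1, f x ^ 2 := by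
  set m := ∫ x in (0:ℝ)..1, f x with hm
  have hnn : 0 ≤ ∫ x in (0:ℝ)..1, (f x ^ 2 - 2 * m * f x + m ^ 2) :=
    intervalIntegral.integral_nonneg zero_le_one fun x _ => by nlinarith [sq_nonneg (f x - m)]
  rw [intervalIntegral.integral_add
      ((by fun_prop : Continuous fun x => f x ^ 2 - 2 * m * f x).intervalIntegrable _ _)
      (by simp),
    intervalIntegral.integral_sub
      ((by fun_prop : Continuous fun x => f x ^ 2).intervalIntegrable _ _)
      ((by fun_prop : Continuous fun x => 2 * m * f x).intervalIntegrable _ _),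
    intervalIntegral.integral_const_mul, ← hm] at hnn
  simp only [intervalIntegral.integral_const, sub_zero, smul_eq_mul, one_mul] at hnn
  linarith

theorem sq_norm_integral_cexp_mul_le {f : ℝ → ℂ} {c : ℂ} (hc : c.re = 0) (hf : Continuous f) :
    ‖∫ x in (0:ℝ)..1, Complex.exp (c * x) * f x‖ ^ 2 ≤ ∫ x in (0:ℝ)..1, ‖f x‖ ^ 2 := by
  refine le_trans ?_ (sq_integral_le_integral_sq hf.norm)
  gcongr
  refine (intervalIntegral.norm_integral_le_integral_norm zero_le_one).trans_eq ?_
  simp [Complex.norm_exp, hc]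

/-- Pointwise decay of the Fourier data of a compactly supported `Cⁿ` function. -/
theorem sq_norm_integral_cexp_mul_le_rpow {n : ℕ} {h : ℝ → ℂ} (hd : ContDiff ℝ n h)
    (hsupp : tsupport h ⊆ Set.Ioo 0 1) {c : ℂ} (hc : c.re = 0) {κ : ℝ} (hκ : 0 < κ)
    (hcκ : ‖c‖ = κ) :
    ‖∫ x in (0:ℝ)..1, Complex.exp (c * x) * h x‖ ^ 2 ≤
      κ ^ (-(2 * (n:ℝ))) * ∫ x in (0:ℝ)..1, ‖iteratedDeriv n h x‖ ^ 2 := by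
  have hle := sq_norm_integral_cexp_mul_le hc (hd.continuous_iteratedDeriv n le_rfl)
  rw [norm_integral_cexp_mul_iteratedDeriv c hd hsupp le_rfl, hcκ, mul_pow, ← pow_mul] at hle
  have hpow : κ ^ (-(2 * (n:ℝ))) = (κ ^ (n * 2))⁻¹ := by
    rw [Real.rpow_neg hκ.le, ← Real.rpow_natCast]
    push_cast
    rw [mul_comm (n:ℝ)]
  rw [hpow, inv_mul_eq_div, le_div_iff₀ (by positivity)]
  linarith

/-- Lemma 3.4 of the paper (first estimate): the high-frequency tail of the
Fourier data of a compactly supported `Hⁿ` function decays like `s^{-(2n-1)}`. -/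
theorem high_frequency_tail_mean (n : ℕ) (hn : 1 ≤ n) (h : ℝ → ℂ)
    (hd : ContDiff ℝ n h) (hsupp : tsupport h ⊆ Set.Ioo 0 1)
    (s : ℝ) (hs : 0 < s) :
    (∫ κ in Set.Ioi s,
      (‖∫ x in (0:ℝ)..1, Complex.exp (Complex.I * κ * x) * h x‖^2 +
       ‖∫ x in (0:ℝ)..1, Complex.exp (-(Complex.I * κ * x)) * h x‖^2)) ≤
      2 * s^(-(2*(n:ℝ)-1)) *
        ∑ k ∈ Finset.range (n+1), ∫ x in (0:ℝ)..1, ‖iteratedDeriv k h x‖^2 := by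
  have hn' : (1:ℝ) ≤ n := by exact_mod_cast hn
  set A := ∫ x in (0:ℝ)..1, ‖iteratedDeriv n h x‖ ^ 2
  have hnonneg : ∀ k, 0 ≤ ∫ x in (0:ℝ)..1, ‖iteratedDeriv k h x‖ ^ 2 := fun k =>
    intervalIntegral.integral_nonneg zero_le_one fun x _ => by positivity
  have hAle : A ≤ ∑ k ∈ Finset.range (n+1), ∫ x in (0:ℝ)..1, ‖iteratedDeriv k h x‖^2 :=
    Finset.single_le_sum (f := fun k => ∫ x in (0:ℝ)..1, ‖iteratedDeriv k h x‖^2)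
      (fun k _ => hnonneg k) (by simp)
  have hexp : -(2 * (n:ℝ)) < -1 := by linarith
  have hint : IntegrableOn (fun κ : ℝ => κ ^ (-(2 * (n:ℝ))) * (2 * A)) (Set.Ioi s) :=
    (integrableOn_Ioi_rpow_of_lt hexp hs).mul_const _
  calc
    _ ≤ ∫ κ in Set.Ioi s, κ ^ (-(2 * (n:ℝ))) * (2 * A) := by
      refine integral_mono_of_nonneg (ae_of_all _ fun κ => by positivity) hint ?_
      filter_upwards [ae_restrict_mem measurableSet_Ioi] with κ hκ
      have hκ0 : 0 < κ := hs.trans hκ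
      have hpos := sq_norm_integral_cexp_mul_le_rpow hd hsupp (c := Complex.I * κ)
        (by simp) hκ0 (by simp [abs_of_pos hκ0])
      have hneg := sq_norm_integral_cexp_mul_le_rpow hd hsupp (c := -(Complex.I * κ))
        (by simp) hκ0 (by simp [abs_of_pos hκ0])
      simp only [neg_mul] at hneg
      linarith
    _ = s ^ (-(2 * (n:ℝ) - 1)) / (2 * n - 1) * (2 * A) := by
      rw [integral_mul_const, integral_Ioi_rpow_of_lt hexp hs,
        show -(2 * (n:ℝ)) + 1 = -(2 * n - 1) by ring, neg_div_neg_eq]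
    _ ≤ s ^ (-(2 * (n:ℝ) - 1)) * (2 * A) := by
      have hA0 : 0 ≤ A := hnonneg n
      gcongr
      exact div_le_self (by positivity) (by linarith)
    _ = 2 * s ^ (-(2 * (n:ℝ) - 1)) * A := by ring
    _ ≤ _ := by gcongr
end

section
/- Let n ≥ 1 be an integer and let p : ℝ → ℂ be n-times continuously differentiable with support contained in a compact subset of (0,1), with ‖p‖²_{H^n(0,1)} = Σ_{k=0}^{n} ∫₀¹ |p^{(k)}(x)|² dx. Then for every s > 0, ∫_s^∞ ( |∫₀¹ e^{2iκx} p(x) dx|² + |∫₀¹ e^{−2iκx} p(x) dx|² ) dκ ≤ 2 s^{−(2n−1)} ‖p‖²_{H^n(0,1)}. -/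
open MeasureTheory Real

/-- Repeated integration by parts against an exponential, without boundary terms. -/
lemma pow_mul_integral_exp_mul_eq (n : ℕ) (p : ℝ → ℂ) (hd : ContDiff ℝ n p)
    (hsupp : tsupport p ⊆ Set.Ioo 0 1) (a : ℂ) :
    (-a) ^ n * ∫ x in (0:ℝ)..1, Complex.exp (a * x) * p x =
      ∫ x in (0:ℝ)..1, Complex.exp (a * x) * iteratedDeriv n p x := by
  induction n generalizing p with
  | zero => simp
  | succ n ih =>
    have hd1 : ContDiff ℝ 1 p := hd.of_le (by exact_mod_cast Nat.succ_le_succ n.zero_le)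
    have hd' : ContDiff ℝ n (deriv p) := by
      push_cast at hd
      exact (contDiff_succ_iff_deriv.1 hd).2.2
    have hsupp' : tsupport (deriv p) ⊆ Set.Ioo 0 1 := tsupport_deriv_subset.trans hsupp
    have h0 : p 0 = 0 := image_eq_zero_of_notMem_tsupport fun h => by simpa using hsupp h
    have h1 : p 1 = 0 := image_eq_zero_of_notMem_tsupport fun h => by simpa using hsupp h
    have hexp (x : ℝ) :
        HasDerivAt (fun x : ℝ => Complex.exp (a * x)) (Complex.exp (a * x) * a) x := by
      simpa using ((Complex.ofRealCLM.hasDerivAt (x := x)).const_mul a).cexp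
    have hcont : Continuous fun x : ℝ => Complex.exp (a * x) * a := by fun_prop
    have key := intervalIntegral.integral_mul_deriv_eq_deriv_mul (a := 0) (b := 1)
      (fun x _ => hexp x)
      (fun x _ => (hd1.differentiable one_ne_zero x).hasDerivAt)
      (hcont.intervalIntegrable 0 1)
      ((hd1.continuous_deriv le_rfl).intervalIntegrable 0 1)
    rw [iteratedDeriv_succ', ← ih _ hd' hsupp', key, h0, h1, pow_succ, mul_assoc,
      ← intervalIntegral.integral_const_mul]
    simp only [mul_zero, sub_zero, zero_sub, ← intervalIntegral.integral_neg]
    congr 2 with x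
    ring

/-- The Cauchy–Schwarz inequality on the unit interval, against a unimodular weight. -/
lemma norm_integral_unimodular_mul_sq_le (e q : ℝ → ℂ) (he : ∀ x, ‖e x‖ = 1)
    (hq : Continuous q) :
    ‖∫ x in (0:ℝ)..1, e x * q x‖ ^ 2 ≤ ∫ x in (0:ℝ)..1, ‖q x‖ ^ 2 := by
  set m := ∫ x in (0:ℝ)..1, ‖q x‖ with hm
  have hle : ‖∫ x in (0:ℝ)..1, e x * q x‖ ≤ m := by
    simpa [he] using
      intervalIntegral.norm_integral_le_integral_norm (μ := volume) (f := fun x => e x * q x)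
        zero_le_one
  have hvar : 0 ≤ ∫ x in (0:ℝ)..1, (‖q x‖ - m) ^ 2 :=
    intervalIntegral.integral_nonneg zero_le_one fun x _ => sq_nonneg _
  have hexpand : ∫ x in (0:ℝ)..1, (‖q x‖ - m) ^ 2 = (∫ x in (0:ℝ)..1, ‖q x‖ ^ 2) - m ^ 2 := by
    have h1 : Continuous fun x => ‖q x‖ ^ 2 := by fun_prop
    have h2 : Continuous fun x => 2 * m * ‖q x‖ := by fun_prop
    have h12 : Continuous fun x => ‖q x‖ ^ 2 - 2 * m * ‖q x‖ := h1.sub h2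
    have heq : ∀ x, (‖q x‖ - m) ^ 2 = ‖q x‖ ^ 2 - 2 * m * ‖q x‖ + m ^ 2 := fun x => by ring
    simp only [heq]
    rw [intervalIntegral.integral_add (h12.intervalIntegrable 0 1) intervalIntegrable_const,
      intervalIntegral.integral_sub (h1.intervalIntegrable 0 1) (h2.intervalIntegrable 0 1),
      intervalIntegral.integral_const_mul, ← hm]
    simp
    ring
  calc _ ≤ m ^ 2 := by gcongr
    _ ≤ _ := by linarith

/-- Pointwise decay of the Fourier–Laplace integral of a `Cⁿ` function supported in `(0, 1)`. -/
lemma norm_integral_exp_mul_sq_le (n : ℕ) (p : ℝ → ℂ) (hd : ContDiff ℝ n p)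
    (hsupp : tsupport p ⊆ Set.Ioo 0 1) (a : ℂ) (hre : a.re = 0) (ha : a ≠ 0) :
    ‖∫ x in (0:ℝ)..1, Complex.exp (a * x) * p x‖ ^ 2 ≤
      (∫ x in (0:ℝ)..1, ‖iteratedDeriv n p x‖ ^ 2) / ‖a‖ ^ (2 * n) := by
  have hpos : 0 < ‖a‖ := norm_pos_iff.2 ha
  have hcs := norm_integral_unimodular_mul_sq_le (fun x : ℝ => Complex.exp (a * x))
    (iteratedDeriv n p) (fun x => by simp [Complex.norm_exp, hre])
    (hd.continuous_iteratedDeriv n le_rfl)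
  rw [← pow_mul_integral_exp_mul_eq n p hd hsupp a, norm_mul, norm_pow, norm_neg, mul_pow,
    ← pow_mul, mul_comm n 2] at hcs
  rwa [le_div_iff₀' (by positivity)]

/-- Lemma 3.4 of the paper (second estimate): the high-frequency tail of the
data `|∫₀¹ e^{±2iκx}p dx|²` of a compactly supported `Hⁿ` function decays like `s^{-(2n-1)}`. -/
theorem high_frequency_tail_variance (n : ℕ) (hn : 1 ≤ n) (p : ℝ → ℂ)
    (hd : ContDiff ℝ n p) (hsupp : tsupport p ⊆ Set.Ioo 0 1)
    (s : ℝ) (hs : 0 < s) :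
    (∫ κ in Set.Ioi s,
      (‖∫ x in (0:ℝ)..1, Complex.exp (2 * Complex.I * κ * x) * p x‖^2 +
       ‖∫ x in (0:ℝ)..1, Complex.exp (-(2 * Complex.I * κ * x)) * p x‖^2)) ≤
      2 * s^(-(2*(n:ℝ)-1)) *
        ∑ k ∈ Finset.range (n+1), ∫ x in (0:ℝ)..1, ‖iteratedDeriv k p x‖^2 := by
  set N := ∑ k ∈ Finset.range (n+1), ∫ x in (0:ℝ)..1, ‖iteratedDeriv k p x‖^2 with hN
  have hterm (k : ℕ) : 0 ≤ ∫ x in (0:ℝ)..1, ‖iteratedDeriv k p x‖ ^ 2 :=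
    intervalIntegral.integral_nonneg zero_le_one fun x _ => sq_nonneg _
  have hN0 : 0 ≤ N := Finset.sum_nonneg fun k _ => hterm k
  have hnN : ∫ x in (0:ℝ)..1, ‖iteratedDeriv n p x‖ ^ 2 ≤ N :=
    Finset.single_le_sum (f := fun k => ∫ x in (0:ℝ)..1, ‖iteratedDeriv k p x‖ ^ 2)
      (fun k _ => hterm k) (Finset.self_mem_range_succ n)
  have hn' : (1:ℝ) ≤ n := by exact_mod_cast hn
  have hexp : -(2 * (n:ℝ)) < -1 := by linarith
  have hdecay (κ : ℝ) (hκ : 0 < κ) (a : ℂ) (hre : a.re = 0) (ha : ‖a‖ = 2 * κ) :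
      ‖∫ x in (0:ℝ)..1, Complex.exp (a * x) * p x‖ ^ 2 ≤ N * κ ^ (-(2 * (n:ℝ))) := by
    have hpow : κ ^ (-(2 * (n:ℝ))) = (κ ^ (2 * n))⁻¹ := by
      rw [rpow_neg hκ.le, ← rpow_natCast]
      push_cast
      rfl
    have h := norm_integral_exp_mul_sq_le n p hd hsupp a hre
      (norm_pos_iff.1 (by rw [ha]; positivity))
    rw [ha] at h
    rw [hpow, ← div_eq_mul_inv]
    refine h.trans ?_
    gcongr
    linarith
  calc _ ≤ ∫ κ in Set.Ioi s, 2 * N * κ ^ (-(2 * (n:ℝ))) := by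
        refine integral_mono_of_nonneg (Filter.Eventually.of_forall fun κ => by positivity)
          ((integrableOn_Ioi_rpow_of_lt hexp hs).const_mul _) ?_
        filter_upwards [ae_restrict_mem measurableSet_Ioi] with κ hκ
        have hκ0 : 0 < κ := hs.trans hκ
        have h1 := hdecay κ hκ0 (2 * Complex.I * κ) (by simp) (by simp [abs_of_pos hκ0])
        have h2 := hdecay κ hκ0 (-(2 * Complex.I * κ)) (by simp) (by simp [abs_of_pos hκ0])
        simp only [neg_mul] at h2
        linarith
    _ = 2 * N * (s ^ (-(2 * (n:ℝ) - 1)) / (2 * n - 1)) := by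
        rw [integral_const_mul, integral_Ioi_rpow_of_lt hexp hs, ← neg_div_neg_eq, neg_neg]
        ring_nf
    _ ≤ 2 * N * s ^ (-(2 * (n:ℝ) - 1)) := by
        gcongr
        exact div_le_self (by positivity) (by linarith)
    _ = _ := by ring
end

section
/- There exists an absolute constant C > 0 with the following property. Let n ≥ 1 be an integer, M > 1, K > 1, and let f₁, f₂ : ℝ → ℂ be n-times continuously differentiable, supported in a compact subset of (0,1), with ‖fⱼ‖_{H^n(0,1)} ≤ M. For s > 0 set I₁(s) = ∫₀^s ( |∫₀¹ e^{iκx}(f₁−f₂)(x) dx|² + |∫₀¹ e^{−iκx}(f₁−f₂)(x) dx|² ) dκ, and set ε₁ = I₁(K)^{1/2}. If 0 < ε₁ < 1, then there exists a function μ : (K, ∞) → ℝ with μ(s) ≥ 1/2 for s ∈ (K, 2^{1/4}K) and μ(s) ≥ (1/π)((s/K)⁴ − 1)^{−1/2} for s ∈ (2^{1/4}K, ∞), such that I₁(s) ≤ C M² e^{3s} ε₁^{2μ(s)} for all s ∈ (K, ∞). -/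
open MeasureTheory Real

/-- A branch of `(ζ² + a²) ^ (1/4)` that is continuous on the closed right half-plane. -/
noncomputable def fourthRootBranch (a : ℝ) (ζ : ℂ) : ℂ :=
  (ζ + a * Complex.I) ^ (4 : ℂ)⁻¹ * (ζ - a * Complex.I) ^ (4 : ℂ)⁻¹

/-- An analytic function on the right half-plane whose modulus is
`exp (c * (arg (ζ + a i) - arg (ζ - a i)))`. -/
noncomputable def angleWeight (a c : ℝ) (ζ : ℂ) : ℂ :=
  Complex.exp (-Complex.I * c * (Complex.log (ζ + a * Complex.I) - Complex.log (ζ - a * Complex.I)))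

lemma norm_angleWeight (a c : ℝ) (ζ : ℂ) : ‖angleWeight a c ζ‖ =
    Real.exp (c * ((ζ + a * Complex.I).arg - (ζ - a * Complex.I).arg)) := by
  simp [angleWeight, Complex.norm_exp, Complex.log_im]

lemma norm_angleWeight_le {a c : ℝ} (hc : 0 ≤ c) {ζ : ℂ} (hζ : 0 ≤ ζ.re) :
    ‖angleWeight a c ζ‖ ≤ Real.exp (c * π) := by
  rw [norm_angleWeight]
  have h₁ := abs_le.1 (Complex.abs_arg_le_pi_div_two_iff (z := ζ + a * Complex.I) |>.2 (by simpa))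
  have h₂ := abs_le.1 (Complex.abs_arg_le_pi_div_two_iff (z := ζ - a * Complex.I) |>.2 (by simpa))
  gcongr
  linarith

lemma fourthRootBranch_eq_exp {a : ℝ} {ζ : ℂ} (h₁ : ζ + a * Complex.I ≠ 0)
    (h₂ : ζ - a * Complex.I ≠ 0) : fourthRootBranch a ζ =
      Complex.exp ((Complex.log (ζ + a * Complex.I) + Complex.log (ζ - a * Complex.I)) / 4) := by
  rw [fourthRootBranch, Complex.cpow_def_of_ne_zero h₁, Complex.cpow_def_of_ne_zero h₂,
    ← Complex.exp_add]
  ring_nf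

lemma fourthRootBranch_eq_zero {a : ℝ} {ζ : ℂ}
    (h : ζ + a * Complex.I = 0 ∨ ζ - a * Complex.I = 0) : fourthRootBranch a ζ = 0 := by
  rcases h with h | h <;> simp [fourthRootBranch, h]

lemma abs_im_exp_le_re_exp {w : ℂ} (hw : |w.im| ≤ π / 4) :
    |(Complex.exp w).im| ≤ (Complex.exp w).re := by
  rw [Complex.exp_im, Complex.exp_re, abs_mul, abs_of_pos (Real.exp_pos _)]
  gcongr
  have hpi := Real.pi_pos
  rw [← Real.cos_abs w.im, Real.abs_sin_eq_sin_abs_of_abs_le_pi (by linarith),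
    ← Real.cos_pi_div_two_sub]
  exact Real.cos_le_cos_of_nonneg_of_le_pi (abs_nonneg _) (by linarith [abs_nonneg w.im])
    (by linarith)

lemma abs_im_fourthRootBranch_le (a : ℝ) {ζ : ℂ} (hζ : 0 ≤ ζ.re) :
    |(fourthRootBranch a ζ).im| ≤ (fourthRootBranch a ζ).re := by
  by_cases h : ζ + a * Complex.I = 0 ∨ ζ - a * Complex.I = 0
  · simp [fourthRootBranch_eq_zero h]
  push Not at h
  rw [fourthRootBranch_eq_exp h.1 h.2]
  apply abs_im_exp_le_re_exp
  have h₁ := abs_le.1 (Complex.abs_arg_le_pi_div_two_iff (z := ζ + a * Complex.I) |>.2 (by simpa))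
  have h₂ := abs_le.1 (Complex.abs_arg_le_pi_div_two_iff (z := ζ - a * Complex.I) |>.2 (by simpa))
  simp only [Complex.div_ofNat_im, Complex.add_im, Complex.log_im]
  rw [abs_le]
  constructor <;> linarith

lemma fourthRootBranch_eq_ofReal {a : ℝ} {ζ : ℂ} (h₁ : ζ + a * Complex.I ≠ 0)
    (h₂ : ζ - a * Complex.I ≠ 0)
    (harg : (ζ + a * Complex.I).arg + (ζ - a * Complex.I).arg = 0) :
    fourthRootBranch a ζ =
      (((‖ζ + a * Complex.I‖ * ‖ζ - a * Complex.I‖) ^ (4⁻¹ : ℝ) : ℝ) : ℂ) := by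
  have n₁ := norm_pos_iff.2 h₁
  have n₂ := norm_pos_iff.2 h₂
  rw [fourthRootBranch_eq_exp h₁ h₂, Real.rpow_def_of_pos (by positivity),
    Real.log_mul n₁.ne' n₂.ne', Complex.ofReal_exp]
  congr 1
  apply Complex.ext
  · simp [Complex.log_re]; ring
  · simp only [Complex.div_ofNat_im, Complex.add_im, Complex.log_im, harg, Complex.ofReal_im]
    simp

lemma arg_add_mul_I_of_pos {x a : ℝ} (hx : 0 < x) :
    ((x : ℂ) + a * Complex.I).arg = Real.arctan (a / x) := by
  have h := abs_lt.1 (Complex.abs_arg_lt_pi_div_two_iff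
    (z := (x : ℂ) + a * Complex.I) |>.2 (Or.inl (by simpa)))
  rw [← Real.arctan_tan h.1 h.2, Complex.tan_arg]
  simp

lemma arg_sub_mul_I_of_pos {x a : ℝ} (hx : 0 < x) :
    ((x : ℂ) - a * Complex.I).arg = -Real.arctan (a / x) := by
  have := arg_add_mul_I_of_pos (a := -a) hx
  rw [neg_div, Real.arctan_neg] at this
  rw [← this]
  push_cast
  ring_nf

lemma continuousAt_fourthRootBranch (a : ℝ) {ζ : ℂ} (hζ : 0 ≤ ζ.re) :
    ContinuousAt (fourthRootBranch a) ζ := by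
  have key (w : ℂ) (hw : 0 ≤ w.re) : ContinuousAt (fun z : ℂ => z ^ (4 : ℂ)⁻¹) w :=
    (Complex.continuousAt_cpow_const_of_re_pos (Or.inl hw) (by norm_num))
  exact (ContinuousAt.comp (f := fun ζ : ℂ => ζ + a * Complex.I) (key _ (by simpa))
    (by fun_prop)).mul
    (ContinuousAt.comp (f := fun ζ : ℂ => ζ - a * Complex.I) (key _ (by simpa)) (by fun_prop))

lemma mem_slitPlane_of_re_nonneg {z : ℂ} (hz : 0 ≤ z.re) (h : z ≠ 0) : z ∈ Complex.slitPlane := by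
  rw [Complex.mem_slitPlane_iff]
  by_contra! hc
  exact h (Complex.ext (le_antisymm hc.1 hz) hc.2)

/-- The two-constants estimate in the sector `|arg z| < π / 4` slit along `(0, K]`. -/
theorem norm_le_of_sector_of_slit {F : ℂ → ℂ} {A B K δ s : ℝ} (hF : Differentiable ℂ F)
    (hF0 : F 0 = 0) (hA : 0 ≤ A) (hB : 1 ≤ B) (hK : 0 < K) (hδ : 0 < δ) (hδ1 : δ ≤ 1)
    (hsector : ∀ z : ℂ, |z.im| ≤ z.re → ‖F z‖ ≤ B * Real.exp (A * z.re))
    (hslit : ∀ t : ℝ, 0 ≤ t → t ≤ K → ‖F t‖ ≤ δ) (hs : K < s) :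
    ‖F s‖ ≤ B * Real.exp (A * s) * δ ^ (2 / π * Real.arctan (K ^ 2 / √(s ^ 4 - K ^ 4))) := by
  set a : ℝ := K ^ 2 with ha
  set c : ℝ := -(Real.log δ / π) with hc
  have hpi := Real.pi_pos
  have hc0 : 0 ≤ c := by
    have := Real.log_nonpos hδ.le hδ1
    rw [hc, ← neg_div]
    exact div_nonneg (by linarith) hpi.le
  have hcexp : Real.exp (c * π) = δ⁻¹ := by
    rw [hc, neg_mul, div_mul_cancel₀ _ hpi.ne', Real.exp_neg, Real.exp_log hδ]
  set h : ℂ → ℂ := fun ζ => F (fourthRootBranch a ζ) *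
    Complex.exp (-A * fourthRootBranch a ζ) * angleWeight a c ζ with hh
  have hnorm (ζ : ℂ) : ‖h ζ‖ = ‖F (fourthRootBranch a ζ)‖ *
      Real.exp (-(A * (fourthRootBranch a ζ).re)) * ‖angleWeight a c ζ‖ := by
    simp [hh, Complex.norm_exp]
  have hfirst (ζ : ℂ) (hζ : 0 ≤ ζ.re) : ‖F (fourthRootBranch a ζ)‖ *
      Real.exp (-(A * (fourthRootBranch a ζ).re)) ≤ B := by
    calc _ ≤ B * Real.exp (A * (fourthRootBranch a ζ).re) *
          Real.exp (-(A * (fourthRootBranch a ζ).re)) := by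
          gcongr
          exact hsector _ (abs_im_fourthRootBranch_le a hζ)
      _ = B := by rw [mul_assoc, ← Real.exp_add]; simp
  have hbdd (ζ : ℂ) (hζ : 0 ≤ ζ.re) : ‖h ζ‖ ≤ B * Real.exp (c * π) := by
    rw [hnorm]
    gcongr
    · exact hfirst ζ hζ
    · exact norm_angleWeight_le hc0 hζ
  have hplus (ζ : ℂ) (hζ : 0 ≤ ζ.re) (h0 : ζ + a * Complex.I ≠ 0) :
      ζ + a * Complex.I ∈ Complex.slitPlane := mem_slitPlane_of_re_nonneg (by simpa) h0
  have hminus (ζ : ℂ) (hζ : 0 ≤ ζ.re) (h0 : ζ - a * Complex.I ≠ 0) :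
      ζ - a * Complex.I ∈ Complex.slitPlane := mem_slitPlane_of_re_nonneg (by simpa) h0
  have hdiff : DiffContOnCl ℂ h {z | 0 < z.re} := by
    constructor
    · intro ζ hζ
      have hζ' : 0 < ζ.re := hζ
      have h1 := Complex.mem_slitPlane_iff (z := ζ + a * Complex.I) |>.2 (Or.inl (by simpa))
      have h2 := Complex.mem_slitPlane_iff (z := ζ - a * Complex.I) |>.2 (Or.inl (by simpa))
      have hd : DifferentiableAt ℂ (fourthRootBranch a) ζ := by
        unfold fourthRootBranch
        exact ((by fun_prop : DifferentiableAt ℂ (fun ζ : ℂ => ζ + a * Complex.I) ζ).cpow_const h1).mul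
          ((by fun_prop : DifferentiableAt ℂ (fun ζ : ℂ => ζ - a * Complex.I) ζ).cpow_const h2)
      have hw : DifferentiableAt ℂ (angleWeight a c) ζ := by
        unfold angleWeight
        exact ((((by fun_prop : DifferentiableAt ℂ (fun ζ : ℂ => ζ + a * Complex.I) ζ).clog h1).sub
          ((by fun_prop : DifferentiableAt ℂ (fun ζ : ℂ => ζ - a * Complex.I) ζ).clog h2)).const_mul
          _).cexp
      exact (((hF.differentiableAt.comp ζ hd).mul (hd.const_mul _).cexp).mul hw).differentiableWithinAt
    · rw [Complex.closure_setOfPred_lt_re]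
      intro ζ hζ
      have hζ' : 0 ≤ ζ.re := hζ
      have hcz := continuousAt_fourthRootBranch a hζ'
      have hc1 : ContinuousAt (fun ζ => F (fourthRootBranch a ζ) *
          Complex.exp (-A * fourthRootBranch a ζ)) ζ :=
        (ContinuousAt.comp hF.continuous.continuousAt hcz).mul (continuousAt_const.mul hcz).cexp
      by_cases hz : ζ + a * Complex.I = 0 ∨ ζ - a * Complex.I = 0
      · have hv : F (fourthRootBranch a ζ) * Complex.exp (-A * fourthRootBranch a ζ) = 0 := by
          rw [fourthRootBranch_eq_zero hz, hF0, zero_mul]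
        have hval : h ζ = 0 := by simp only [hh, hv, zero_mul]
        rw [ContinuousWithinAt, hval]
        refine Filter.Tendsto.zero_mul_isBoundedUnder_le ?_ ?_
        · have := hc1.continuousWithinAt (s := {z | 0 ≤ z.re})
          rwa [ContinuousWithinAt, hv] at this
        · refine Filter.isBoundedUnder_of_eventually_le (a := Real.exp (c * π)) ?_
          filter_upwards [self_mem_nhdsWithin] with w hw
          exact norm_angleWeight_le hc0 hw
      · push Not at hz
        refine (hc1.mul ?_).continuousWithinAt
        unfold angleWeight
        exact (continuousAt_const.mul
          (((by fun_prop : ContinuousAt (fun ζ : ℂ => ζ + a * Complex.I) ζ).clog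
            (hplus ζ hζ' hz.1)).sub
          ((by fun_prop : ContinuousAt (fun ζ : ℂ => ζ - a * Complex.I) ζ).clog
            (hminus ζ hζ' hz.2)))).cexp
  have him (t : ℝ) : ‖h (t * Complex.I)‖ ≤ B := by
    have hre : 0 ≤ ((t : ℂ) * Complex.I).re := by simp
    have hp : (t : ℂ) * Complex.I + a * Complex.I = ((t + a : ℝ) : ℂ) * Complex.I := by
      push_cast; ring
    have hm : (t : ℂ) * Complex.I - a * Complex.I = ((t - a : ℝ) : ℂ) * Complex.I := by
      push_cast; ring
    have hpos (r : ℝ) (hr : 0 < r) : ((r : ℂ) * Complex.I).arg = π / 2 := by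
      rw [Complex.arg_eq_pi_div_two_iff]; simpa
    have hneg (r : ℝ) (hr : r < 0) : ((r : ℂ) * Complex.I).arg = -(π / 2) := by
      rw [Complex.arg_eq_neg_pi_div_two_iff]; simpa
    have ha0 : 0 < a := by positivity
    by_cases hz : (t : ℂ) * Complex.I + a * Complex.I = 0 ∨ (t : ℂ) * Complex.I - a * Complex.I = 0
    · simp only [hh, fourthRootBranch_eq_zero hz, hF0]
      simp; linarith
    push Not at hz
    have hp0 : t + a ≠ 0 := by intro h0; apply hz.1; rw [hp, h0]; simp
    have hm0 : t - a ≠ 0 := by intro h0; apply hz.2; rw [hm, h0]; simp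
    rw [hnorm]
    have hone (heq : ((t : ℂ) * Complex.I + a * Complex.I).arg =
        ((t : ℂ) * Complex.I - a * Complex.I).arg) :
        ‖F (fourthRootBranch a (t * Complex.I))‖ *
          Real.exp (-(A * (fourthRootBranch a (t * Complex.I)).re)) *
          ‖angleWeight a c (t * Complex.I)‖ ≤ B := by
      rw [norm_angleWeight, heq]
      simpa using hfirst _ hre
    rcases lt_or_gt_of_ne hp0 with h1 | h1
    · apply hone
      rw [hp, hm, hneg _ h1, hneg _ (by linarith)]
    · rcases lt_or_gt_of_ne hm0 with h2 | h2
      · have hroot := fourthRootBranch_eq_ofReal hz.1 hz.2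
          (by rw [hp, hm, hpos _ h1, hneg _ h2]; ring)
        have hle : (‖(t : ℂ) * Complex.I + a * Complex.I‖ *
            ‖(t : ℂ) * Complex.I - a * Complex.I‖) ^ (4⁻¹ : ℝ) ≤ K := by
          rw [hp, hm]
          simp only [norm_mul, Complex.norm_real, Complex.norm_I, mul_one, Real.norm_eq_abs,
            abs_of_pos h1, abs_of_neg h2]
          calc _ ≤ (K ^ 4) ^ (4⁻¹ : ℝ) := by
                have : 0 ≤ (t + a) * -(t - a) := mul_nonneg h1.le (by linarith)
                gcongr
                rw [show K ^ 4 = a ^ 2 by rw [ha]; ring]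
                nlinarith [sq_nonneg t]
            _ = K := by
                have := Real.pow_rpow_inv_natCast hK.le (n := 4) (by norm_num)
                simpa using this
        set r := (‖(t : ℂ) * Complex.I + a * Complex.I‖ *
            ‖(t : ℂ) * Complex.I - a * Complex.I‖) ^ (4⁻¹ : ℝ)
        have hr0 : 0 ≤ r := by positivity
        rw [hroot]
        calc _ ≤ δ * 1 * δ⁻¹ := by
              gcongr
              · exact hslit r hr0 hle
              · rw [Real.exp_le_one_iff, Complex.ofReal_re]
                have := mul_nonneg hA hr0
                linarith
              · rw [← hcexp]; exact norm_angleWeight_le hc0 hre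
          _ = 1 := by field_simp
          _ ≤ B := hB
      · apply hone
        rw [hp, hm, hpos _ h1, hpos _ h2]
  have hfinal : ∀ ζ : ℂ, 0 ≤ ζ.re → ‖h ζ‖ ≤ B := by
    intro ζ hζ
    refine PhragmenLindelof.right_half_plane_of_bounded_on_real hdiff ⟨0, by norm_num, 0, ?_⟩ ?_
      him hζ
    · simp only [zero_mul, Real.exp_zero]
      refine Asymptotics.IsBigO.of_bound (B * Real.exp (c * π)) ?_
      refine Filter.Eventually.filter_mono inf_le_right ?_
      rw [Filter.eventually_principal]
      intro w hw
      simpa using hbdd w (le_of_lt hw)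
    · refine Filter.isBoundedUnder_of_eventually_le (a := B * Real.exp (c * π)) ?_
      filter_upwards [Filter.eventually_ge_atTop 0] with x hx
      exact hbdd x (by simpa)
  have hs0 : 0 < s := hK.trans hs
  have hsub : 0 < s ^ 4 - K ^ 4 := by
    have : K ^ 4 < s ^ 4 := by gcongr
    linarith
  set x := √(s ^ 4 - K ^ 4) with hx
  have hx0 : 0 < x := Real.sqrt_pos.2 hsub
  have hxx : x ^ 2 = s ^ 4 - K ^ 4 := Real.sq_sqrt hsub.le
  have hroot : fourthRootBranch a x = s := by
    rw [fourthRootBranch_eq_ofReal]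
    · have h1 : ‖(x : ℂ) + a * Complex.I‖ * ‖(x : ℂ) - a * Complex.I‖ = s ^ 4 := by
        rw [← norm_mul, show ((x : ℂ) + a * Complex.I) * (x - a * Complex.I) =
          ((x ^ 2 + a ^ 2 : ℝ) : ℂ) by push_cast; linear_combination (-(a:ℂ)^2) * Complex.I_sq,
          Complex.norm_real, hxx, ha, Real.norm_eq_abs, abs_of_pos] <;> ring_nf
        positivity
      rw [h1]
      have := Real.pow_rpow_inv_natCast hs0.le (n := 4) (by norm_num)
      simpa using this
    · intro h0
      have := congrArg Complex.re h0
      simp at this; linarith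
    · intro h0
      have := congrArg Complex.re h0
      simp at this; linarith
    · rw [arg_add_mul_I_of_pos hx0, arg_sub_mul_I_of_pos hx0]; ring
  have hle := hfinal x (by simpa using hx0.le)
  rw [hnorm, hroot, norm_angleWeight, arg_add_mul_I_of_pos hx0, arg_sub_mul_I_of_pos hx0,
    Complex.ofReal_re] at hle
  rw [Real.rpow_def_of_pos hδ]
  set θ := Real.arctan (a / x)
  have e1 : c * (θ - -θ) = -(Real.log δ * (2 / π * θ)) := by rw [hc]; ring
  rw [e1, mul_assoc, ← Real.exp_add] at hle
  calc ‖F s‖ = ‖F s‖ * Real.exp (-(A * s) + -(Real.log δ * (2 / π * θ))) *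
        (Real.exp (A * s) * Real.exp (Real.log δ * (2 / π * θ))) := by
        rw [mul_assoc, ← Real.exp_add, ← Real.exp_add]
        ring_nf; simp
    _ ≤ B * (Real.exp (A * s) * Real.exp (Real.log δ * (2 / π * θ))) := by gcongr
    _ = _ := by ring

/-- The Fourier–Laplace transform of `f` on the unit interval. -/
noncomputable def unitLaplace (f : ℝ → ℂ) (w : ℂ) : ℂ :=
  ∫ x in (0:ℝ)..1, Complex.exp (w * x) * f x

lemma differentiable_unitLaplace {f : ℝ → ℂ} (hf : Continuous f) :
    Differentiable ℂ (unitLaplace f) := by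
  intro w₀
  have hbound (x : ℝ) (hx : x ∈ Set.uIoc (0:ℝ) 1) (w : ℂ) (hw : w ∈ Metric.ball w₀ 1) :
      ‖x * Complex.exp (w * x) * f x‖ ≤ Real.exp (‖w₀‖ + 1) * ‖f x‖ := by
    rw [Set.uIoc_of_le zero_le_one] at hx
    have h1 : ‖w‖ ≤ ‖w₀‖ + 1 := by
      have := norm_le_norm_add_norm_sub' w w₀
      rw [mem_ball_iff_norm] at hw
      linarith
    have h2 : ‖Complex.exp (w * x)‖ ≤ Real.exp (‖w₀‖ + 1) := by
      refine (Complex.norm_exp_le_exp_norm _).trans ?_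
      gcongr
      rw [norm_mul, Complex.norm_real, Real.norm_eq_abs, abs_of_pos hx.1]
      nlinarith [norm_nonneg w, hx.2]
    rw [norm_mul, norm_mul, Complex.norm_real, Real.norm_eq_abs, abs_of_pos hx.1]
    gcongr
    nlinarith [norm_nonneg (Complex.exp (w * x)), hx.2]
  refine (intervalIntegral.hasDerivAt_integral_of_dominated_loc_of_deriv_le
    (F := fun w (x : ℝ) => Complex.exp (w * x) * f x)
    (F' := fun w (x : ℝ) => x * Complex.exp (w * x) * f x)
    (bound := fun x => Real.exp (‖w₀‖ + 1) * ‖f x‖)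
    (Metric.ball_mem_nhds w₀ one_pos) (Filter.Eventually.of_forall fun w => ?_) ?_ ?_
    (Filter.Eventually.of_forall hbound) ?_ ?_).2.differentiableAt
  · exact (by fun_prop : Continuous fun x : ℝ => Complex.exp (w * x) * f x).aestronglyMeasurable
  · exact (by fun_prop : Continuous fun x : ℝ => Complex.exp (w₀ * x) * f x).intervalIntegrable _ _
  · exact (by fun_prop : Continuous fun x : ℝ =>
      x * Complex.exp (w₀ * x) * f x).aestronglyMeasurable
  · exact (by fun_prop : Continuous fun x : ℝ =>
      Real.exp (‖w₀‖ + 1) * ‖f x‖).intervalIntegrable _ _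
  · refine Filter.Eventually.of_forall fun x _ w _ => ?_
    have := (((hasDerivAt_id w).mul_const (x : ℂ)).cexp).mul_const (f x)
    simp only [id, one_mul] at this
    rwa [mul_comm _ (x : ℂ)] at this

lemma norm_unitLaplace_le {f : ℝ → ℂ} (hf : Continuous f) {w : ℂ} {m : ℝ} (hm : |w.re| ≤ m) :
    ‖unitLaplace f w‖ ≤ Real.exp m * ∫ x in (0:ℝ)..1, ‖f x‖ := by
  rw [unitLaplace, ← intervalIntegral.integral_const_mul]
  refine intervalIntegral.norm_integral_le_of_norm_le zero_le_one
    (Filter.Eventually.of_forall fun x hx => ?_) ((by fun_prop : Continuous fun x =>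
      Real.exp m * ‖f x‖).intervalIntegrable _ _)
  rw [norm_mul, Complex.norm_exp]
  gcongr
  have h1 : (w * x).re = w.re * x := by simp
  rw [h1]
  nlinarith [le_abs_self w.re, abs_nonneg w.re, hx.1, hx.2]

lemma conj_unitLaplace (f : ℝ → ℂ) (w : ℂ) :
    (starRingEnd ℂ) (unitLaplace f w) =
      unitLaplace (fun x => (starRingEnd ℂ) (f x)) ((starRingEnd ℂ) w) := by
  simp only [unitLaplace]
  simp only [intervalIntegral.integral_of_le zero_le_one]
  rw [← integral_conj]
  simp [← Complex.exp_conj]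

/-- The L¹ norm on the unit interval is controlled by a bound on the L² norm. -/
lemma integral_norm_le_of_integral_sq_le_s13 {f : ℝ → ℂ} (hf : Continuous f) {M : ℝ} (hM : 0 < M)
    (h : ∫ x in (0:ℝ)..1, ‖f x‖ ^ 2 ≤ M ^ 2) : ∫ x in (0:ℝ)..1, ‖f x‖ ≤ M := by
  have h1 : ∫ x in (0:ℝ)..1, ‖f x‖ ≤ ∫ x in (0:ℝ)..1, (‖f x‖ ^ 2 * (2 * M)⁻¹ + M / 2) := by
    apply intervalIntegral.integral_mono_on zero_le_one
    · exact (by fun_prop : Continuous fun x => ‖f x‖).intervalIntegrable _ _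
    · exact (by fun_prop : Continuous fun x => ‖f x‖ ^ 2 * (2 * M)⁻¹ + M / 2).intervalIntegrable _ _
    · intro x _
      rw [← sub_nonneg]
      have : ‖f x‖ ^ 2 * (2 * M)⁻¹ + M / 2 - ‖f x‖ = (‖f x‖ - M) ^ 2 / (2 * M) := by
        field_simp; ring
      rw [this]; positivity
  rw [intervalIntegral.integral_add
    ((by fun_prop : Continuous fun x => ‖f x‖ ^ 2 * (2 * M)⁻¹).intervalIntegrable _ _) (by simp),
    intervalIntegral.integral_mul_const] at h1
  simp only [intervalIntegral.integral_const, sub_zero, smul_eq_mul, one_mul] at h1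
  refine h1.trans ?_
  calc _ ≤ M ^ 2 * (2 * M)⁻¹ + M / 2 := by gcongr
    _ = M := by field_simp; ring

lemma integral_norm_le_of_sobolev {n : ℕ} {f : ℝ → ℂ} (hf : Continuous f) {M : ℝ} (hM : 0 < M)
    (h : Real.sqrt (∑ k ∈ Finset.range (n+1),
      ∫ x in (0:ℝ)..1, ‖iteratedDeriv k f x‖^2) ≤ M) : ∫ x in (0:ℝ)..1, ‖f x‖ ≤ M := by
  apply integral_norm_le_of_integral_sq_le_s13 hf hM
  rw [Real.sqrt_le_left hM.le] at h
  refine le_trans ?_ h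
  have := Finset.single_le_sum (f := fun k => ∫ x in (0:ℝ)..1, ‖iteratedDeriv k f x‖^2)
    (s := Finset.range (n+1)) (fun k _ => intervalIntegral.integral_nonneg zero_le_one
      fun x _ => by positivity) (Finset.mem_range.2 n.succ_pos)
  simpa using this

lemma half_le_arctan {t : ℝ} (h0 : 0 ≤ t) (h1 : t ≤ 1) : t / 2 ≤ Real.arctan t := by
  have hs := Real.sin_le (Real.arctan_nonneg.2 h0)
  rw [Real.sin_arctan] at hs
  refine le_trans ?_ hs
  have : √(1 + t ^ 2) ≤ 2 := by rw [Real.sqrt_le_left (by norm_num)]; nlinarith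
  have h' : 0 < √(1 + t ^ 2) := Real.sqrt_pos.2 (by positivity)
  gcongr

/-- The data integral extends to an entire function, with a bound of exponential type. -/
lemma exists_entire_extension {f : ℝ → ℂ} (hf : Continuous f) {L : ℝ}
    (hL : ∫ x in (0:ℝ)..1, ‖f x‖ ≤ L) :
    ∃ F : ℂ → ℂ, Differentiable ℂ F ∧ F 0 = 0 ∧
      (∀ z : ℂ, |z.im| ≤ z.re → ‖F z‖ ≤ 4 * L ^ 2 * Real.exp (3 * z.re)) ∧
      ∀ s : ℝ, F s = ((∫ κ in (0:ℝ)..s, (‖unitLaplace f (Complex.I * κ)‖ ^ 2 +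
        ‖unitLaplace f (-(Complex.I * κ))‖ ^ 2) : ℝ) : ℂ) := by
  set g : ℝ → ℂ := fun x => (starRingEnd ℂ) (f x) with hg
  have hgc : Continuous g := Complex.continuous_conj.comp hf
  have hgL : ∫ x in (0:ℝ)..1, ‖g x‖ ≤ L := by simpa [hg] using hL
  have hL0 : 0 ≤ L := (intervalIntegral.integral_nonneg zero_le_one
    fun x _ => norm_nonneg _).trans hL
  set G : ℂ → ℂ := fun z =>
    unitLaplace f (Complex.I * z) * unitLaplace g (-(Complex.I * z)) +
    unitLaplace f (-(Complex.I * z)) * unitLaplace g (Complex.I * z) with hG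
  have hfd := differentiable_unitLaplace hf
  have hgd := differentiable_unitLaplace hgc
  have hGd : Differentiable ℂ G := by
    have h1 : Differentiable ℂ fun z : ℂ => Complex.I * z := by fun_prop
    have h2 : Differentiable ℂ fun z : ℂ => -(Complex.I * z) := by fun_prop
    exact ((hfd.comp h1).mul (hgd.comp h2)).add ((hfd.comp h2).mul (hgd.comp h1))
  have hGbound (z : ℂ) (m : ℝ) (hz : |z.im| ≤ m) : ‖G z‖ ≤ 2 * L ^ 2 * Real.exp (2 * m) := by
    have hb {φ : ℝ → ℂ} (hφ : Continuous φ) (hφL : ∫ x in (0:ℝ)..1, ‖φ x‖ ≤ L) {w : ℂ}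
        (hw : |w.re| ≤ m) : ‖unitLaplace φ w‖ ≤ Real.exp m * L :=
      (norm_unitLaplace_le hφ hw).trans (by gcongr)
    have hw₁ : |(Complex.I * z).re| ≤ m := by simpa
    have hw₂ : |(-(Complex.I * z)).re| ≤ m := by simpa
    calc ‖G z‖ ≤ (Real.exp m * L) * (Real.exp m * L) + (Real.exp m * L) * (Real.exp m * L) := by
          refine (norm_add_le _ _).trans ?_
          rw [norm_mul, norm_mul]
          gcongr
          exacts [hb hf hL hw₁, hb hgc hgL hw₂, hb hf hL hw₂, hb hgc hgL hw₁]
      _ = _ := by rw [two_mul m, Real.exp_add]; ring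
  obtain ⟨F₀, hF₀⟩ := hGd.isExactOn_univ
  have hF (z : ℂ) : HasDerivAt (fun z => F₀ z - F₀ 0) (G z) z := (hF₀ z trivial).sub_const _
  refine ⟨fun z => F₀ z - F₀ 0, fun z => (hF z).differentiableAt, sub_self _, fun z hz => ?_,
    fun s => ?_⟩
  · have hre : 0 ≤ z.re := (abs_nonneg _).trans hz
    have key := (convex_segment (0 : ℂ) z).norm_image_sub_le_of_norm_hasDerivWithin_le
      (f := F₀) (f' := G) (C := 2 * L ^ 2 * Real.exp (2 * z.re))
      (fun w _ => (hF₀ w trivial).hasDerivWithinAt) (fun w hw => ?_)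
      (left_mem_segment ℝ 0 z) (right_mem_segment ℝ 0 z)
    · rw [sub_zero] at key
      have hzn : ‖z‖ ≤ 2 * Real.exp z.re := by
        have := Complex.norm_le_abs_re_add_abs_im z
        rw [abs_of_nonneg hre] at this
        linarith [Real.add_one_le_exp z.re]
      calc _ ≤ 2 * L ^ 2 * Real.exp (2 * z.re) * ‖z‖ := key
        _ ≤ 2 * L ^ 2 * Real.exp (2 * z.re) * (2 * Real.exp z.re) := by gcongr
        _ = _ := by rw [show 3 * z.re = 2 * z.re + z.re by ring, Real.exp_add]; ring
    · apply hGbound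
      rw [segment_eq_image'] at hw
      obtain ⟨t, ht, rfl⟩ := hw
      have : ((0 : ℂ) + t • (z - 0)).im = t * z.im := by simp
      rw [this, abs_mul, abs_of_nonneg ht.1]
      nlinarith [ht.1, ht.2, abs_nonneg z.im]
  · have hGreal (κ : ℝ) : G κ = ((‖unitLaplace f (Complex.I * κ)‖ ^ 2 +
        ‖unitLaplace f (-(Complex.I * κ))‖ ^ 2 : ℝ) : ℂ) := by
      push_cast
      rw [← Complex.mul_conj', ← Complex.mul_conj', conj_unitLaplace, conj_unitLaplace]
      simp [hG, hg]
    rw [← intervalIntegral.integral_ofReal, ← intervalIntegral.integral_congr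
      (f := fun κ : ℝ => G κ) (fun κ _ => hGreal κ)]
    rw [intervalIntegral.integral_eq_sub_of_hasDerivAt (f := fun κ : ℝ => F₀ κ)
      (fun κ _ => (hF₀ κ trivial).comp_ofReal)
      ((hGd.continuous.comp Complex.continuous_ofReal).intervalIntegrable _ _)]
    simp

lemma two_rpow_quarter_pow_four : ((2:ℝ) ^ ((1:ℝ) / 4)) ^ 4 = 2 := by
  rw [← Real.rpow_natCast, ← Real.rpow_mul (by norm_num)]
  norm_num

/-- Lemma 3.6 of the paper (first estimate): decay of the analytically continued
data integral `I₁` beyond the frequency band `(0, K]`. -/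
theorem continued_data_bound_I1 :
    ∃ C > (0:ℝ), ∀ (n : ℕ), 1 ≤ n → ∀ (M K : ℝ), 1 < M → 1 < K →
    ∀ (f₁ f₂ : ℝ → ℂ), ContDiff ℝ n f₁ → ContDiff ℝ n f₂ →
    tsupport f₁ ⊆ Set.Ioo 0 1 → tsupport f₂ ⊆ Set.Ioo 0 1 →
    Real.sqrt (∑ k ∈ Finset.range (n+1),
      ∫ x in (0:ℝ)..1, ‖iteratedDeriv k f₁ x‖^2) ≤ M →
    Real.sqrt (∑ k ∈ Finset.range (n+1),
      ∫ x in (0:ℝ)..1, ‖iteratedDeriv k f₂ x‖^2) ≤ M →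
    ∀ I₁ : ℝ → ℝ,
      (∀ s : ℝ, I₁ s = ∫ κ in (0:ℝ)..s,
        (‖∫ x in (0:ℝ)..1, Complex.exp (Complex.I * κ * x) * (f₁ x - f₂ x)‖^2 +
         ‖∫ x in (0:ℝ)..1, Complex.exp (-(Complex.I * κ * x)) * (f₁ x - f₂ x)‖^2)) →
    ∀ ε₁ : ℝ, ε₁ = Real.sqrt (I₁ K) → 0 < ε₁ → ε₁ < 1 →
    ∃ μ : ℝ → ℝ,
      (∀ s ∈ Set.Ioo K ((2:ℝ)^((1:ℝ)/4) * K), μ s ≥ 1/2) ∧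
      (∀ s ∈ Set.Ioi ((2:ℝ)^((1:ℝ)/4) * K), μ s ≥ (1/π) * ((s/K)^4 - 1)^(-(1:ℝ)/2)) ∧
      (∀ s ∈ Set.Ioi K, I₁ s ≤ C * M^2 * Real.exp (3*s) * ε₁^(2 * μ s)) := by
  refine ⟨16, by norm_num, ?_⟩
  intro n _ M K hM hK f₁ f₂ hf₁ hf₂ _ _ hN₁ hN₂ I₁ hI ε₁ hε hε0 hε1
  have hM0 : 0 < M := by linarith
  have hK0 : 0 < K := by linarith
  set f : ℝ → ℂ := fun x => f₁ x - f₂ x with hf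
  have hfc : Continuous f := hf₁.continuous.sub hf₂.continuous
  have hL : ∫ x in (0:ℝ)..1, ‖f x‖ ≤ 2 * M := by
    have i₁ : IntervalIntegrable (fun x => ‖f₁ x‖) volume 0 1 :=
      hf₁.continuous.norm.intervalIntegrable _ _
    have i₂ : IntervalIntegrable (fun x => ‖f₂ x‖) volume 0 1 :=
      hf₂.continuous.norm.intervalIntegrable _ _
    calc _ ≤ ∫ x in (0:ℝ)..1, (‖f₁ x‖ + ‖f₂ x‖) :=
          intervalIntegral.integral_mono_on zero_le_one (hfc.norm.intervalIntegrable _ _)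
            (i₁.add i₂) fun x _ => norm_sub_le _ _
      _ ≤ 2 * M := by
          rw [intervalIntegral.integral_add i₁ i₂]
          linarith [integral_norm_le_of_sobolev hf₁.continuous hM0 hN₁,
            integral_norm_le_of_sobolev hf₂.continuous hM0 hN₂]
  obtain ⟨F, hFd, hF0, hFb, hFI⟩ := exists_entire_extension hfc hL
  have hIdef (s : ℝ) : I₁ s = ∫ κ in (0:ℝ)..s, (‖unitLaplace f (Complex.I * κ)‖ ^ 2 +
      ‖unitLaplace f (-(Complex.I * κ))‖ ^ 2) := by
    simp only [hI s, unitLaplace, hf, neg_mul]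
  have hFI' (s : ℝ) : F s = (I₁ s : ℂ) := by rw [hFI, hIdef]
  have hcont : Continuous fun κ : ℝ => ‖unitLaplace f (Complex.I * κ)‖ ^ 2 +
      ‖unitLaplace f (-(Complex.I * κ))‖ ^ 2 := by
    have := (differentiable_unitLaplace hfc).continuous
    fun_prop
  have hI0 (t : ℝ) (ht : 0 ≤ t) : 0 ≤ I₁ t := by
    rw [hIdef]
    exact intervalIntegral.integral_nonneg ht fun κ _ => by positivity
  have hImono (t : ℝ) (ht : 0 ≤ t) (htK : t ≤ K) : I₁ t ≤ I₁ K := by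
    rw [hIdef, hIdef]
    exact intervalIntegral.integral_mono_interval le_rfl ht htK
      (Filter.Eventually.of_forall fun κ => by positivity) (hcont.intervalIntegrable _ _)
  have hεsq : I₁ K = ε₁ ^ 2 := by rw [hε, Real.sq_sqrt (hI0 K hK0.le)]
  refine ⟨fun s => 2 / π * Real.arctan (K ^ 2 / √(s ^ 4 - K ^ 4)), ?_, ?_, ?_⟩
  · rintro s ⟨hs, hs'⟩
    have hs0 : 0 < s := hK0.trans hs
    have h4 : s ^ 4 < 2 * K ^ 4 := by
      calc s ^ 4 < ((2:ℝ) ^ ((1:ℝ) / 4) * K) ^ 4 := by gcongr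
        _ = 2 * K ^ 4 := by rw [mul_pow, two_rpow_quarter_pow_four]
    have hK4 : K ^ 4 < s ^ 4 := by gcongr
    have hle : √(s ^ 4 - K ^ 4) ≤ K ^ 2 := by
      rw [Real.sqrt_le_left (by positivity)]
      nlinarith
    have h1 : 1 ≤ K ^ 2 / √(s ^ 4 - K ^ 4) := by
      rwa [one_le_div (Real.sqrt_pos.2 (by linarith))]
    have h2 := Real.arctan_mono h1
    rw [Real.arctan_one] at h2
    calc 2 / π * Real.arctan (K ^ 2 / √(s ^ 4 - K ^ 4)) ≥ 2 / π * (π / 4) := by gcongr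
      _ = 1 / 2 := by field_simp; norm_num
  · intro s hs
    have h4 : 2 * K ^ 4 < s ^ 4 := by
      calc 2 * K ^ 4 = ((2:ℝ) ^ ((1:ℝ) / 4) * K) ^ 4 := by rw [mul_pow, two_rpow_quarter_pow_four]
        _ < s ^ 4 := by gcongr; exact hs
    have hK4 : 0 < K ^ 4 := by positivity
    have hle : K ^ 2 ≤ √(s ^ 4 - K ^ 4) := Real.le_sqrt_of_sq_le (by nlinarith)
    have hpos : 0 < √(s ^ 4 - K ^ 4) := Real.sqrt_pos.2 (by linarith)
    have h1 : K ^ 2 / √(s ^ 4 - K ^ 4) ≤ 1 := by rwa [div_le_one hpos]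
    have heq : ((s / K) ^ 4 - 1) ^ (-(1:ℝ) / 2) = K ^ 2 / √(s ^ 4 - K ^ 4) := by
      have e1 : (s / K) ^ 4 - 1 = (s ^ 4 - K ^ 4) / (K ^ 2) ^ 2 := by
        field_simp
      have e2 : 0 ≤ (s ^ 4 - K ^ 4) / (K ^ 2) ^ 2 := div_nonneg (by linarith) (by positivity)
      rw [e1, neg_div, Real.rpow_neg e2, ← Real.sqrt_eq_rpow, Real.sqrt_div (by linarith),
        Real.sqrt_sq (by positivity), inv_div]
    rw [heq]
    have h2 := half_le_arctan (t := K ^ 2 / √(s ^ 4 - K ^ 4)) (by positivity) h1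
    calc 2 / π * Real.arctan (K ^ 2 / √(s ^ 4 - K ^ 4))
        ≥ 2 / π * (K ^ 2 / √(s ^ 4 - K ^ 4) / 2) := by gcongr
      _ = _ := by ring
  · intro s hs
    have key := norm_le_of_sector_of_slit (A := 3) (B := 16 * M ^ 2) (δ := ε₁ ^ 2) hFd hF0
      (by norm_num) (by nlinarith) hK0 (by positivity) (by nlinarith)
      (fun z hz => (hFb z hz).trans_eq (by ring)) (fun t ht htK => by
        rw [hFI', Complex.norm_real, Real.norm_eq_abs, abs_of_nonneg (hI0 t ht), ← hεsq]
        exact hImono t ht htK) hs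
    rw [hFI', Complex.norm_real] at key
    rw [Real.rpow_mul hε0.le, Real.rpow_two]
    exact (le_abs_self _).trans key
end
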